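/- Let D ⊂ ℂ be a domain and let ρ : D → [-∞,∞) be a subharmonic function that is bounded from below. Let z₁⁰ ∈ D be a point such that there is no open connected neighborhood U ⊂ D of z₁⁰ on which ρ is constant. Then ρ(z₁⁰) = ρ̃*(z₁⁰). -/

import Mathlib

open MeasureTheory Filter Metric Set

/-- `elog x` is `log x` with value `-∞` for `x ≤ 0`, as an extended real. -/
noncomputable def elog (x : ℝ) : EReal := if x ≤ 0 then ⊥ else ((Real.log x : ℝ) : EReal)

/-- The sub-mean value inequality over circles of closed discs contained in `Ω`, phrased via
continuous real-valued majorants of the (extended-real-valued) function on the circle. -/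
def SubmeanOn (u : ℂ → EReal) (Ω : Set ℂ) : Prop :=
  ∀ c : ℂ, ∀ r : ℝ, 0 < r → Metric.closedBall c r ⊆ Ω →
    ∀ φ : ℝ → ℝ, Continuous φ →
      (∀ θ : ℝ, u (c + r * Complex.exp (θ * Complex.I)) ≤ ((φ θ : ℝ) : EReal)) →
      u c ≤ (((2 * Real.pi)⁻¹ * ∫ θ in (0:ℝ)..(2 * Real.pi), φ θ : ℝ) : EReal)

/-- `u : Ω → [-∞, ∞)` is subharmonic on the open set `Ω ⊆ ℂ`: upper semicontinuous,
nowhere `+∞`, not identically `-∞` on any connected component, sub-mean value inequality. -/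
def SubharmonicOn (u : ℂ → EReal) (Ω : Set ℂ) : Prop :=
  IsOpen Ω ∧ UpperSemicontinuousOn u Ω ∧
  (∀ z ∈ Ω, u z ≠ ⊤) ∧
  (∀ z ∈ Ω, ∃ w ∈ connectedComponentIn Ω z, u w ≠ ⊥) ∧
  SubmeanOn u Ω

/-- A set `E ⊆ ℂ` is polar if some subharmonic function on an open set containing `E`
equals `-∞` on `E`. -/
def PolarSet (E : Set ℂ) : Prop :=
  ∃ Ω : Set ℂ, E ⊆ Ω ∧ ∃ u : ℂ → EReal, SubharmonicOn u Ω ∧ ∀ z ∈ E, u z = ⊥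

/-- The space of square-integrable holomorphic functions on `D`. -/
def L2h {E : Type*} [NormedAddCommGroup E] [NormedSpace ℂ E] [MeasureSpace E]
    (D : Set E) : Set (E → ℂ) :=
  {f | DifferentiableOn ℂ f D ∧ IntegrableOn (fun z => ‖f z‖ ^ 2) D volume}

/-- `D` is an `L²ₕ`-domain of holomorphy. -/
def IsL2hDomainOfHolomorphy {E : Type*} [NormedAddCommGroup E] [NormedSpace ℂ E]
    [MeasureSpace E] (D : Set E) : Prop :=
  ¬ ∃ D₀ D₁ : Set E, IsOpen D₀ ∧ IsConnected D₀ ∧ IsOpen D₁ ∧ IsConnected D₁ ∧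
      D₀ ⊆ D₁ ∩ D ∧ ¬ (D₁ ⊆ D) ∧
      ∀ f ∈ L2h D, ∃ g : E → ℂ, DifferentiableOn ℂ g D₁ ∧ Set.EqOn g f D₀

/-- The Hartogs domain `G_{D,ρ} = {(z₁,z₂) : z₁ ∈ D, |z₂| < e^{-ρ(z₁)}}`. -/
def hartogs (D : Set ℂ) (ρ : ℂ → EReal) : Set (ℂ × ℂ) :=
  {p | p.1 ∈ D ∧ elog ‖p.2‖ < - ρ p.1}

/-- `S(D)`: boundary points near which the complement of `D` is polar. -/
def polarS (D : Set ℂ) : Set ℂ :=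
  {z ∈ frontier D | ∃ U : Set ℂ, IsOpen U ∧ z ∈ U ∧ PolarSet (U \ D)}

/-- `fj` is the family of coefficients of a Hartogs expansion of `f` on `G_{D,ρ}`. -/
def HartogsExpansion (D : Set ℂ) (ρ : ℂ → EReal) (f : ℂ × ℂ → ℂ) (fj : ℕ → ℂ → ℂ) : Prop :=
  (∀ j, DifferentiableOn ℂ (fj j) D) ∧
  ∀ p ∈ hartogs D ρ, HasSum (fun j => fj j p.1 * p.2 ^ j) (f p)

/-- `ρ_f(z) = limsup_j (1/j) log |f_j(z)|` for coefficients `fj`. -/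
noncomputable def coeffGrowth (fj : ℕ → ℂ → ℂ) (z : ℂ) : EReal :=
  Filter.limsup (fun (j : ℕ) => ((((j : ℝ)⁻¹ : ℝ)) : EReal) * elog ‖fj j z‖) Filter.atTop

/-- The upper semicontinuous regularization `g*`. -/
noncomputable def uscReg (g : ℂ → EReal) (z : ℂ) : EReal := Filter.limsup g (nhds z)

/-- `ρ̃ = sup_{f ∈ L²ₕ(G_{D,ρ})} (ρ_f)*`. -/
noncomputable def rhoTilde (D : Set ℂ) (ρ : ℂ → EReal) (z : ℂ) : EReal :=
  ⨆ fj ∈ {fj : ℕ → ℂ → ℂ | ∃ f ∈ L2h (hartogs D ρ), HartogsExpansion D ρ f fj},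
    uscReg (coeffGrowth fj) z

/-- `D̂ = D ∪ {z ∈ S(D) : limsup_{D ∋ w → z} ρ(w) < ∞}`. -/
def DHat (D : Set ℂ) (ρ : ℂ → EReal) : Set ℂ :=
  D ∪ {z ∈ polarS D | Filter.limsup ρ (nhdsWithin z D) < ⊤}

open Classical in
/-- `ρ̂`, extending `ρ` to `D̂` by boundary limsups. -/
noncomputable def rhoHat (D : Set ℂ) (ρ : ℂ → EReal) (z : ℂ) : EReal :=
  if z ∈ D then ρ z else Filter.limsup ρ (nhdsWithin z D)

/-- `u` is plurisubharmonic on an open `Ω ⊆ ℂⁿ`. -/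
def PlurisubharmonicOn {n : ℕ} (u : (Fin n → ℂ) → EReal) (Ω : Set (Fin n → ℂ)) : Prop :=
  IsOpen Ω ∧ UpperSemicontinuousOn u Ω ∧
  (∀ z ∈ Ω, u z ≠ ⊤) ∧
  (∀ z ∈ Ω, ∃ w ∈ connectedComponentIn Ω z, u w ≠ ⊥) ∧
  ∀ a b : Fin n → ℂ, SubmeanOn (fun lam => u (a + lam • b)) {lam : ℂ | a + lam • b ∈ Ω}

/-- A set `E ⊆ ℂⁿ` is pluripolar. -/
def PluripolarSet {n : ℕ} (E : Set (Fin n → ℂ)) : Prop :=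
  ∃ Ω : Set (Fin n → ℂ), E ⊆ Ω ∧
    ∃ u : (Fin n → ℂ) → EReal, PlurisubharmonicOn u Ω ∧ ∀ z ∈ E, u z = ⊥

/-- `D ⊆ ℂⁿ` is pseudoconvex: it admits a plurisubharmonic exhaustion function. -/
def IsPseudoconvex {n : ℕ} (D : Set (Fin n → ℂ)) : Prop :=
  ∃ u : (Fin n → ℂ) → EReal, PlurisubharmonicOn u D ∧
    ∀ c : ℝ, IsCompact {z | z ∈ D ∧ u z ≤ (c : EReal)}

/-- `L²ₕ(D)` is infinite dimensional: arbitrarily many elements that are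
linearly independent as functions on `D`. -/
def L2hInfiniteDim {E : Type*} [NormedAddCommGroup E] [NormedSpace ℂ E] [MeasureSpace E]
    (D : Set E) : Prop :=
  ∀ N : ℕ, ∃ fs : Fin N → E → ℂ, (∀ i, fs i ∈ L2h D) ∧
    ∀ c : Fin N → ℂ, (∀ z ∈ D, ∑ i, c i * fs i z = 0) → c = 0

open scoped ContDiff ComplexConjugate Topology

/-- The Wirtinger derivative `∂/∂z` of a real-differentiable function. -/
noncomputable def dz (f : ℂ → ℂ) (z : ℂ) : ℂ :=
  (fderiv ℝ f z 1 - Complex.I * fderiv ℝ f z Complex.I) / 2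

/-- The Wirtinger derivative `∂/∂z̄` of a real-differentiable function. -/
noncomputable def dzb (f : ℂ → ℂ) (z : ℂ) : ℂ :=
  (fderiv ℝ f z 1 + Complex.I * fderiv ℝ f z Complex.I) / 2

/-- The real-linear map `v ↦ a v + b v̄`. -/
noncomputable def wlin (a b : ℂ) : ℂ →L[ℝ] ℂ :=
  a • (ContinuousLinearMap.id ℝ ℂ) + b • (Complex.conjCLE : ℂ →L[ℝ] ℂ)

@[simp] lemma wlin_apply (a b v : ℂ) : wlin a b v = a * v + b * conj v := by
  simp [wlin]

/-- `f` is real-differentiable at `z` with Wirtinger derivatives `a = ∂f/∂z`, `b = ∂f/∂z̄`. -/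
def HasW (f : ℂ → ℂ) (a b z : ℂ) : Prop := HasFDerivAt f (wlin a b) z

lemma HasW.dz {f : ℂ → ℂ} {a b z : ℂ} (h : HasW f a b z) : dz f z = a := by
  have := HasFDerivAt.fderiv h
  simp only [_root_.dz, this, wlin_apply, map_one, Complex.conj_I]
  linear_combination (-a / 2 + b / 2) * Complex.I_sq

lemma HasW.dzb {f : ℂ → ℂ} {a b z : ℂ} (h : HasW f a b z) : dzb f z = b := by
  have := HasFDerivAt.fderiv h
  simp only [_root_.dzb, this, wlin_apply, map_one, Complex.conj_I]
  linear_combination (a / 2 - b / 2) * Complex.I_sq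

lemma HasW.congr_val {f : ℂ → ℂ} {a b a' b' z : ℂ} (h : HasW f a b z) (ha : a = a') (hb : b = b') :
    HasW f a' b' z := by subst ha hb; exact h

lemma fderiv_eq_wlin {f : ℂ → ℂ} {z : ℂ} : fderiv ℝ f z = wlin (dz f z) (dzb f z) := by
  ext v
  have : fderiv ℝ f z v = v.re • fderiv ℝ f z 1 + v.im • fderiv ℝ f z Complex.I := by
    rw [← map_smul, ← map_smul, ← map_add]
    congr 1
    simp [Complex.re_add_im]
  rw [this, wlin_apply, dz, dzb]
  conv_rhs => rw [← Complex.re_add_im v]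
  simp only [map_add, map_mul, Complex.conj_ofReal, Complex.conj_I, Complex.real_smul]
  linear_combination (v.im * fderiv ℝ f z Complex.I) * Complex.I_sq

lemma DifferentiableAt.hasW {f : ℂ → ℂ} {z : ℂ} (h : DifferentiableAt ℝ f z) :
    HasW f (_root_.dz f z) (_root_.dzb f z) z := by
  rw [HasW, ← fderiv_eq_wlin]; exact h.hasFDerivAt

lemma hasW_const (c z : ℂ) : HasW (fun _ => c) 0 0 z := by
  have : wlin 0 0 = 0 := by ext; simp
  rw [HasW, this]; exact hasFDerivAt_const c z

lemma HasW.add {f g : ℂ → ℂ} {a b a' b' z : ℂ} (hf : HasW f a b z) (hg : HasW g a' b' z) :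
    HasW (fun z => f z + g z) (a + a') (b + b') z := by
  have : wlin (a + a') (b + b') = wlin a b + wlin a' b' := by ext; simp; ring
  rw [HasW, this]; exact HasFDerivAt.add hf hg

lemma HasW.neg {f : ℂ → ℂ} {a b z : ℂ} (hf : HasW f a b z) :
    HasW (fun z => - f z) (-a) (-b) z := by
  have : wlin (-a) (-b) = - wlin a b := by ext; simp; ring
  rw [HasW, this]; exact HasFDerivAt.neg hf

lemma HasW.mul {f g : ℂ → ℂ} {a b a' b' z : ℂ} (hf : HasW f a b z) (hg : HasW g a' b' z) :
    HasW (fun z => f z * g z) (a * g z + f z * a') (b * g z + f z * b') z := by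
  have : wlin (a * g z + f z * a') (b * g z + f z * b') = f z • wlin a' b' + g z • wlin a b := by
    ext; simp; ring
  rw [HasW, this]; exact HasFDerivAt.mul hf hg

lemma HasW.conj {f : ℂ → ℂ} {a b z : ℂ} (hf : HasW f a b z) :
    HasW (fun z => conj (f z)) (conj b) (conj a) z := by
  have : wlin (conj b) (conj a) = (Complex.conjCLE : ℂ →L[ℝ] ℂ).comp (wlin a b) := by
    ext; simp; ring
  rw [HasW, this]
  exact (Complex.conjCLE : ℂ →L[ℝ] ℂ).hasFDerivAt.comp z hf

/-- Chain rule with a holomorphic outer function. -/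
lemma HasW.hcomp {f g : ℂ → ℂ} {a b g' z : ℂ} (hg : HasDerivAt g g' (f z)) (hf : HasW f a b z) :
    HasW (fun z => g (f z)) (g' * a) (g' * b) z := by
  have h1 := (hg.hasFDerivAt.restrictScalars ℝ).comp z (show HasFDerivAt f (wlin a b) z from hf)
  have : wlin (g' * a) (g' * b) =
     ((ContinuousLinearMap.toSpanSingleton ℂ g').restrictScalars ℝ).comp (wlin a b) := by
    ext; simp; ring
  rw [HasW, this]; exact h1

lemma HasDerivAt.hasW {g : ℂ → ℂ} {g' z : ℂ} (hg : HasDerivAt g g' z) : HasW g g' 0 z := by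
  have h1 := hg.hasFDerivAt.restrictScalars ℝ
  have : wlin g' 0 = ((ContinuousLinearMap.toSpanSingleton ℂ g').restrictScalars ℝ) := by
    ext; simp; ring
  rw [HasW, this]; exact h1

lemma hasW_id (z : ℂ) : HasW (fun z => z) 1 0 z := (hasDerivAt_id z).hasW

lemma HasW.cexp {f : ℂ → ℂ} {a b z : ℂ} (hf : HasW f a b z) :
    HasW (fun z => Complex.exp (f z)) (Complex.exp (f z) * a) (Complex.exp (f z) * b) z :=
  HasW.hcomp (Complex.hasDerivAt_exp _) hf

/-- Chain rule with a real outer function, for a real-valued function. -/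
lemma HasW.rcomp {f : ℂ → ℝ} {g : ℝ → ℝ} {a b z : ℂ} {g' : ℝ} (hg : HasDerivAt g g' (f z))
    (hf : HasW (fun z => (f z : ℂ)) a b z) :
    HasW (fun z => (g (f z) : ℂ)) (g' * a) (g' * b) z := by
  have hf' : HasFDerivAt f (Complex.reCLM.comp (wlin a b)) z := by
    have := Complex.reCLM.hasFDerivAt.comp z (show HasFDerivAt _ (wlin a b) z from hf)
    simpa [Function.comp_def] using this
  have him : Complex.imCLM.comp (wlin a b) = 0 := by
    have := Complex.imCLM.hasFDerivAt.comp z (show HasFDerivAt _ (wlin a b) z from hf)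
    refine this.unique ?_
    have h0 : (⇑Complex.imCLM ∘ fun z => (f z : ℂ)) = fun _ => 0 := by ext; simp
    rw [h0]; exact hasFDerivAt_const _ _
  have h2 := Complex.ofRealCLM.hasFDerivAt.comp z (hg.hasFDerivAt.comp z hf')
  have : wlin (g' * a) (g' * b) = Complex.ofRealCLM.comp
     ((ContinuousLinearMap.toSpanSingleton ℝ g').comp (Complex.reCLM.comp (wlin a b))) := by
    ext v
    have hv : (wlin a b v).im = 0 := by simpa using congrArg (fun L => L v) him
    have hv2 : wlin a b v = ((wlin a b v).re : ℂ) := by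
      apply Complex.ext <;> simp [-wlin_apply, hv]
    have h3 : wlin (g' * a) (g' * b) v = g' * wlin a b v := by simp; ring
    rw [h3, hv2]
    simp [-wlin_apply]; ring
  rw [HasW, this]; exact h2

lemma contDiff_dz {f : ℂ → ℂ} {n m : ℕ∞ω} (hf : ContDiff ℝ n f) (h : m + 1 ≤ n) :
    ContDiff ℝ m (dz f) := by
  have := hf.fderiv_right h
  unfold dz
  exact ((this.clm_apply contDiff_const).sub
    (contDiff_const.mul (this.clm_apply contDiff_const))).div_const 2

lemma contDiff_dzb {f : ℂ → ℂ} {n m : ℕ∞ω} (hf : ContDiff ℝ n f) (h : m + 1 ≤ n) :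
    ContDiff ℝ m (dzb f) := by
  have := hf.fderiv_right h
  unfold dzb
  exact ((this.clm_apply contDiff_const).add
    (contDiff_const.mul (this.clm_apply contDiff_const))).div_const 2

lemma ContDiff.dz {f : ℂ → ℂ} (hf : ContDiff ℝ ∞ f) : ContDiff ℝ ∞ (_root_.dz f) :=
  contDiff_dz hf (by simp)

lemma ContDiff.dzb {f : ℂ → ℂ} (hf : ContDiff ℝ ∞ f) : ContDiff ℝ ∞ (_root_.dzb f) :=
  contDiff_dzb hf (by simp)

lemma ContDiff.hasW {f : ℂ → ℂ} (hf : ContDiff ℝ ∞ f) (z : ℂ) :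
    HasW f (_root_.dz f z) (_root_.dzb f z) z :=
  (hf.differentiable (by simp) z).hasW

lemma dz_dzb_comm {f : ℂ → ℂ} (hf : ContDiff ℝ ∞ f) (z : ℂ) : dzb (dz f) z = dz (dzb f) z := by
  have hsym : ∀ v w, fderiv ℝ (fderiv ℝ f) z v w = fderiv ℝ (fderiv ℝ f) z w v := by
    intro v w
    have := (hf.contDiffAt (x := z)).isSymmSndFDerivAt (by simp; exact WithTop.coe_le_coe.2 (le_top : (2:ℕ∞) ≤ ⊤))
    exact this v w
  have h1 : DifferentiableAt ℝ (fderiv ℝ f) z :=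
    (hf.fderiv_right (m := ∞) (by simp)).differentiable (by simp) z
  have h2 : ∀ v w, fderiv ℝ (fun y => fderiv ℝ f y w) z v = fderiv ℝ (fderiv ℝ f) z v w := by
    intro v w
    rw [fderiv_clm_apply h1 (by fun_prop)]; simp
  have d : ∀ w, DifferentiableAt ℝ (fun y => fderiv ℝ f y w) z := fun w =>
    h1.clm_apply (by fun_prop)
  have e1 : ∀ v, fderiv ℝ (dz f) z v = (fderiv ℝ (fderiv ℝ f) z v 1
      - Complex.I * fderiv ℝ (fderiv ℝ f) z v Complex.I) / 2 := by
    intro v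
    have : HasFDerivAt (dz f) ((2:ℂ)⁻¹ • (fderiv ℝ (fun y => fderiv ℝ f y 1) z
       - Complex.I • fderiv ℝ (fun y => fderiv ℝ f y Complex.I) z)) z := by
      have := (((d 1).hasFDerivAt.sub ((d Complex.I).hasFDerivAt.const_mul Complex.I)).const_mul
        (2:ℂ)⁻¹)
      have hfun : dz f = fun y => (2:ℂ)⁻¹ * (fderiv ℝ f y 1 - Complex.I * fderiv ℝ f y Complex.I) := by
        funext y; rw [dz]; ring
      rw [hfun]; exact this
    rw [this.fderiv]; simp [h2]; ring
  have e2 : ∀ v, fderiv ℝ (dzb f) z v = (fderiv ℝ (fderiv ℝ f) z v 1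
      + Complex.I * fderiv ℝ (fderiv ℝ f) z v Complex.I) / 2 := by
    intro v
    have : HasFDerivAt (dzb f) ((2:ℂ)⁻¹ • (fderiv ℝ (fun y => fderiv ℝ f y 1) z
       + Complex.I • fderiv ℝ (fun y => fderiv ℝ f y Complex.I) z)) z := by
      have := (((d 1).hasFDerivAt.add ((d Complex.I).hasFDerivAt.const_mul Complex.I)).const_mul
        (2:ℂ)⁻¹)
      have hfun : dzb f = fun y => (2:ℂ)⁻¹ * (fderiv ℝ f y 1 + Complex.I * fderiv ℝ f y Complex.I) := by
        funext y; rw [dzb]; ring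
      rw [hfun]; exact this
    rw [this.fderiv]; simp [h2]; ring
  rw [dz, dzb, e1, e1, e2, e2, hsym 1 Complex.I]
  ring

lemma integral_fderiv_eq_zero {f : ℂ → ℂ} (hf : ContDiff ℝ 1 f) (hc : HasCompactSupport f)
    (v : ℂ) : ∫ z, fderiv ℝ f z v = 0 := by
  have := integral_mul_fderiv_eq_neg_fderiv_mul_of_integrable (μ := (volume : Measure ℂ))
    (f := fun _ : ℂ => (1:ℂ)) (g := f) (v := v) (by simp) ?_ ?_ (by fun_prop)
    (fun x _ => hf.differentiable (by simp) x)
  · simpa using this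
  · simp only [one_mul]
    exact ((hf.continuous_fderiv (by simp)).clm_apply continuous_const).integrable_of_hasCompactSupport
      (hc.fderiv_apply (𝕜 := ℝ) v)
  · simpa using hf.continuous.integrable_of_hasCompactSupport hc

lemma HasCompactSupport.dz {f : ℂ → ℂ} (hc : HasCompactSupport f) :
    HasCompactSupport (_root_.dz f) := by
  refine (hc.fderiv (𝕜 := ℝ)).mono ?_
  intro z hz
  contrapose! hz
  simp only [Function.mem_support, not_not] at hz
  simp [_root_.dz, hz]

lemma HasCompactSupport.dzb {f : ℂ → ℂ} (hc : HasCompactSupport f) :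
    HasCompactSupport (_root_.dzb f) := by
  refine (hc.fderiv (𝕜 := ℝ)).mono ?_
  intro z hz
  contrapose! hz
  simp only [Function.mem_support, not_not] at hz
  simp [_root_.dzb, hz]

lemma tsupport_dzb_subset {f : ℂ → ℂ} : tsupport (dzb f) ⊆ tsupport f := by
  refine (closure_mono ?_).trans (tsupport_fderiv_subset ℝ (f := f))
  intro z hz
  contrapose! hz
  simp only [Function.mem_support, not_not] at hz
  simp [dzb, hz]

lemma tsupport_dz_subset {f : ℂ → ℂ} : tsupport (dz f) ⊆ tsupport f := by
  refine (closure_mono ?_).trans (tsupport_fderiv_subset ℝ (f := f))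
  intro z hz
  contrapose! hz
  simp only [Function.mem_support, not_not] at hz
  simp [dz, hz]

lemma integrable_fderiv_apply {f : ℂ → ℂ} (hf : ContDiff ℝ 1 f) (hc : HasCompactSupport f)
    (v : ℂ) : Integrable (fun z => fderiv ℝ f z v) :=
  ((hf.continuous_fderiv (by simp)).clm_apply continuous_const).integrable_of_hasCompactSupport
      (hc.fderiv_apply (𝕜 := ℝ) v)

lemma integral_dz_eq_zero {f : ℂ → ℂ} (hf : ContDiff ℝ 1 f) (hc : HasCompactSupport f) :
    ∫ z, dz f z = 0 := by
  unfold dz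
  rw [integral_div, integral_sub (integrable_fderiv_apply hf hc _)
    ((integrable_fderiv_apply hf hc _).const_mul _), integral_const_mul,
    integral_fderiv_eq_zero hf hc, integral_fderiv_eq_zero hf hc]
  simp

lemma integral_dzb_eq_zero {f : ℂ → ℂ} (hf : ContDiff ℝ 1 f) (hc : HasCompactSupport f) :
    ∫ z, dzb f z = 0 := by
  unfold dzb
  rw [integral_div, integral_add (integrable_fderiv_apply hf hc _)
    ((integrable_fderiv_apply hf hc _).const_mul _), integral_const_mul,
    integral_fderiv_eq_zero hf hc, integral_fderiv_eq_zero hf hc]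
  simp

lemma dzb_conj {f : ℂ → ℂ} {z : ℂ} (h : DifferentiableAt ℝ f z) :
    dzb (fun z => conj (f z)) z = conj (dz f z) := h.hasW.conj.dzb

lemma dz_conj {f : ℂ → ℂ} {z : ℂ} (h : DifferentiableAt ℝ f z) :
    dz (fun z => conj (f z)) z = conj (dzb f z) := h.hasW.conj.dz

lemma ContDiff.conj {f : ℂ → ℂ} {n : ℕ∞ω} (hf : ContDiff ℝ n f) :
    ContDiff ℝ n (fun z => conj (f z)) :=
  (Complex.conjCLE : ℂ →L[ℝ] ℂ).contDiff.comp hf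

lemma ContDiff.ofReal' {f : ℂ → ℝ} {n : ℕ∞ω} (hf : ContDiff ℝ n f) :
    ContDiff ℝ n (fun z => (f z : ℂ)) :=
  Complex.ofRealCLM.contDiff.comp hf

/-- A quarter of the Laplacian: `∂²u/∂z∂z̄` of a real function. -/
noncomputable def qlap (u : ℂ → ℝ) (z : ℂ) : ℝ := (dz (dzb (fun z => (u z : ℂ))) z).re

lemma dzb_ofReal {u : ℂ → ℝ} (hu : ContDiff ℝ ∞ u) (z : ℂ) :
    dzb (fun z => (u z : ℂ)) z = conj (dz (fun z => (u z : ℂ)) z) := by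
  have := dzb_conj (f := fun z => (u z : ℂ)) (z := z)
    (hu.ofReal'.differentiable (by simp) z)
  simpa using this

lemma ofReal_qlap {u : ℂ → ℝ} (hu : ContDiff ℝ ∞ u) (z : ℂ) :
    (qlap u z : ℂ) = dz (dzb (fun z => (u z : ℂ))) z := by
  unfold qlap
  apply Complex.conj_eq_iff_re.1
  have h : dzb (fun z => (u z : ℂ)) = fun z => conj (dz (fun z => (u z : ℂ)) z) :=
    funext (dzb_ofReal hu)
  conv_lhs => rw [h]
  rw [dz_conj (hu.ofReal'.dz.differentiable (by simp) z), Complex.conj_conj,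
    dz_dzb_comm hu.ofReal']

lemma ContDiff.qlap {u : ℂ → ℝ} (hu : ContDiff ℝ ∞ u) : ContDiff ℝ ∞ (_root_.qlap u) :=
  Complex.reCLM.contDiff.comp hu.ofReal'.dzb.dz

/-- The basic twisted estimate for `∂̄` with weight `φ` and twist `w`. -/
lemma twisted_basic {φ w : ℂ → ℝ} {β : ℂ → ℂ} (hφ : ContDiff ℝ ∞ φ) (hw : ContDiff ℝ ∞ w)
    (hβ : ContDiff ℝ ∞ β) (hc : HasCompactSupport β) (hw0 : ∀ z, 0 ≤ w z) :
    ∫ z, (w z * qlap φ z - qlap w z) * ‖β z‖ ^ 2 * Real.exp (φ z) ≤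
    ∫ z, (w z * ‖dzb β z‖ ^ 2 + 2 * ‖dz (fun z => (w z : ℂ)) z‖ * ‖dzb β z‖ * ‖β z‖)
      * Real.exp (φ z) := by
  set φc : ℂ → ℂ := fun z => (φ z : ℂ) with hφc
  set wc : ℂ → ℂ := fun z => (w z : ℂ) with hwc
  have sφ : ContDiff ℝ ∞ φc := hφ.ofReal'
  have sw : ContDiff ℝ ∞ wc := hw.ofReal'
  have sE : ContDiff ℝ ∞ (fun z => Complex.exp (φc z)) := sφ.cexp
  have sb := hβ.dzb
  have sβc : ContDiff ℝ ∞ (fun z => conj (β z)) := hβ.conj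
  have sG : ContDiff ℝ ∞ (fun z => conj (dz β z) * Complex.exp (φc z)
      + conj (β z) * (Complex.exp (φc z) * dzb φc z)) :=
    (hβ.dz.conj.mul sE).add (sβc.mul (sE.mul sφ.dzb))
  have sF1 : ContDiff ℝ ∞ (fun z => dz wc z * β z * (conj (β z) * Complex.exp (φc z))) :=
    (sw.dz.mul hβ).mul (sβc.mul sE)
  have sF2 : ContDiff ℝ ∞ (fun z => wc z * β z * (conj (dz β z) * Complex.exp (φc z)
      + conj (β z) * (Complex.exp (φc z) * dzb φc z))) := (sw.mul hβ).mul sG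
  have sF3 : ContDiff ℝ ∞ (fun z => wc z * β z * (conj (dzb β z) * Complex.exp (φc z))) :=
    (sw.mul hβ).mul (sb.conj.mul sE)
  have c1 : HasCompactSupport (fun z => dz wc z * β z * (conj (β z) * Complex.exp (φc z))) :=
    (hc.mul_left (f' := β) (f := dz wc)).mul_right
  have c2 : HasCompactSupport (fun z => wc z * β z * (conj (dz β z) * Complex.exp (φc z)
      + conj (β z) * (Complex.exp (φc z) * dzb φc z))) :=
    (hc.mul_left (f' := β) (f := wc)).mul_right
  have c3 : HasCompactSupport (fun z => wc z * β z * (conj (dzb β z) * Complex.exp (φc z))) :=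
    (hc.mul_left (f' := β) (f := wc)).mul_right
  have i1 := integral_dzb_eq_zero (sF1.of_le (by simp)) c1
  have i2 := integral_dz_eq_zero (sF2.of_le (by simp)) c2
  have i3 := integral_dzb_eq_zero (sF3.of_le (by simp)) c3
  have n1 : Integrable (dzb _) := sF1.dzb.continuous.integrable_of_hasCompactSupport c1.dzb
  have n2 : Integrable (dz _) := sF2.dz.continuous.integrable_of_hasCompactSupport c2.dz
  have n3 : Integrable (dzb _) := sF3.dzb.continuous.integrable_of_hasCompactSupport c3.dzb
  have key : ∀ z, dzb (fun z => dz wc z * β z * (conj (β z) * Complex.exp (φc z))) z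
      - dz (fun z => wc z * β z * (conj (dz β z) * Complex.exp (φc z)
      + conj (β z) * (Complex.exp (φc z) * dzb φc z))) z
      + dzb (fun z => wc z * β z * (conj (dzb β z) * Complex.exp (φc z))) z
      = (((qlap w z - w z * qlap φ z) * ‖β z‖ ^ 2 - w z * ‖dz β z + dz φc z * β z‖ ^ 2
        + w z * ‖dzb β z‖ ^ 2 + 2 * (dz wc z * dzb β z * conj (β z)).re) * Real.exp (φ z) : ℝ) := by
    intro z
    have hβz := hβ.hasW z
    have hEz := (sφ.hasW z).cexp
    have hwz := sw.hasW z
    have e1 := (((sw.dz.hasW z).mul hβz).mul (hβz.conj.mul hEz)).dzb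
    have e3 := ((hwz.mul hβz).mul ((sb.hasW z).conj.mul hEz)).dzb
    have e2 := ((hwz.mul hβz).mul (((hβ.dz.hasW z).conj.mul hEz).add
      (hβz.conj.mul (hEz.mul (sφ.dzb.hasW z))))).dz
    rw [e1, e2, e3]
    have q1 := ofReal_qlap hw z
    have q2 := ofReal_qlap hφ z
    have q3 : dzb φc z = conj (dz φc z) := dzb_ofReal hφ z
    have q4 : dzb wc z = conj (dz wc z) := dzb_ofReal hw z
    have q5 : ∀ x : ℂ, ((‖x‖ ^ 2 : ℝ) : ℂ) = x * conj x := fun x => by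
      rw [Complex.mul_conj, Complex.normSq_eq_norm_sq]
    have q6 : ∀ x : ℂ, ((2 * x.re : ℝ) : ℂ) = x + conj x := fun x => by
      rw [Complex.add_conj]
    simp only [Complex.ofReal_mul, Complex.ofReal_add, Complex.ofReal_sub, q5]
    have q7 : (2:ℂ) * ((dz wc z * dzb β z * conj (β z)).re : ℂ) =
      dz wc z * dzb β z * conj (β z) + conj (dz wc z * dzb β z * conj (β z)) := by
      rw [← q6]; push_cast; rfl
    rw [dz_dzb_comm sw, dz_dzb_comm hβ]
    have q8 : (Complex.ofReal 2) = 2 := rfl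
    simp only [q1, q2, q8, q7, q3, q4, map_mul, map_add, Complex.conj_conj]
    simp only [hφc, hwc, Complex.ofReal_exp]
    ring
  have hsum : ∫ z, (((qlap w z - w z * qlap φ z) * ‖β z‖ ^ 2 - w z * ‖dz β z + dz φc z * β z‖ ^ 2
        + w z * ‖dzb β z‖ ^ 2 + 2 * (dz wc z * dzb β z * conj (β z)).re) * Real.exp (φ z) : ℝ) = 0 := by
    rw [← Complex.ofReal_eq_zero, ← integral_complex_ofReal, ← integral_congr_ae (ae_of_all _ key),
      integral_add (f := fun z => _ - _) (n1.sub n2) n3, integral_sub n1 n2, i1, i2, i3]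
    simp
  have c0 : HasCompactSupport (fun z => ‖β z‖) := hc.norm
  have cφ := hφ.continuous
  have cw := hw.continuous
  have cβ := hβ.continuous
  have cb := sb.continuous
  have cdβ := hβ.dz.continuous
  have cdφ := sφ.dz.continuous
  have cdw := sw.dz.continuous
  have cqw := hw.qlap.continuous
  have cqφ := hφ.qlap.continuous
  have m1 : Integrable (fun z => (w z * qlap φ z - qlap w z) * ‖β z‖ ^ 2 * Real.exp (φ z)) := by
    refine Continuous.integrable_of_hasCompactSupport (by fun_prop) ?_
    refine hc.mono ?_
    intro z hz; contrapose! hz; simp only [Function.mem_support, not_not] at hz; simp [hz]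
  have m2 : Integrable (fun z => (w z * ‖dzb β z‖ ^ 2
      + 2 * ‖dz (fun z => (w z : ℂ)) z‖ * ‖dzb β z‖ * ‖β z‖) * Real.exp (φ z)) := by
    refine Continuous.integrable_of_hasCompactSupport (by fun_prop) ?_
    refine hc.dzb.mono ?_
    intro z hz; contrapose! hz; simp only [Function.mem_support, not_not] at hz; simp [hz]
  have m3 : Integrable (fun z => ((qlap w z - w z * qlap φ z) * ‖β z‖ ^ 2
        - w z * ‖dz β z + dz φc z * β z‖ ^ 2
        + w z * ‖dzb β z‖ ^ 2 + 2 * (dz wc z * dzb β z * conj (β z)).re) * Real.exp (φ z)) := by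
    refine (((n1.sub n2).add n3).re).congr ?_
    refine ae_of_all _ fun z => ?_
    simp only [Pi.add_apply, Pi.sub_apply]
    rw [key]; exact Complex.ofReal_re _
  rw [← sub_nonneg, ← integral_sub m2 m1, ← hsum]
  refine integral_mono m3 (m2.sub m1) fun z => ?_
  simp only []
  rw [mul_comm _ (Real.exp (φ z)), mul_comm _ (Real.exp (φ z)), mul_comm _ (Real.exp (φ z)),
    ← mul_sub]
  refine mul_le_mul_of_nonneg_left ?_ (Real.exp_pos _).le
  have r1 : (dz wc z * dzb β z * conj (β z)).re ≤ ‖dz wc z‖ * ‖dzb β z‖ * ‖β z‖ := by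
    refine (Complex.re_le_norm _).trans (by simp)
  have r2 : 0 ≤ w z * ‖dz β z + dz φc z * β z‖ ^ 2 := by have := hw0 z; positivity
  have : dz (fun z => (w z : ℂ)) z = dz wc z := rfl
  rw [this]
  linarith

/-- The twisted estimate with the gradient term of the twist absorbed. -/
lemma twisted_estimate {φ w h p : ℂ → ℝ} {β : ℂ → ℂ} (hφ : ContDiff ℝ ∞ φ) (hw : ContDiff ℝ ∞ w)
    (hβ : ContDiff ℝ ∞ β) (hc : HasCompactSupport β) (hw1 : ∀ z, 1 ≤ w z)
    (hh : ∀ z, 0 ≤ h z) (hhc : Continuous h) (hp : ∀ z, 0 ≤ p z) (hQ : ∀ z, qlap w z = p z - h z)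
    (hφp : ∀ z ∈ tsupport β, 2 * p z ≤ qlap φ z) :
    ∫ z, h z * ‖β z‖ ^ 2 * Real.exp (φ z) ≤
      6 * ∫ z, w z ^ 2 * ‖dzb β z‖ ^ 2 * Real.exp (φ z) := by
  set W : ℂ → ℝ := fun z => w z + Real.log (w z) with hW
  have hwpos : ∀ z, 0 < w z := fun z => by linarith [hw1 z]
  have sW : ContDiff ℝ ∞ W := hw.add (hw.log fun z => (hwpos z).ne')
  have sw := hw.ofReal'
  have hder : ∀ z, HasW (fun z => (W z : ℂ)) ((1 + 1 / (w z : ℂ)) * dz (fun z => (w z : ℂ)) z)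
      ((1 + 1 / (w z : ℂ)) * dzb (fun z => (w z : ℂ)) z) z := by
    intro z
    have h1 := HasW.rcomp (f := w) (Real.hasDerivAt_log (hwpos z).ne') (sw.hasW z)
    have := (sw.hasW z).add h1
    simp only [hW]
    push_cast at this ⊢
    exact this.congr_val (by ring) (by ring)
  have hWz : ∀ z, dz (fun z => (W z : ℂ)) z = (1 + 1 / (w z : ℂ)) * dz (fun z => (w z : ℂ)) z :=
    fun z => (hder z).dz
  have hWzb : dzb (fun z => (W z : ℂ)) = fun z => (1 + 1 / (w z : ℂ)) * dzb (fun z => (w z : ℂ)) z :=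
    funext fun z => (hder z).dzb
  have hQW : ∀ z, qlap W z = (1 + 1 / w z) * qlap w z
      - ‖dz (fun z => (w z : ℂ)) z‖ ^ 2 / w z ^ 2 := by
    intro z
    have hwne : (w z : ℂ) ≠ 0 := by exact_mod_cast (hwpos z).ne'
    have h1 : HasW (fun z => ((w z)⁻¹ : ℂ)) (-((w z : ℂ) ^ 2)⁻¹ * dz (fun z => (w z : ℂ)) z)
      (-((w z : ℂ) ^ 2)⁻¹ * dzb (fun z => (w z : ℂ)) z) z :=
      HasW.hcomp (f := fun z => (w z : ℂ)) (hasDerivAt_inv hwne) (sw.hasW z)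
    have h2 := (((hasW_const 1 z).add h1).mul (sw.dzb.hasW z)).dz
    have h3 : (qlap W z : ℂ) = ((1 + 1 / w z) * qlap w z
      - ‖dz (fun z => (w z : ℂ)) z‖ ^ 2 / w z ^ 2 : ℝ) := by
      rw [ofReal_qlap sW, hWzb]
      simp only [one_div] at h2 ⊢
      rw [h2]
      push_cast
      rw [ofReal_qlap hw, dzb_ofReal hw, ← Complex.ofReal_pow ‖_‖, ← Complex.normSq_eq_norm_sq, ← Complex.mul_conj]
      ring
    exact_mod_cast h3
  have base := twisted_basic (φ := φ) (w := W) hφ sW hβ hc fun z =>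
    add_nonneg (hwpos z).le (Real.log_nonneg (hw1 z))
  have cφ := hφ.continuous
  have cw := hw.continuous
  have cβ := hβ.continuous
  have cb := hβ.dzb.continuous
  have cdw := sw.dz.continuous
  have cW := sW.continuous
  have cqW := sW.qlap.continuous
  have cdW := sW.ofReal'.dz.continuous
  have cqφ := hφ.qlap.continuous
  have I : ∀ {f : ℂ → ℝ}, Continuous f → (∀ z, β z = 0 → dzb β z = 0 → f z = 0) → Integrable f := by
    intro f hf h0
    refine hf.integrable_of_hasCompactSupport (hc.of_isClosed_subset (isClosed_tsupport f) ?_)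
    have : Function.support f ⊆ tsupport β := by
      intro z hz
      by_contra hzn
      exact hz (h0 z (image_eq_zero_of_notMem_tsupport hzn)
        (image_eq_zero_of_notMem_tsupport fun hh => hzn (tsupport_dzb_subset hh)))
    exact closure_minimal this (isClosed_tsupport β)
  have j1 : Integrable (fun z => (W z * qlap φ z - qlap W z) * ‖β z‖ ^ 2 * Real.exp (φ z)) :=
    I (by fun_prop) (by intro z h1 h2; simp [h1])
  have j2 : Integrable (fun z => (W z * ‖dzb β z‖ ^ 2 +
    2 * ‖dz (fun z => (W z : ℂ)) z‖ * ‖dzb β z‖ * ‖β z‖) * Real.exp (φ z)) :=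
    I (by fun_prop) (by intro z h1 h2; simp [h2])
  have j3 : Integrable (fun z => h z * ‖β z‖ ^ 2 * Real.exp (φ z)) :=
    I (by fun_prop) (by intro z h1 h2; simp [h1])
  have j4 : Integrable (fun z => w z ^ 2 * ‖dzb β z‖ ^ 2 * Real.exp (φ z)) :=
    I (by fun_prop) (by intro z h1 h2; simp [h2])
  have hcomb : ∀ z, h z * ‖β z‖ ^ 2 * Real.exp (φ z) - 6 * (w z ^ 2 * ‖dzb β z‖ ^ 2 * Real.exp (φ z))
     ≤ (W z * qlap φ z - qlap W z) * ‖β z‖ ^ 2 * Real.exp (φ z) - (W z * ‖dzb β z‖ ^ 2 +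
    2 * ‖dz (fun z => (W z : ℂ)) z‖ * ‖dzb β z‖ * ‖β z‖) * Real.exp (φ z) := by
    intro z
    by_cases hz : z ∈ tsupport β
    · have a1 := hφp z hz
      have hw1z := hw1 z
      have hpz := hp z
      have hhz := hh z
      have a2 : Real.log (w z) ≤ w z := (Real.log_le_sub_one_of_pos (hwpos z)).trans (by linarith)
      have a3 : 0 ≤ Real.log (w z) := Real.log_nonneg (hw1 z)
      have a5 : 1 / w z ≤ 1 := by rw [div_le_one (hwpos z)]; exact hw1z
      have a6 : 0 < 1 / w z := by have := hwpos z; positivity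
      set G := ‖dz (fun z => (w z : ℂ)) z‖ with hG
      have a7 : ‖dz (fun z => (W z : ℂ)) z‖ ≤ 2 * G := by
        rw [hWz, norm_mul]
        refine mul_le_mul_of_nonneg_right ?_ (norm_nonneg _)
        have : (1 + 1 / (w z : ℂ)) = ((1 + 1 / w z : ℝ) : ℂ) := by push_cast; ring
        rw [this, Complex.norm_real, Real.norm_of_nonneg (by linarith)]; linarith
      have a8 : 2 * p z ≤ W z * qlap φ z := by
        have : (1:ℝ) ≤ W z := by simp only [hW]; linarith
        nlinarith
      have a9 : h z + G ^ 2 / w z ^ 2 ≤ W z * qlap φ z - qlap W z := by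
        rw [hQW, hQ]
        have : (1 + 1 / w z) * (p z - h z) ≤ 2 * p z - h z := by nlinarith
        linarith
      have a10 : (W z * ‖dzb β z‖ ^ 2 + 2 * ‖dz (fun z => (W z : ℂ)) z‖ * ‖dzb β z‖ * ‖β z‖) ≤
        6 * (w z ^ 2 * ‖dzb β z‖ ^ 2) + G ^ 2 / w z ^ 2 * ‖β z‖ ^ 2 := by
        have b1 : W z ≤ 2 * w z ^ 2 := by simp only [hW]; nlinarith
        have b2 : 2 * ‖dz (fun z => (W z : ℂ)) z‖ * ‖dzb β z‖ * ‖β z‖ ≤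
            2 * (2 * G) * ‖dzb β z‖ * ‖β z‖ := by gcongr
        have b3 : 2 * (2 * G) * ‖dzb β z‖ * ‖β z‖ ≤
            4 * (w z ^ 2 * ‖dzb β z‖ ^ 2) + G ^ 2 / w z ^ 2 * ‖β z‖ ^ 2 := by
          have e : 2 * (2 * G) * ‖dzb β z‖ * ‖β z‖ =
            2 * (2 * (w z * ‖dzb β z‖)) * (G / w z * ‖β z‖) := by
            have := (hwpos z).ne'
            field_simp
          rw [e]
          have := two_mul_le_add_sq (2 * (w z * ‖dzb β z‖)) (G / w z * ‖β z‖)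
          calc _ ≤ _ := this
            _ = _ := by ring
        have b4 : W z * ‖dzb β z‖ ^ 2 ≤ 2 * w z ^ 2 * ‖dzb β z‖ ^ 2 := by gcongr
        linarith
      have := (Real.exp_pos (φ z)).le
      have a11 : h z * ‖β z‖ ^ 2 + G ^ 2 / w z ^ 2 * ‖β z‖ ^ 2 ≤
         (W z * qlap φ z - qlap W z) * ‖β z‖ ^ 2 := by
        rw [← add_mul]; gcongr
      nlinarith
    · have b0 : β z = 0 := image_eq_zero_of_notMem_tsupport hz
      have b1 : dzb β z = 0 :=
        image_eq_zero_of_notMem_tsupport fun hh => hz (tsupport_dzb_subset hh)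
      simp [b0, b1]
  have := integral_mono (j3.sub (j4.const_mul 6)) (j1.sub j2) hcomb
  simp only [Pi.sub_apply] at this
  rw [integral_sub j3 (j4.const_mul 6), integral_sub j1 j2, integral_const_mul] at this
  linarith

/-- Convolution of complex-valued functions on the plane. -/
noncomputable def cv (f g : ℂ → ℂ) (z : ℂ) : ℂ := ∫ ζ, f ζ * g (z - ζ)

/-- Convolution of real-valued functions on the plane. -/
noncomputable def rcv (f g : ℂ → ℝ) (z : ℂ) : ℝ := ∫ ζ, f ζ * g (z - ζ)

lemma cv_eq_convolution (f g : ℂ → ℂ) :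
    cv f g = convolution f g (ContinuousLinearMap.mul ℝ ℂ) volume := by
  ext z; simp [cv, convolution_def]

lemma ofReal_rcv (f g : ℂ → ℝ) (z : ℂ) :
    (rcv f g z : ℂ) = cv (fun z => (f z : ℂ)) (fun z => (g z : ℂ)) z := by
  unfold rcv cv
  rw [← integral_complex_ofReal]
  simp

lemma cv_swap (f g : ℂ → ℂ) (z : ℂ) : cv f g z = ∫ ζ, f (z - ζ) * g ζ := by
  unfold cv
  rw [← integral_sub_left_eq_self _ volume z]
  simp

lemma rcv_swap (f g : ℂ → ℝ) (z : ℂ) : rcv f g z = ∫ ζ, f (z - ζ) * g ζ := by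
  unfold rcv
  rw [← integral_sub_left_eq_self _ volume z]
  simp

section cv
variable {f g : ℂ → ℂ}

lemma contDiff_cv (hf : LocallyIntegrable f) (hg : ContDiff ℝ ∞ g) (hc : HasCompactSupport g) :
    ContDiff ℝ ∞ (cv f g) := by
  rw [cv_eq_convolution]
  exact hc.contDiff_convolution_right _ hf hg

lemma fderiv_cv (hf : LocallyIntegrable f) (hg : ContDiff ℝ ∞ g) (hc : HasCompactSupport g)
    (z v : ℂ) : fderiv ℝ (cv f g) z v = cv f (fun y => fderiv ℝ g y v) z := by
  rw [cv_eq_convolution, (hc.hasFDerivAt_convolution_right (ContinuousLinearMap.mul ℝ ℂ) hf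
    (hg.of_le (by simp)) z).fderiv, convolution_precompR_apply _ hf (hc.fderiv (𝕜 := ℝ))
    (hg.continuous_fderiv (by simp)), cv_eq_convolution]

lemma integrable_mul_shift (hf : LocallyIntegrable f) (hg : Continuous g)
    (hc : HasCompactSupport g) (z : ℂ) : Integrable (fun ζ => f ζ * g (z - ζ)) := by
  have := hc.convolutionExists_right (ContinuousLinearMap.mul ℝ ℂ) hf hg z
  simpa [ConvolutionExistsAt] using this

lemma dz_cv (hf : LocallyIntegrable f) (hg : ContDiff ℝ ∞ g) (hc : HasCompactSupport g) :
    dz (cv f g) = cv f (dz g) := by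
  funext z
  have h : ∀ v, Integrable (fun ζ => f ζ * fderiv ℝ g (z - ζ) v) := fun v =>
    integrable_mul_shift (g := fun y => fderiv ℝ g y v) hf
      ((hg.continuous_fderiv (by simp)).clm_apply continuous_const) (hc.fderiv_apply (𝕜 := ℝ) v) z
  rw [dz, fderiv_cv hf hg hc, fderiv_cv hf hg hc]
  unfold cv
  rw [← integral_const_mul, ← integral_sub (h _) ((h _).const_mul _), ← integral_div]
  congr 1; ext ζ; rw [dz]; ring

lemma dzb_cv (hf : LocallyIntegrable f) (hg : ContDiff ℝ ∞ g) (hc : HasCompactSupport g) :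
    dzb (cv f g) = cv f (dzb g) := by
  funext z
  have h : ∀ v, Integrable (fun ζ => f ζ * fderiv ℝ g (z - ζ) v) := fun v =>
    integrable_mul_shift (g := fun y => fderiv ℝ g y v) hf
      ((hg.continuous_fderiv (by simp)).clm_apply continuous_const) (hc.fderiv_apply (𝕜 := ℝ) v) z
  rw [dzb, fderiv_cv hf hg hc, fderiv_cv hf hg hc]
  unfold cv
  rw [← integral_const_mul, ← integral_add (h _) ((h _).const_mul _), ← integral_div]
  congr 1; ext ζ; rw [dzb]; ring

end cv

/-- Integration by parts for `∂/∂z̄`. -/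
lemma integral_mul_dzb {f g : ℂ → ℂ} (hf : ContDiff ℝ ∞ f) (hg : ContDiff ℝ ∞ g)
    (hc : HasCompactSupport g) : ∫ z, f z * dzb g z = - ∫ z, dzb f z * g z := by
  have h := integral_dzb_eq_zero (f := fun z => f z * g z) ((hf.mul hg).of_le (by simp))
    hc.mul_left
  have e : ∀ z, dzb (fun z => f z * g z) z = dzb f z * g z + f z * dzb g z := fun z =>
    ((hf.hasW z).mul (hg.hasW z)).dzb
  simp_rw [e] at h
  rw [integral_add] at h
  · linear_combination h
  · exact (hf.dzb.continuous.mul hg.continuous).integrable_of_hasCompactSupport hc.mul_left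
  · exact (hf.continuous.mul hg.dzb.continuous).integrable_of_hasCompactSupport hc.dzb.mul_left

/-- Integration by parts for `∂/∂z`. -/
lemma integral_mul_dz {f g : ℂ → ℂ} (hf : ContDiff ℝ ∞ f) (hg : ContDiff ℝ ∞ g)
    (hc : HasCompactSupport g) : ∫ z, f z * dz g z = - ∫ z, dz f z * g z := by
  have h := integral_dz_eq_zero (f := fun z => f z * g z) ((hf.mul hg).of_le (by simp))
    hc.mul_left
  have e : ∀ z, dz (fun z => f z * g z) z = dz f z * g z + f z * dz g z := fun z =>
    ((hf.hasW z).mul (hg.hasW z)).dz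
  simp_rw [e] at h
  rw [integral_add] at h
  · linear_combination h
  · exact (hf.dz.continuous.mul hg.continuous).integrable_of_hasCompactSupport hc.mul_left
  · exact (hf.continuous.mul hg.dz.continuous).integrable_of_hasCompactSupport hc.dz.mul_left

/-- The regularized logarithm `log (|z|² + s²)`. -/
noncomputable def lreg (s : ℝ) (z : ℂ) : ℝ := Real.log (‖z‖ ^ 2 + s ^ 2)

/-- The approximate identity `∂²/∂z∂z̄ log (|z|² + s²)`. -/
noncomputable def hreg (s : ℝ) (z : ℂ) : ℝ := s ^ 2 / (‖z‖ ^ 2 + s ^ 2) ^ 2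

/-- The derivative `∂/∂z log (|z|² + s²)`. -/
noncomputable def kreg (s : ℝ) (z : ℂ) : ℂ := conj z / ((‖z‖ ^ 2 + s ^ 2 : ℝ) : ℂ)

/-- The total mass of the approximate identity. -/
noncomputable def cpi : ℝ := ∫ z, hreg 1 z

section reg
variable {s : ℝ}

lemma reg_pos (hs : 0 < s) (z : ℂ) : 0 < ‖z‖ ^ 2 + s ^ 2 := by positivity

lemma contDiff_lreg (hs : 0 < s) : ContDiff ℝ ∞ (lreg s) := by
  unfold lreg
  exact ((contDiff_norm_sq ℝ).add contDiff_const).log fun z => (reg_pos hs z).ne'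

lemma contDiff_kreg (hs : 0 < s) : ContDiff ℝ ∞ (kreg s) := by
  unfold kreg
  have h1 : ContDiff ℝ ∞ (fun z : ℂ => ((‖z‖ ^ 2 + s ^ 2 : ℝ) : ℂ)) :=
    ((contDiff_norm_sq ℝ).add contDiff_const).ofReal'
  simp_rw [div_eq_mul_inv]
  exact (contDiff_id.conj).mul <| h1.inv fun z => by exact_mod_cast (reg_pos hs z).ne'

lemma hasW_normsq (z : ℂ) : HasW (fun z => ((‖z‖ ^ 2 + s ^ 2 : ℝ) : ℂ)) (conj z) z z := by
  have h := ((hasW_id z).mul (hasW_id z).conj).add (hasW_const ((s:ℂ) ^ 2) z)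
  have e : (fun z : ℂ => ((‖z‖ ^ 2 + s ^ 2 : ℝ) : ℂ)) = fun z : ℂ => z * conj z + (s:ℂ) ^ 2 := by
    ext z
    rw [Complex.mul_conj, Complex.normSq_eq_norm_sq]
    push_cast; rfl
  rw [e]
  exact h.congr_val (by simp) (by simp)

lemma hasW_lreg (hs : 0 < s) (z : ℂ) :
    HasW (fun z => (lreg s z : ℂ)) (kreg s z) (conj (kreg s z)) z := by
  have := HasW.rcomp (f := fun z => ‖z‖ ^ 2 + s ^ 2)
    (Real.hasDerivAt_log (reg_pos hs z).ne') (hasW_normsq z)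
  refine HasW.congr_val this ?_ ?_
  · rw [kreg]; push_cast; ring
  · rw [kreg, map_div₀, Complex.conj_conj, Complex.conj_ofReal]; push_cast; ring

lemma hasW_kreg (hs : 0 < s) (z : ℂ) :
    HasW (kreg s) (dz (kreg s) z) (hreg s z) z := by
  have hne : ((‖z‖ ^ 2 + s ^ 2 : ℝ) : ℂ) ≠ 0 := by exact_mod_cast (reg_pos hs z).ne'
  have h1 := HasW.hcomp (f := fun z => ((‖z‖ ^ 2 + s ^ 2 : ℝ) : ℂ)) (hasDerivAt_inv hne)
    (hasW_normsq z)
  have h2 := (hasW_id z).conj.mul h1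
  have h3 : HasW (kreg s) _ _ z := h2
  refine h3.congr_val h3.dz.symm ?_
  have e : conj z * z = (‖z‖ : ℂ) ^ 2 := by
    rw [mul_comm, Complex.mul_conj, Complex.normSq_eq_norm_sq]; push_cast; rfl
  rw [hreg]
  push_cast at hne ⊢
  simp only [map_one]
  field_simp
  linear_combination -e

lemma qlap_lreg (hs : 0 < s) (z : ℂ) : qlap (lreg s) z = hreg s z := by
  have h : dz (fun z => (lreg s z : ℂ)) = kreg s := funext fun z => (hasW_lreg hs z).dz
  have := ofReal_qlap (contDiff_lreg hs) z
  rw [← dz_dzb_comm (contDiff_lreg hs).ofReal', h, (hasW_kreg hs z).dzb] at this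
  exact_mod_cast this

lemma continuous_hreg (hs : 0 < s) : Continuous (hreg s) := by
  unfold hreg
  exact continuous_const.div (by fun_prop) fun z => by have := reg_pos hs z; positivity

lemma hreg_nonneg (z : ℂ) : 0 ≤ hreg s z := by unfold hreg; positivity

lemma integrable_hreg_one : Integrable (hreg 1) := by
  have := integrable_rpow_neg_one_add_norm_sq (E := ℂ) (μ := volume) (r := 4)
    (by rw [Complex.finrank_real_complex]; norm_num)
  refine this.congr (ae_of_all _ fun z => ?_)
  have hp : (0:ℝ) < 1 + ‖z‖ ^ 2 := by positivity
  simp only [hreg]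
  rw [show (-4 / 2 : ℝ) = -(2:ℕ) by norm_num, Real.rpow_neg hp.le, Real.rpow_natCast]
  simp [add_comm]

lemma cpi_pos : 0 < cpi := by
  refine integral_pos_of_integrable_nonneg_nonzero (x := 0) (continuous_hreg one_pos)
    integrable_hreg_one (fun z => hreg_nonneg z) ?_
  simp [hreg]

lemma kreg_norm_le (z : ℂ) : ‖kreg s z‖ ≤ ‖z‖⁻¹ := by
  unfold kreg
  rw [norm_div, Complex.norm_conj, Complex.norm_real, Real.norm_of_nonneg (by positivity)]
  by_cases h : z = 0
  · simp [h]
  · have : 0 < ‖z‖ := norm_pos_iff.2 h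
    rw [div_le_iff₀ (by positivity), mul_add]
    have : ‖z‖ = ‖z‖⁻¹ * ‖z‖ ^ 2 := by field_simp
    have h2 : 0 ≤ ‖z‖⁻¹ * s ^ 2 := by positivity
    linarith

lemma neg_inv_le_log {x : ℝ} (hx : 0 < x) : -x⁻¹ ≤ Real.log x := by
  have := Real.one_sub_inv_le_log_of_pos hx
  linarith

lemma lreg_abs_le (hs : 0 ≤ s) (hs1 : s ≤ 1) (z : ℂ) (hz : z ≠ 0) :
    |lreg s z| ≤ ‖z‖ ^ 2 + 2 * ‖z‖⁻¹ := by
  have hz' : 0 < ‖z‖ := norm_pos_iff.2 hz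
  have hi : 0 < ‖z‖⁻¹ := by positivity
  have hp : 0 < ‖z‖ ^ 2 + s ^ 2 := by positivity
  unfold lreg
  rw [abs_le]
  constructor
  · have h1 : Real.log (‖z‖ ^ 2) ≤ Real.log (‖z‖ ^ 2 + s ^ 2) :=
      Real.log_le_log (by positivity) (by nlinarith)
    rw [Real.log_pow] at h1
    have := neg_inv_le_log hz'
    push_cast at h1
    nlinarith
  · have := Real.log_le_sub_one_of_pos hp
    nlinarith

lemma tendsto_integral_hreg {g : ℂ → ℂ} (hg : Continuous g) (hc : HasCompactSupport g) :
    Tendsto (fun s : ℝ => ∫ z, (hreg s z : ℂ) * g z) (𝓝[>] 0) (𝓝 (cpi * g 0)) := by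
  obtain ⟨C, hC⟩ := hg.bounded_above_of_compact_support hc
  have h1 : Tendsto (fun s : ℝ => ∫ u, (hreg 1 u : ℂ) * g (s • u)) (𝓝[>] 0)
      (𝓝 (∫ u, (hreg 1 u : ℂ) * g 0)) := by
    refine tendsto_integral_filter_of_dominated_convergence (fun u => hreg 1 u * C) ?_ ?_ ?_ ?_
    · refine Eventually.of_forall fun s => Continuous.aestronglyMeasurable ?_
      have := continuous_hreg one_pos
      fun_prop
    · refine Eventually.of_forall fun s => ae_of_all _ fun u => ?_
      rw [norm_mul, Complex.norm_real, Real.norm_of_nonneg (hreg_nonneg u)]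
      exact mul_le_mul_of_nonneg_left (hC _) (hreg_nonneg u)
    · exact integrable_hreg_one.mul_const C
    · refine ae_of_all _ fun u => ?_
      refine Tendsto.const_mul _ ?_
      have : Tendsto (fun s : ℝ => g (s • u)) (𝓝 0) (𝓝 (g ((0:ℝ) • u))) :=
        (hg.comp (by fun_prop : Continuous fun s : ℝ => s • u)).tendsto 0
      rw [zero_smul] at this
      exact this.mono_left nhdsWithin_le_nhds
  have h2 : ∫ u, (hreg 1 u : ℂ) * g 0 = cpi * g 0 := by
    rw [integral_mul_const, cpi, ← integral_complex_ofReal]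
  rw [h2] at h1
  refine h1.congr' ?_
  filter_upwards [self_mem_nhdsWithin] with s hs
  have hs : 0 < s := hs
  have := Measure.integral_comp_smul (volume : Measure ℂ) (fun z => (hreg s z : ℂ) * g z) s
  rw [Complex.finrank_real_complex, abs_of_pos (by positivity)] at this
  have e : ∀ u : ℂ, (hreg s (s • u) : ℂ) = ((s ^ 2)⁻¹ : ℝ) * hreg 1 u := by
    intro u
    have : hreg s (s • u) = (s ^ 2)⁻¹ * hreg 1 u := by
      unfold hreg
      rw [norm_smul, Real.norm_of_nonneg hs.le]
      have := reg_pos one_pos u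
      rw [show (s * ‖u‖) ^ 2 + s ^ 2 = s ^ 2 * (‖u‖ ^ 2 + 1 ^ 2) by ring]
      field_simp
    rw [this]; push_cast; rfl
  simp_rw [e, mul_assoc] at this
  rw [integral_const_mul, Complex.real_smul] at this
  refine mul_left_cancel₀ ?_ this
  have : (s ^ 2)⁻¹ ≠ 0 := by positivity
  exact_mod_cast this

lemma locallyIntegrable_inv_norm : LocallyIntegrable (fun z : ℂ => ‖z‖⁻¹) := by
  refine locallyIntegrable_of_norm_le_rpow (C := 1) (α := 1) ?_ ?_ ?_ ?_
  · simp
  · rw [Complex.finrank_real_complex]; norm_num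
  · refine ae_of_all _ fun z => ?_
    rw [Real.rpow_neg_one]; simp
  · exact (measurable_norm.inv).aestronglyMeasurable

/-- A locally integrable majorant of all the regularized logarithms. -/
noncomputable def lmaj (z : ℂ) : ℝ := ‖z‖ ^ 2 + 2 * ‖z‖⁻¹

lemma locallyIntegrable_lmaj : LocallyIntegrable lmaj :=
  (Continuous.locallyIntegrable (by fun_prop)).add (locallyIntegrable_inv_norm.smul (2:ℝ))

lemma lmaj_nonneg (z : ℂ) : 0 ≤ lmaj z := by unfold lmaj; positivity

lemma ae_ne_zero : ∀ᵐ z : ℂ, z ≠ 0 := by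
  simp [ae_iff]

lemma measurable_lreg : Measurable (lreg s) := by
  unfold lreg
  fun_prop

lemma locallyIntegrable_lreg_zero : LocallyIntegrable (lreg 0) := by
  refine locallyIntegrable_lmaj.mono measurable_lreg.aestronglyMeasurable ?_
  filter_upwards [ae_ne_zero] with z hz
  rw [Real.norm_eq_abs, Real.norm_of_nonneg (lmaj_nonneg z)]
  exact lreg_abs_le le_rfl zero_le_one z hz

lemma tendsto_lreg {z : ℂ} (hz : z ≠ 0) : Tendsto (fun s => lreg s z) (𝓝[>] 0) (𝓝 (lreg 0 z)) := by
  have : 0 < ‖z‖ := norm_pos_iff.2 hz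
  have : ContinuousAt (fun s => lreg s z) 0 := by
    unfold lreg
    refine ContinuousAt.log (by fun_prop) (by positivity)
  exact this.tendsto.mono_left nhdsWithin_le_nhds

lemma mem_Ioc_zero_one : ∀ᶠ s : ℝ in 𝓝[>] 0, s ∈ Ioc (0:ℝ) 1 :=
  Ioc_mem_nhdsGT one_pos

lemma tendsto_integral_lreg {g : ℂ → ℂ} (hg : Continuous g) (hc : HasCompactSupport g) :
    Tendsto (fun s : ℝ => ∫ z, (lreg s z : ℂ) * g z) (𝓝[>] 0)
      (𝓝 (∫ z, (lreg 0 z : ℂ) * g z)) := by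
  refine tendsto_integral_filter_of_dominated_convergence (fun z => lmaj z * ‖g z‖) ?_ ?_ ?_ ?_
  · refine Eventually.of_forall fun s => ?_
    exact (Complex.measurable_ofReal.comp measurable_lreg).aestronglyMeasurable.mul
      hg.aestronglyMeasurable
  · filter_upwards [mem_Ioc_zero_one] with s hs
    filter_upwards [ae_ne_zero] with z hz
    rw [norm_mul, Complex.norm_real, Real.norm_eq_abs]
    exact mul_le_mul_of_nonneg_right (lreg_abs_le hs.1.le hs.2 z hz) (norm_nonneg _)
  · exact locallyIntegrable_lmaj.integrable_smul_right_of_hasCompactSupport hg.norm hc.norm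
  · filter_upwards [ae_ne_zero] with z hz
    refine Tendsto.mul_const _ ?_
    exact (Complex.continuous_ofReal.tendsto _).comp (tendsto_lreg hz)

/-- The Cauchy–Pompeiu formula. -/
lemma integral_inv_mul_dzb {g : ℂ → ℂ} (hg : ContDiff ℝ ∞ g) (hc : HasCompactSupport g) :
    ∫ z, z⁻¹ * dzb g z = - (cpi * g 0) := by
  have h1 := (tendsto_integral_hreg hg.continuous hc).neg
  have h2 : Tendsto (fun s : ℝ => ∫ z, kreg s z * dzb g z) (𝓝[>] 0)
      (𝓝 (∫ z, z⁻¹ * dzb g z)) := by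
    refine tendsto_integral_filter_of_dominated_convergence (fun z => ‖z‖⁻¹ * ‖dzb g z‖) ?_ ?_ ?_ ?_
    · filter_upwards [self_mem_nhdsWithin] with s hs
      exact ((contDiff_kreg hs).continuous.mul hg.dzb.continuous).aestronglyMeasurable
    · refine Eventually.of_forall fun s => ae_of_all _ fun z => ?_
      rw [norm_mul]
      exact mul_le_mul_of_nonneg_right (kreg_norm_le z) (norm_nonneg _)
    · exact locallyIntegrable_inv_norm.integrable_smul_right_of_hasCompactSupport
        hg.dzb.continuous.norm hc.dzb.norm
    · filter_upwards [ae_ne_zero] with z hz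
      refine Tendsto.mul_const _ ?_
      have hz' : ((‖z‖ ^ 2 + 0 ^ 2 : ℝ) : ℂ) ≠ 0 := by simpa using hz
      have e : z⁻¹ = kreg 0 z := by
        unfold kreg
        rw [Complex.inv_def, Complex.normSq_eq_norm_sq]; simp; ring
      rw [e]
      have : ContinuousAt (fun s => kreg s z) 0 := by
        unfold kreg
        exact ContinuousAt.div (by fun_prop) (by fun_prop) hz'
      exact this.tendsto.mono_left nhdsWithin_le_nhds
  refine tendsto_nhds_unique h2 (h1.congr' ?_)
  filter_upwards [self_mem_nhdsWithin] with s hs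
  rw [integral_mul_dzb (contDiff_kreg hs) hg hc]
  simp_rw [(hasW_kreg hs _).dzb]

/-- The logarithmic kernel is a fundamental solution. -/
lemma integral_lreg_zero_mul_dz_dzb {g : ℂ → ℂ} (hg : ContDiff ℝ ∞ g) (hc : HasCompactSupport g) :
    ∫ z, (lreg 0 z : ℂ) * dz (dzb g) z = cpi * g 0 := by
  have h1 := tendsto_integral_hreg hg.continuous hc
  refine tendsto_nhds_unique (tendsto_integral_lreg hg.dzb.dz.continuous hc.dzb.dz) (h1.congr' ?_)
  filter_upwards [self_mem_nhdsWithin] with s hs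
  rw [integral_mul_dz (contDiff_lreg hs).ofReal' hg.dzb hc.dzb]
  simp_rw [(hasW_lreg hs _).dz]
  rw [integral_mul_dzb (contDiff_kreg hs) hg hc, neg_neg]
  simp_rw [(hasW_kreg hs _).dzb]

lemma MeasureTheory.LocallyIntegrable.ofReal' {f : ℂ → ℝ} (hf : LocallyIntegrable f) :
    LocallyIntegrable (fun z => (f z : ℂ)) :=
  hf.mono (Complex.continuous_ofReal.comp_aestronglyMeasurable hf.aestronglyMeasurable)
    (ae_of_all _ fun z => by simp)

lemma contDiff_rcv {f g : ℂ → ℝ} (hf : LocallyIntegrable f) (hg : ContDiff ℝ ∞ g)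
    (hc : HasCompactSupport g) : ContDiff ℝ ∞ (rcv f g) := by
  have h : ContDiff ℝ ∞ (cv (fun z => (f z : ℂ)) (fun z => (g z : ℂ))) :=
    contDiff_cv hf.ofReal' hg.ofReal' (hc.comp_left Complex.ofReal_zero)
  have e : rcv f g = fun z => (cv (fun z => (f z : ℂ)) (fun z => (g z : ℂ)) z).re := by
    ext z; rw [← ofReal_rcv]; simp
  rw [e]
  exact Complex.reCLM.contDiff.comp h

/-- Poisson equation for the logarithmic potential of a test function. -/
lemma qlap_log_potential {g : ℂ → ℝ} (hg : ContDiff ℝ ∞ g) (hc : HasCompactSupport g) (z : ℂ) :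
    qlap (rcv (lreg 0) g) z = cpi * g z := by
  have hl := locallyIntegrable_lreg_zero.ofReal'
  have hgc : HasCompactSupport (fun z => (g z : ℂ)) := hc.comp_left Complex.ofReal_zero
  have h : (qlap (rcv (lreg 0) g) z : ℂ) = cpi * g z := by
    rw [ofReal_qlap (contDiff_rcv locallyIntegrable_lreg_zero hg hc)]
    have e : (fun z => (rcv (lreg 0) g z : ℂ)) =
      cv (fun z => (lreg 0 z : ℂ)) (fun z => (g z : ℂ)) := funext (ofReal_rcv _ _)
    rw [e, dzb_cv hl hg.ofReal' hgc, dz_cv hl hg.ofReal'.dzb hgc.dzb]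
    have sh : ContDiff ℝ ∞ (fun ζ => (g (z - ζ) : ℂ)) :=
      hg.ofReal'.comp (contDiff_const.sub contDiff_id)
    have chain : ∀ {u : ℂ → ℂ}, ContDiff ℝ ∞ u → ∀ ζ v,
        fderiv ℝ (fun ζ => u (z - ζ)) ζ v = - fderiv ℝ u (z - ζ) v := by
      intro u hu ζ v
      have h1 := (hu.differentiable (by simp) (z - ζ)).hasFDerivAt.comp ζ
        ((hasFDerivAt_const z ζ).sub (hasFDerivAt_id ζ))
      have h2 : fderiv ℝ (fun ζ => u (z - ζ)) ζ = _ := h1.fderiv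
      rw [h2]; simp
    have e1 : dzb (fun ζ => (g (z - ζ) : ℂ)) = fun ζ => -dzb (fun z => (g z : ℂ)) (z - ζ) := by
      funext ζ
      rw [dzb, chain hg.ofReal', chain hg.ofReal', dzb]; ring
    have e2 : dz (dzb (fun ζ => (g (z - ζ) : ℂ))) = fun ζ => dz (dzb (fun z => (g z : ℂ))) (z - ζ) := by
      funext ζ
      have e3 : dzb (fun ζ => (g (z - ζ) : ℂ)) =
        fun ζ => (fun w => -dzb (fun z => (g z : ℂ)) w) (z - ζ) := e1
      rw [e3, dz, chain hg.ofReal'.dzb.neg, chain hg.ofReal'.dzb.neg, dz]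
      simp only [fderiv_fun_neg, neg_apply]
      ring
    have := integral_lreg_zero_mul_dz_dzb sh
      (hgc.comp_homeomorph (Homeomorph.subLeft z))
    rw [e2] at this
    simpa [cv] using this
  exact_mod_cast h

end reg

section qlap
variable {u v : ℂ → ℝ}

lemma qlap_eq_of_hasW {u : ℂ → ℝ} (hu : ContDiff ℝ ∞ u) {b : ℂ → ℂ} {x y z : ℂ}
    (h1 : dzb (fun z => (u z : ℂ)) = b) (h2 : HasW b x y z) : (qlap u z : ℂ) = x := by
  rw [ofReal_qlap hu, h1, h2.dz]

lemma qlap_add (hu : ContDiff ℝ ∞ u) (hv : ContDiff ℝ ∞ v) (z : ℂ) :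
    qlap (fun z => u z + v z) z = qlap u z + qlap v z := by
  have h1 : dzb (fun z => ((u z + v z : ℝ) : ℂ)) =
      fun z => dzb (fun z => (u z : ℂ)) z + dzb (fun z => (v z : ℂ)) z := by
    funext z; push_cast; exact ((hu.ofReal'.hasW z).add (hv.ofReal'.hasW z)).dzb
  have := qlap_eq_of_hasW (hu.add hv) h1 ((hu.ofReal'.dzb.hasW z).add (hv.ofReal'.dzb.hasW z))
  rw [← ofReal_qlap hu, ← ofReal_qlap hv] at this
  exact_mod_cast this

lemma qlap_const_mul (c : ℝ) (hu : ContDiff ℝ ∞ u) (z : ℂ) :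
    qlap (fun z => c * u z) z = c * qlap u z := by
  have h1 : dzb (fun z => ((c * u z : ℝ) : ℂ)) = fun z => c * dzb (fun z => (u z : ℂ)) z := by
    funext z; push_cast
    simpa using ((hasW_const (c:ℂ) z).mul (hu.ofReal'.hasW z)).dzb
  have := qlap_eq_of_hasW (contDiff_const.mul hu) h1
    ((hasW_const (c:ℂ) z).mul (hu.ofReal'.dzb.hasW z))
  rw [← ofReal_qlap hu, zero_mul, zero_add] at this
  exact_mod_cast this

lemma qlap_const (c : ℝ) (z : ℂ) : qlap (fun _ => c) z = 0 := by
  have h1 : dzb (fun _ => (c : ℂ)) = fun _ => 0 := by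
    funext z; exact (hasW_const (c:ℂ) z).dzb
  have := qlap_eq_of_hasW contDiff_const h1 (hasW_const 0 z)
  exact_mod_cast this

lemma qlap_mul (hu : ContDiff ℝ ∞ u) (hv : ContDiff ℝ ∞ v) (z : ℂ) :
    qlap (fun z => u z * v z) z = qlap u z * v z + u z * qlap v z
      + 2 * (dz (fun z => (u z : ℂ)) z * conj (dz (fun z => (v z : ℂ)) z)).re := by
  have h1 : dzb (fun z => ((u z * v z : ℝ) : ℂ)) =
      fun z => dzb (fun z => (u z : ℂ)) z * v z + u z * dzb (fun z => (v z : ℂ)) z := by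
    funext z; push_cast; exact ((hu.ofReal'.hasW z).mul (hv.ofReal'.hasW z)).dzb
  have := qlap_eq_of_hasW (hu.mul hv) h1
    (((hu.ofReal'.dzb.hasW z).mul (hv.ofReal'.hasW z)).add
      ((hu.ofReal'.hasW z).mul (hv.ofReal'.dzb.hasW z)))
  rw [← ofReal_qlap hu, ← ofReal_qlap hv, dzb_ofReal hu, dzb_ofReal hv] at this
  have q := Complex.add_conj (dz (fun z => (u z : ℂ)) z * conj (dz (fun z => (v z : ℂ)) z))
  rw [map_mul, Complex.conj_conj] at q
  rw [← Complex.ofReal_inj, this]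
  push_cast at q ⊢
  linear_combination q

lemma integral_mul_qlap (hu : ContDiff ℝ ∞ u) (hv : ContDiff ℝ ∞ v) (hc : HasCompactSupport v) :
    ∫ z, u z * qlap v z = ∫ z, qlap u z * v z := by
  have hvc : HasCompactSupport (fun z => (v z : ℂ)) := hc.comp_left Complex.ofReal_zero
  have h1 := integral_mul_dz hu.ofReal' hv.ofReal'.dzb hvc.dzb
  rw [integral_mul_dzb hu.ofReal'.dz hv.ofReal' hvc, neg_neg] at h1
  simp_rw [dz_dzb_comm hu.ofReal', ← ofReal_qlap hu, ← ofReal_qlap hv, ← Complex.ofReal_mul,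
    integral_complex_ofReal] at h1
  exact_mod_cast h1

lemma HasCompactSupport.qlap (hc : HasCompactSupport u) : HasCompactSupport (qlap u) := by
  have hvc : HasCompactSupport (fun z => (u z : ℂ)) := hc.comp_left Complex.ofReal_zero
  exact hvc.dzb.dz.comp_left (g := Complex.re) Complex.zero_re

lemma qlap_eq_zero_of_notMem {z : ℂ} (h : z ∉ tsupport u) : qlap u z = 0 := by
  have h1 : z ∉ tsupport (dzb (fun z => (u z : ℂ))) := fun hh => h <|
    closure_mono (Function.support_comp_subset Complex.ofReal_zero u) (tsupport_dzb_subset hh)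
  have : dz (dzb (fun z => (u z : ℂ))) z = 0 :=
    image_eq_zero_of_notMem_tsupport fun hh => h1 (tsupport_dz_subset hh)
  simp [qlap, this]

lemma dz_comp_sub (f : ℂ → ℂ) (a z : ℂ) : dz (fun z => f (z - a)) z = dz f (z - a) := by
  simp [dz, fderiv_comp_sub]

lemma dzb_comp_sub (f : ℂ → ℂ) (a z : ℂ) : dzb (fun z => f (z - a)) z = dzb f (z - a) := by
  simp [dzb, fderiv_comp_sub]

lemma qlap_comp_sub (a z : ℂ) : qlap (fun z => u (z - a)) z = qlap u (z - a) := by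
  unfold qlap
  have : dzb (fun z => (u (z - a) : ℂ)) = fun z => dzb (fun z => (u z : ℂ)) (z - a) :=
    funext (dzb_comp_sub (fun z => (u z : ℂ)) a)
  rw [this, dz_comp_sub]

/-- The bounded modification `σ + e^{-σ}`, strictly convex in `σ`. -/
noncomputable def cmod (σ : ℂ → ℝ) (z : ℂ) : ℝ := σ z + Real.exp (-σ z)

lemma contDiff_cmod (hu : ContDiff ℝ ∞ u) : ContDiff ℝ ∞ (cmod u) := hu.add hu.neg.exp

lemma qlap_cmod (hu : ContDiff ℝ ∞ u) (z : ℂ) :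
    qlap (cmod u) z = (1 - Real.exp (-u z)) * qlap u z
      + Real.exp (-u z) * ‖dz (fun z => (u z : ℂ)) z‖ ^ 2 := by
  have h0 : ∀ z, HasW (fun z => (Real.exp (-u z) : ℂ))
      (Complex.exp (-u z) * -dz (fun z => (u z : ℂ)) z)
      (Complex.exp (-u z) * -dzb (fun z => (u z : ℂ)) z) z := by
    intro z
    have := (hu.ofReal'.hasW z).neg.cexp
    push_cast
    exact this
  have h1 : dzb (fun z => (cmod u z : ℂ)) = fun z => dzb (fun z => (u z : ℂ)) z
      + (Real.exp (-u z) : ℂ) * -dzb (fun z => (u z : ℂ)) z := by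
    funext z
    have := ((hu.ofReal'.hasW z).add (h0 z)).dzb
    unfold cmod
    push_cast at this ⊢
    exact this
  have := qlap_eq_of_hasW (contDiff_cmod hu) h1
    ((hu.ofReal'.dzb.hasW z).add ((h0 z).mul (hu.ofReal'.dzb.hasW z).neg))
  rw [← ofReal_qlap hu, dzb_ofReal hu] at this
  have e : ((‖dz (fun z => (u z : ℂ)) z‖ : ℂ)) ^ 2 =
      dz (fun z => (u z : ℂ)) z * conj (dz (fun z => (u z : ℂ)) z) := by
    rw [Complex.mul_conj, Complex.normSq_eq_norm_sq]; push_cast; rfl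
  rw [← Complex.ofReal_inj, this]
  push_cast
  linear_combination -Complex.exp (-(u z : ℂ)) * e

lemma qlap_cmod_nonneg (hu : ContDiff ℝ ∞ u) {z : ℂ} (h0 : 0 ≤ u z) (h : 0 ≤ qlap u z) :
    0 ≤ qlap (cmod u) z := by
  rw [qlap_cmod hu]
  have : Real.exp (-u z) ≤ 1 := Real.exp_le_one_iff.2 (by linarith)
  have h3 : 0 ≤ 1 - Real.exp (-u z) := by linarith
  positivity

lemma cmod_nonneg {z : ℂ} (h0 : 0 ≤ u z) : 0 ≤ cmod u z := by unfold cmod; positivity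

lemma cmod_le {z : ℂ} (h0 : 0 ≤ u z) : cmod u z ≤ u z + 1 := by
  have : Real.exp (-u z) ≤ 1 := Real.exp_le_one_iff.2 (by linarith)
  unfold cmod; linarith

end qlap

lemma rcv_lreg_lower {θ : ℂ → ℝ} (hθ : ContDiff ℝ ∞ θ) (hθ0 : ∀ z, 0 ≤ θ z)
    {R : ℝ} (hθs : tsupport θ ⊆ closedBall 0 (2 * R)) (S : ℝ) (hS : 0 ≤ S) (T : ℝ) :
    ∃ A : ℝ, 0 ≤ A ∧ ∀ τ : ℂ → ℝ, ContDiff ℝ ∞ τ → (∀ z, 0 ≤ τ z) →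
      (∀ z ∈ closedBall 0 (2 * R), τ z ≤ S) →
      ∀ z ∈ closedBall (0:ℂ) T, -A ≤ rcv (lreg 0) (fun z => θ z * qlap τ z) z := by
  have hc : HasCompactSupport θ :=
    (isCompact_closedBall 0 (2*R)).of_isClosed_subset (isClosed_tsupport θ) hθs
  have hcC : HasCompactSupport (fun z => (θ z : ℂ)) := hc.comp_left Complex.ofReal_zero
  obtain ⟨C1, hC1⟩ := hθ.ofReal'.dz.continuous.bounded_above_of_compact_support hcC.dz
  obtain ⟨C2, hC2⟩ := hθ.qlap.continuous.bounded_above_of_compact_support hc.qlap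
  have hC1' : 0 ≤ C1 := (norm_nonneg _).trans (hC1 0)
  have hC2' : 0 ≤ C2 := (norm_nonneg _).trans (hC2 0)
  set M : ℂ → ℝ := fun ζ => 2 * C1 * ‖ζ‖⁻¹ + C2 * lmaj ζ with hM
  have hM0 : ∀ ζ, 0 ≤ M ζ := fun ζ => by have := lmaj_nonneg ζ; simp only [hM]; positivity
  have hMi : LocallyIntegrable M :=
    (locallyIntegrable_inv_norm.smul (2 * C1)).add (locallyIntegrable_lmaj.smul C2)
  have hMK : IntegrableOn M (closedBall 0 (2 * R + T)) :=
    hMi.integrableOn_isCompact (isCompact_closedBall _ _)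
  refine ⟨S * ∫ ζ in closedBall 0 (2 * R + T), M ζ, mul_nonneg hS (integral_nonneg hM0), ?_⟩
  intro τ hτ hτ0 hτS z hz
  have hg : ContDiff ℝ ∞ (fun z => θ z * qlap τ z) := hθ.mul hτ.qlap
  have hgc : HasCompactSupport (fun z => θ z * qlap τ z) := hc.mul_right
  have sh : ContDiff ℝ ∞ (fun ζ => ((θ (z - ζ) * qlap τ (z - ζ) : ℝ) : ℂ)) :=
    (hg.comp (contDiff_const.sub contDiff_id)).ofReal'
  have shc : HasCompactSupport (fun ζ => ((θ (z - ζ) * qlap τ (z - ζ) : ℝ) : ℂ)) :=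
    (hgc.comp_homeomorph (Homeomorph.subLeft z)).comp_left Complex.ofReal_zero
  have lim := tendsto_integral_lreg sh.continuous shc
  simp_rw [← Complex.ofReal_mul, integral_complex_ofReal] at lim
  have lim' : Tendsto (fun s : ℝ => ∫ ζ, lreg s ζ * (θ (z - ζ) * qlap τ (z - ζ))) (𝓝[>] 0)
      (𝓝 (rcv (lreg 0) (fun z => θ z * qlap τ z) z)) := by
    have := (Complex.continuous_re.tendsto _).comp lim
    simpa [rcv, Function.comp_def] using this
  refine ge_of_tendsto lim' ?_
  filter_upwards [mem_Ioc_zero_one] with s hs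
  have e1 : ∫ ζ, lreg s ζ * (θ (z - ζ) * qlap τ (z - ζ)) =
      ∫ w, (lreg s (w - z) * θ w) * qlap τ w := by
    rw [← integral_sub_left_eq_self _ volume z]
    congr 1; ext w
    have : lreg s (z - w) = lreg s (w - z) := by unfold lreg; rw [norm_sub_rev]
    simp only [sub_sub_cancel, this]; ring
  have sl : ContDiff ℝ ∞ (fun w => lreg s (w - z)) :=
    (contDiff_lreg hs.1).comp (contDiff_id.sub contDiff_const)
  have slθ : ContDiff ℝ ∞ (fun w => lreg s (w - z) * θ w) := sl.mul hθ
  have clθ : HasCompactSupport (fun w => lreg s (w - z) * θ w) := hc.mul_left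
  have e2 := integral_mul_qlap hτ slθ clθ
  have e3 : ∫ w, (lreg s (w - z) * θ w) * qlap τ w =
      ∫ w, τ w * qlap (fun w => lreg s (w - z) * θ w) w := by
    rw [e2]; congr 1; ext w; ring
  rw [e1, e3]
  have pt : ∀ᵐ w, -((closedBall z (2 * R + T)).indicator (fun w => S * M (w - z)) w) ≤
      τ w * qlap (fun w => lreg s (w - z) * θ w) w := by
    have hne : ∀ᵐ w : ℂ, w ≠ z := by simp [ae_iff]
    filter_upwards [hne] with w hwz
    by_cases hw : w ∈ closedBall (0:ℂ) (2 * R)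
    · have hwz' : w - z ≠ 0 := sub_ne_zero.2 hwz
      have hmem : w ∈ closedBall z (2 * R + T) := by
        rw [mem_closedBall] at *
        calc dist w z ≤ dist w 0 + dist 0 z := dist_triangle _ _ _
          _ ≤ 2 * R + T := by rw [dist_comm 0 z]; linarith
      rw [indicator_of_mem hmem, qlap_mul sl hθ, qlap_comp_sub, qlap_lreg hs.1]
      have ed : dz (fun w => (lreg s (w - z) : ℂ)) w = kreg s (w - z) := by
        rw [dz_comp_sub (fun w => (lreg s w : ℂ)), (hasW_lreg hs.1 _).dz]
      rw [ed]
      have b1 : 0 ≤ hreg s (w - z) * θ w := mul_nonneg (hreg_nonneg _) (hθ0 w)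
      have b2 : -(C2 * lmaj (w - z)) ≤ lreg s (w - z) * qlap θ w := by
        refine neg_le_of_abs_le ?_
        rw [abs_mul, mul_comm C2]
        exact mul_le_mul (lreg_abs_le hs.1.le hs.2 _ hwz') (hC2 w) (abs_nonneg _) (lmaj_nonneg _)
      have b3 : -(C1 * ‖w - z‖⁻¹) ≤
          (kreg s (w - z) * conj (dz (fun z => (θ z : ℂ)) w)).re := by
        refine neg_le_of_abs_le ((Complex.abs_re_le_norm _).trans ?_)
        rw [norm_mul, Complex.norm_conj, mul_comm C1]
        exact mul_le_mul (kreg_norm_le _) (hC1 w) (norm_nonneg _) (by positivity)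
      have b4 : -M (w - z) ≤ hreg s (w - z) * θ w + lreg s (w - z) * qlap θ w
          + 2 * (kreg s (w - z) * conj (dz (fun z => (θ z : ℂ)) w)).re := by
        simp only [hM]; linarith
      have b5 := hτS w hw
      have b6 := hτ0 w
      have b7 := hM0 (w - z)
      nlinarith
    · have : qlap (fun w => lreg s (w - z) * θ w) w = 0 := by
        refine qlap_eq_zero_of_notMem fun h => hw (hθs ?_)
        exact (tsupport_mul_subset_right (f := fun w => lreg s (w - z)) (g := θ)) h
      rw [this, mul_zero]
      refine neg_nonpos.2 (indicator_nonneg (fun w _ => ?_) w)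
      exact mul_nonneg hS (hM0 _)
  have hpre : (fun w => w - z) ⁻¹' closedBall (0:ℂ) (2 * R + T) = closedBall z (2 * R + T) := by
    ext w; simp [dist_eq_norm]
  have eind : (closedBall z (2 * R + T)).indicator (fun w => S * M (w - z)) =
      fun w => (closedBall (0:ℂ) (2 * R + T)).indicator (fun w => S * M w) (w - z) := by
    rw [← hpre]; rfl
  have hi0 : Integrable ((closedBall (0:ℂ) (2 * R + T)).indicator (fun w => S * M w)) :=
    (integrable_indicator_iff measurableSet_closedBall).2 (hMK.const_mul S)
  have hi1 : Integrable ((closedBall z (2 * R + T)).indicator (fun w => S * M (w - z))) := by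
    rw [eind]; exact hi0.comp_sub_right z
  have hi2 : Integrable (fun w => τ w * qlap (fun w => lreg s (w - z) * θ w) w) :=
    (hτ.continuous.mul slθ.qlap.continuous).integrable_of_hasCompactSupport clθ.qlap.mul_left
  have := integral_mono_ae hi1.neg hi2 pt
  refine le_trans (le_of_eq ?_) this
  simp only [Pi.neg_apply]
  rw [integral_neg, eind, integral_sub_right_eq_self
    (fun w => (closedBall (0:ℂ) (2 * R + T)).indicator (fun w => S * M w) w),
    integral_indicator measurableSet_closedBall, integral_const_mul]

lemma integrable_lreg_zero_shift {g : ℂ → ℝ} (hg : Continuous g) (hc : HasCompactSupport g) (z : ℂ) :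
    Integrable (fun ζ => lreg 0 (z - ζ) * g ζ) := by
  have h1 : Integrable (fun ζ => lreg 0 ζ * g (z - ζ)) :=
    locallyIntegrable_lreg_zero.integrable_smul_right_of_hasCompactSupport
      (hg.comp (continuous_const.sub continuous_id)) (hc.comp_homeomorph (Homeomorph.subLeft z))
  simpa using h1.comp_sub_left z

lemma rcv_lreg_upper {R : ℝ} {g : ℂ → ℝ} (hg : Continuous g)
    (hgs : tsupport g ⊆ closedBall 0 (2 * R)) (hg0 : ∀ z, 0 ≤ g z) (z : ℂ) :
    rcv (lreg 0) g z ≤ (Real.log (1 + ‖z‖ ^ 2) + Real.log (2 * (1 + (2 * R) ^ 2))) * ∫ z, g z := by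
  have hc : HasCompactSupport g :=
    (isCompact_closedBall 0 (2*R)).of_isClosed_subset (isClosed_tsupport g) hgs
  rw [rcv_swap, ← integral_const_mul]
  refine integral_mono (integrable_lreg_zero_shift hg hc z)
    ((hg.integrable_of_hasCompactSupport hc).const_mul _) fun ζ => ?_
  by_cases hζ : ζ ∈ tsupport g
  · refine mul_le_mul_of_nonneg_right ?_ (hg0 ζ)
    have h1 : ‖ζ‖ ≤ 2 * R := by simpa using hgs hζ
    have p1 : 0 < 1 + ‖z‖ ^ 2 := by positivity
    have p2 : 0 < 2 * (1 + (2 * R) ^ 2) := by positivity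
    rw [← Real.log_mul p1.ne' p2.ne']
    by_cases h0 : z - ζ = 0
    · simp only [lreg, h0]
      simp only [norm_zero, ne_eq, OfNat.ofNat_ne_zero, not_false_eq_true, zero_pow, add_zero,
        Real.log_zero]
      exact Real.log_nonneg (by nlinarith [sq_nonneg ‖z‖, sq_nonneg R])
    · refine Real.log_le_log (by have := norm_pos_iff.2 h0; positivity) ?_
      have h2 : ‖z - ζ‖ ≤ ‖z‖ + ‖ζ‖ := norm_sub_le _ _
      have h3 := norm_nonneg (z - ζ)
      have h4 := norm_nonneg ζ
      have h5 := norm_nonneg z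
      have h6 : ‖z - ζ‖ ^ 2 ≤ (‖z‖ + ‖ζ‖) ^ 2 := by gcongr
      have h7 : ‖ζ‖ ^ 2 ≤ (2 * R) ^ 2 := by gcongr
      nlinarith [sq_nonneg (‖z‖ - ‖ζ‖), mul_nonneg (sq_nonneg ‖z‖) (sq_nonneg (2 * R))]
  · simp [image_eq_zero_of_notMem_tsupport hζ]

lemma rcv_lreg_lower_far {R : ℝ} (hR : 0 < R) {g : ℂ → ℝ} (hg : Continuous g)
    (hgs : tsupport g ⊆ closedBall 0 (2 * R)) (hg0 : ∀ z, 0 ≤ g z) (z : ℂ) (hz : 4 * R + 1 ≤ ‖z‖) :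
    (Real.log (1 + ‖z‖ ^ 2) - Real.log 8) * ∫ z, g z ≤ rcv (lreg 0) g z := by
  have hc : HasCompactSupport g :=
    (isCompact_closedBall 0 (2*R)).of_isClosed_subset (isClosed_tsupport g) hgs
  rw [rcv_swap, ← integral_const_mul]
  refine integral_mono ((hg.integrable_of_hasCompactSupport hc).const_mul _)
    (integrable_lreg_zero_shift hg hc z) fun ζ => ?_
  by_cases hζ : ζ ∈ tsupport g
  · refine mul_le_mul_of_nonneg_right ?_ (hg0 ζ)
    have h1 : ‖ζ‖ ≤ 2 * R := by simpa using hgs hζ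
    have p1 : 0 < 1 + ‖z‖ ^ 2 := by positivity
    rw [← Real.log_div p1.ne' (by norm_num)]
    refine Real.log_le_log (by positivity) ?_
    have h2 : ‖z‖ - ‖ζ‖ ≤ ‖z - ζ‖ := norm_sub_norm_le _ _
    have h3 : ‖z‖ / 2 ≤ ‖z - ζ‖ := by linarith
    have h5 := norm_nonneg z
    nlinarith
  · simp [image_eq_zero_of_notMem_tsupport hζ]

/-- Uniform bounds for normalized logarithmic potentials. -/
lemma potential_bound {θ : ℂ → ℝ} (hθ : ContDiff ℝ ∞ θ) (hθ0 : ∀ z, 0 ≤ θ z)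
    {R : ℝ} (hR : 0 < R) (hθs : tsupport θ ⊆ closedBall 0 (2 * R)) (S : ℝ) (hS : 0 ≤ S)
    (c₁ : ℝ) (hc₁ : 0 < c₁) :
    ∃ A : ℝ, 0 ≤ A ∧ ∀ τ : ℂ → ℝ, ContDiff ℝ ∞ τ → (∀ z, 0 ≤ τ z) →
      (∀ z ∈ closedBall 0 (2 * R), τ z ≤ S) → (∀ z ∈ tsupport θ, 0 ≤ qlap τ z) →
      c₁ ≤ ∫ z, θ z * qlap τ z →
      ∀ z, |(∫ z, θ z * qlap τ z)⁻¹ * rcv (lreg 0) (fun z => θ z * qlap τ z) z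
        - Real.log (1 + ‖z‖ ^ 2)| ≤ A := by
  obtain ⟨A₀, hA₀, h⟩ := rcv_lreg_lower hθ hθ0 hθs S hS (4 * R + 1)
  set B := Real.log (2 * (1 + (2 * R) ^ 2))
  have hB : 0 ≤ B := Real.log_nonneg (by nlinarith [sq_nonneg R])
  set B' := Real.log (1 + (4 * R + 1) ^ 2)
  have hB' : 0 ≤ B' := Real.log_nonneg (by nlinarith [sq_nonneg (4 * R + 1)])
  have h8 : 0 ≤ Real.log 8 := Real.log_nonneg (by norm_num)
  refine ⟨B + (Real.log 8 + (A₀ / c₁ + B')), by positivity, ?_⟩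
  intro τ hτ hτ0 hτS hτq hcτ z
  set g : ℂ → ℝ := fun z => θ z * qlap τ z with hg
  have hgc : Continuous g := hθ.continuous.mul hτ.qlap.continuous
  have hgs : tsupport g ⊆ closedBall 0 (2 * R) := (tsupport_mul_subset_left).trans hθs
  have hg0 : ∀ z, 0 ≤ g z := by
    intro z
    by_cases hz : z ∈ tsupport θ
    · exact mul_nonneg (hθ0 z) (hτq z hz)
    · simp [hg, image_eq_zero_of_notMem_tsupport hz]
  have hcpos : 0 < ∫ z, g z := hc₁.trans_le hcτ
  have hA1 : 0 ≤ A₀ / c₁ := by positivity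
  rw [abs_le]
  constructor
  · rw [inv_mul_eq_div]
    rcases le_total (4 * R + 1) ‖z‖ with hz | hz
    · have h1 := rcv_lreg_lower_far hR hgc hgs hg0 z hz
      rw [← le_div_iff₀ hcpos] at h1
      linarith
    · have h1 := h τ hτ hτ0 hτS z (by simpa using hz)
      have h2 : -(A₀ / c₁) ≤ rcv (lreg 0) g z / ∫ z, g z := by
        rw [le_div_iff₀ hcpos]
        have : A₀ ≤ A₀ / c₁ * ∫ z, g z := by
          calc A₀ = A₀ / c₁ * c₁ := by field_simp
            _ ≤ _ := by gcongr
        linarith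
      have h3 : Real.log (1 + ‖z‖ ^ 2) ≤ B' :=
        Real.log_le_log (by positivity) (by gcongr)
      linarith
  · rw [inv_mul_eq_div]
    have h1 := rcv_lreg_upper hgc hgs hg0 z
    rw [← div_le_iff₀ hcpos] at h1
    linarith

/-- The weight in the final estimate. -/
noncomputable def wgt (z : ℂ) : ℝ := (‖z‖ * (1 + ‖z‖))⁻¹

lemma wgt_nonneg (z : ℂ) : 0 ≤ wgt z := by unfold wgt; positivity

lemma wgt_le (z : ℂ) : wgt z ≤ ‖z‖⁻¹ := by
  unfold wgt
  rw [mul_inv]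
  refine mul_le_of_le_one_right (by positivity) (inv_le_one_of_one_le₀ ?_)
  linarith [norm_nonneg z]

lemma norm_sq_mul_wgt_le (z : ℂ) : ‖z‖ ^ 2 * wgt z ≤ 1 := by
  unfold wgt
  rw [← div_eq_mul_inv]
  refine div_le_one_of_le₀ ?_ (by positivity)
  nlinarith [norm_nonneg z]

lemma measurable_wgt : Measurable wgt := by unfold wgt; fun_prop

lemma locallyIntegrable_wgt : LocallyIntegrable wgt := by
  refine locallyIntegrable_inv_norm.mono measurable_wgt.aestronglyMeasurable
    (ae_of_all _ fun z => ?_)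
  rw [Real.norm_of_nonneg (wgt_nonneg z), Real.norm_of_nonneg (by positivity)]
  exact wgt_le z

lemma log_twist_le {B t : ℝ} (hB : 1 ≤ B) (ht : 0 < t) :
    (Real.log (1 + t ^ 2) - Real.log (t ^ 2) + B) ^ 2 * (1 + t ^ 2)⁻¹ ≤
      2 * (4 + B) ^ 2 * (t * (1 + t))⁻¹ := by
  set q := Real.sqrt (1 + t⁻¹) with hq
  have hti : 0 < t⁻¹ := by positivity
  have hq1 : 1 ≤ q := by rw [hq]; exact Real.one_le_sqrt.2 (by linarith)
  have hq2 : q ^ 2 = 1 + t⁻¹ := Real.sq_sqrt (by positivity)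
  have h1 : Real.log (1 + t ^ 2) - Real.log (t ^ 2) ≤ 4 * q := by
    rw [← Real.log_div (by positivity) (by positivity)]
    have : (1 + t ^ 2) / t ^ 2 ≤ (q ^ 2) ^ 2 := by
      rw [hq2]
      have : (1 + t ^ 2) / t ^ 2 = 1 + (t⁻¹) ^ 2 := by field_simp; ring
      rw [this]; nlinarith
    calc _ ≤ Real.log ((q ^ 2) ^ 2) := Real.log_le_log (by positivity) this
      _ = 4 * Real.log q := by rw [← pow_mul, Real.log_pow]; norm_num
      _ ≤ 4 * q := by
        have := Real.log_le_sub_one_of_pos (by linarith : 0 < q); linarith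
  have h0 : 0 ≤ Real.log (1 + t ^ 2) - Real.log (t ^ 2) := by
    have := Real.log_le_log (by positivity : 0 < t ^ 2) (by linarith : t ^ 2 ≤ 1 + t ^ 2)
    linarith
  have h2 : (Real.log (1 + t ^ 2) - Real.log (t ^ 2) + B) ^ 2 ≤ (4 + B) ^ 2 * (1 + t⁻¹) := by
    rw [← hq2, ← mul_pow]
    refine pow_le_pow_left₀ (by linarith) ?_ 2
    nlinarith
  calc _ ≤ (4 + B) ^ 2 * (1 + t⁻¹) * (1 + t ^ 2)⁻¹ := by gcongr
    _ ≤ (4 + B) ^ 2 * (1 + t⁻¹) * (2 * ((1 + t) ^ 2)⁻¹) := by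
      gcongr
      rw [← div_eq_mul_inv, le_div_iff₀ (by positivity), inv_mul_le_iff₀ (by positivity)]
      nlinarith [sq_nonneg (t - 1)]
    _ = _ := by field_simp; ring

/-- The weighted estimate for the value of a test function at the origin. -/
lemma core_estimate {θ : ℂ → ℝ} (hθ : ContDiff ℝ ∞ θ) (hθ0 : ∀ z, 0 ≤ θ z) (hθ1 : ∀ z, θ z ≤ 1)
    {R : ℝ} (hR : 0 < R) (hθs : tsupport θ ⊆ closedBall 0 (2 * R)) (S : ℝ) (hS : 0 ≤ S)
    (c₁ : ℝ) (hc₁ : 0 < c₁) :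
    ∃ C : ℝ, 0 ≤ C ∧ ∃ m : ℕ, ∀ (σ : ℂ → ℝ) (K : Set ℂ), ContDiff ℝ ∞ σ → (∀ z, 0 ≤ σ z) →
      (∀ z ∈ closedBall 0 (2 * R), σ z ≤ S) → tsupport θ ⊆ K → (∀ z ∈ K, 0 ≤ qlap σ z) →
      c₁ ≤ ∫ z, θ z * qlap (cmod σ) z →
      ∀ β : ℂ → ℂ, ContDiff ℝ ∞ β → HasCompactSupport β → tsupport β ⊆ K → ∀ j : ℕ,
      ‖β 0‖ ^ 2 * Real.exp (2 * j * σ 0) ≤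
        C * ∫ z, ‖dzb β z‖ ^ 2 * wgt z * Real.exp (2 * (j + m : ℕ) * σ z) := by
  obtain ⟨A, hA, hP⟩ := potential_bound hθ hθ0 hR hθs (S + 1) (by linarith) c₁ hc₁
  obtain ⟨m, hm⟩ := exists_nat_ge (3 * (cpi / c₁))
  have hcp := cpi_pos
  refine ⟨cpi⁻¹ * Real.exp A * (6 * (Real.exp A * Real.exp (2 * m) * (2 * (4 + (2 * A + 1)) ^ 2))),
    by positivity, m, ?_⟩
  intro σ K hσ hσ0 hσS hθK hσq hcτ β hβ hβc hβK j
  have hτ := contDiff_cmod hσ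
  have hτ0 : ∀ z, 0 ≤ cmod σ z := fun z => cmod_nonneg (hσ0 z)
  have hτ1 : ∀ z, cmod σ z ≤ σ z + 1 := fun z => cmod_le (hσ0 z)
  have hτq : ∀ z ∈ K, 0 ≤ qlap (cmod σ) z := fun z hz => qlap_cmod_nonneg hσ (hσ0 z) (hσq z hz)
  have hP := hP (cmod σ) hτ hτ0 (fun z hz => (hτ1 z).trans (by linarith [hσS z hz]))
    (fun z hz => hτq z (hθK hz)) hcτ
  set τ := cmod σ with hτdef
  set c := ∫ z, θ z * qlap τ z with hc
  have hcpos : 0 < c := hc₁.trans_le hcτ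
  set g : ℂ → ℝ := fun z => θ z * qlap τ z with hg
  have hgs : ContDiff ℝ ∞ g := hθ.mul hτ.qlap
  have hθc : HasCompactSupport θ :=
    (isCompact_closedBall 0 (2*R)).of_isClosed_subset (isClosed_tsupport θ) hθs
  have hgc : HasCompactSupport g := hθc.mul_right
  have hg0 : ∀ z, 0 ≤ g z := by
    intro z
    by_cases hz : z ∈ tsupport θ
    · exact mul_nonneg (hθ0 z) (hτq z (hθK hz))
    · simp [hg, image_eq_zero_of_notMem_tsupport hz]
  have hrc := contDiff_rcv locallyIntegrable_lreg_zero hgs hgc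
  set P : ℂ → ℝ := fun z => c⁻¹ * rcv (lreg 0) g z with hPdef
  have hPs : ContDiff ℝ ∞ P := contDiff_const.mul hrc
  have hPq : ∀ z, qlap P z = cpi * c⁻¹ * g z := by
    intro z
    rw [hPdef, qlap_const_mul _ hrc, qlap_log_potential hgs hgc]; ring
  have hP1 : ∀ z, Real.log (1 + ‖z‖ ^ 2) - A ≤ P z := fun z => by
    have := (abs_le.1 (hP z)).1; linarith
  have hP2 : ∀ z, P z ≤ Real.log (1 + ‖z‖ ^ 2) + A := fun z => by
    have := (abs_le.1 (hP z)).2; linarith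
  set φ : ℂ → ℝ := fun z => (2 * j * σ z + 2 * m * τ z) + (-1) * P z with hφdef
  have hφs : ContDiff ℝ ∞ φ :=
    ((contDiff_const.mul hσ).add (contDiff_const.mul hτ)).add (contDiff_const.mul hPs)
  have hφq : ∀ z, qlap φ z = 2 * j * qlap σ z + 2 * m * qlap τ z - cpi * c⁻¹ * g z := by
    intro z
    rw [hφdef, qlap_add ((contDiff_const.mul hσ).add (contDiff_const.mul hτ))
      (contDiff_const.mul hPs), qlap_add (contDiff_const.mul hσ) (contDiff_const.mul hτ),
      qlap_const_mul _ hσ, qlap_const_mul _ hτ, qlap_const_mul _ hPs, hPq]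
    ring
  set M := ∫ z, ‖dzb β z‖ ^ 2 * wgt z * Real.exp (2 * (j + m : ℕ) * σ z) with hM
  set C₂ := Real.exp A * Real.exp (2 * m) * (2 * (4 + (2 * A + 1)) ^ 2) with hC₂
  have hmain : ∀ s : ℝ, 0 < s → s ≤ 1 →
      ∫ z, hreg s z * (‖β z‖ ^ 2 * Real.exp (φ z)) ≤ 6 * (C₂ * M) := by
    intro s hs hs1
    have hls := contDiff_lreg hs
    set w : ℂ → ℝ := fun z => ((-1) * lreg s z + P z) + (A + 1) with hw
    have hws : ContDiff ℝ ∞ w := ((contDiff_const.mul hls).add hPs).add contDiff_const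
    have hlr : ∀ z, lreg s z ≤ Real.log (1 + ‖z‖ ^ 2) := by
      intro z
      exact Real.log_le_log (by positivity) (by nlinarith)
    have hw1 : ∀ z, 1 ≤ w z := by
      intro z
      have := hP1 z; have := hlr z
      simp only [hw]; linarith
    have hwq : ∀ z, qlap w z = cpi * c⁻¹ * g z - hreg s z := by
      intro z
      rw [hw, qlap_add ((contDiff_const.mul hls).add hPs) contDiff_const,
        qlap_add (contDiff_const.mul hls) hPs, qlap_const_mul _ hls, hPq, qlap_const, qlap_lreg hs]
      ring
    have key := twisted_estimate hφs hws hβ hβc hw1 (fun z => hreg_nonneg z)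
      (continuous_hreg hs) (p := fun z => cpi * c⁻¹ * g z)
      (fun z => mul_nonneg (by positivity) (hg0 z)) hwq (fun z hz => by
        rw [hφq]
        have h1 : 0 ≤ 2 * (j:ℝ) * qlap σ z := mul_nonneg (by positivity) (hσq z (hβK hz))
        have h2 : 0 ≤ qlap τ z := hτq z (hβK hz)
        have h3 : cpi * c⁻¹ * g z ≤ cpi / c₁ * qlap τ z := by
          rw [hg, div_eq_mul_inv]
          have : θ z * qlap τ z ≤ qlap τ z := mul_le_of_le_one_left h2 (hθ1 z)
          have : 0 ≤ θ z * qlap τ z := mul_nonneg (hθ0 z) h2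
          gcongr
        have h4 : 3 * (cpi / c₁) * qlap τ z ≤ m * qlap τ z := by gcongr
        have h5 : 0 ≤ (m:ℝ) * qlap τ z := by positivity
        linarith)
    have e1 : ∫ z, hreg s z * (‖β z‖ ^ 2 * Real.exp (φ z)) =
        ∫ z, hreg s z * ‖β z‖ ^ 2 * Real.exp (φ z) := by
      congr 1; ext z; ring
    rw [e1]
    refine key.trans ?_
    gcongr
    rw [hM, ← integral_const_mul]
    have hdc : HasCompactSupport (fun z => ‖dzb β z‖ ^ 2) := by
      have := hβc.dzb
      refine this.comp_left (g := fun x : ℂ => ‖x‖ ^ 2) (by simp)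
    refine integral_mono_ae ?_ ?_ ?_
    · refine Continuous.integrable_of_hasCompactSupport ?_ ?_
      · have := hβ.dzb.continuous
        have := hws.continuous
        have := hφs.continuous
        fun_prop
      · exact (hdc.mul_left (f := fun z => w z ^ 2)).mul_right
    · have hcont : Continuous (fun z => ‖dzb β z‖ ^ 2 * Real.exp (2 * (j + m : ℕ) * σ z)) := by
        have := hβ.dzb.continuous
        have := hσ.continuous
        fun_prop
      have := locallyIntegrable_wgt.integrable_smul_right_of_hasCompactSupport hcont hdc.mul_right
      refine (this.const_mul C₂).congr (ae_of_all _ fun z => ?_)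
      simp only [smul_eq_mul]; ring
    · filter_upwards [ae_ne_zero] with z hz
      have hz0 : 0 < ‖z‖ := norm_pos_iff.2 hz
      have h1 : -lreg s z ≤ -Real.log (‖z‖ ^ 2) := by
        have := Real.log_le_log (by positivity : 0 < ‖z‖ ^ 2)
          (by nlinarith [sq_nonneg s] : ‖z‖ ^ 2 ≤ ‖z‖ ^ 2 + s ^ 2)
        simp only [lreg]; linarith
      have h2 : w z ≤ Real.log (1 + ‖z‖ ^ 2) - Real.log (‖z‖ ^ 2) + (2 * A + 1) := by
        have := hP2 z
        simp only [hw]; linarith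
      have h3 := log_twist_le (B := 2 * A + 1) (by linarith) hz0
      have h4 : w z ^ 2 ≤
          (Real.log (1 + ‖z‖ ^ 2) - Real.log (‖z‖ ^ 2) + (2 * A + 1)) ^ 2 :=
        pow_le_pow_left₀ (by linarith [hw1 z]) h2 2
      have h5 : Real.exp (φ z) ≤ (Real.exp A * Real.exp (2 * m) *
          Real.exp (2 * (j + m : ℕ) * σ z)) * (1 + ‖z‖ ^ 2)⁻¹ := by
        have : (1 + ‖z‖ ^ 2)⁻¹ = Real.exp (-Real.log (1 + ‖z‖ ^ 2)) := by
          rw [Real.exp_neg, Real.exp_log (by positivity)]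
        rw [this, ← Real.exp_add, ← Real.exp_add, ← Real.exp_add]
        apply Real.exp_le_exp.2
        have a1 := hP1 z
        have a2 : (m:ℝ) * τ z ≤ m * (σ z + 1) := by gcongr; exact hτ1 z
        simp only [hφdef]
        push_cast
        linarith
      have h6 : w z ^ 2 * (1 + ‖z‖ ^ 2)⁻¹ ≤ 2 * (4 + (2 * A + 1)) ^ 2 * wgt z := by
        refine le_trans ?_ h3
        gcongr
      calc w z ^ 2 * ‖dzb β z‖ ^ 2 * Real.exp (φ z)
          ≤ w z ^ 2 * ‖dzb β z‖ ^ 2 * ((Real.exp A * Real.exp (2 * m) *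
          Real.exp (2 * (j + m : ℕ) * σ z)) * (1 + ‖z‖ ^ 2)⁻¹) := by gcongr
        _ = (‖dzb β z‖ ^ 2 * (Real.exp A * Real.exp (2 * m) *
          Real.exp (2 * (j + m : ℕ) * σ z))) * (w z ^ 2 * (1 + ‖z‖ ^ 2)⁻¹) := by ring
        _ ≤ (‖dzb β z‖ ^ 2 * (Real.exp A * Real.exp (2 * m) *
          Real.exp (2 * (j + m : ℕ) * σ z))) * (2 * (4 + (2 * A + 1)) ^ 2 * wgt z) := by gcongr
        _ = _ := by rw [hC₂]; ring
  have hlim := tendsto_integral_hreg (g := fun z => ((‖β z‖ ^ 2 * Real.exp (φ z) : ℝ) : ℂ))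
    (by
      have := hβ.continuous
      have := hφs.continuous
      fun_prop)
    (by
      have h1 : HasCompactSupport (fun z => ‖β z‖ ^ 2) :=
        hβc.comp_left (g := fun x : ℂ => ‖x‖ ^ 2) (by simp)
      exact (h1.mul_right (f' := fun z => Real.exp (φ z))).comp_left (g := fun x : ℝ => (x:ℂ)) (by simp))
  have hlim' : Tendsto (fun s => ∫ z, hreg s z * (‖β z‖ ^ 2 * Real.exp (φ z)))
      (𝓝[>] 0) (𝓝 (cpi * (‖β 0‖ ^ 2 * Real.exp (φ 0)))) := by
    have h := (Complex.continuous_re.tendsto _).comp hlim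
    rw [← Complex.ofReal_mul, Complex.ofReal_re] at h
    refine h.congr fun s => ?_
    simp only [Function.comp, ← Complex.ofReal_mul]
    rw [integral_complex_ofReal, Complex.ofReal_re]
  have hfin : cpi * (‖β 0‖ ^ 2 * Real.exp (φ 0)) ≤ 6 * (C₂ * M) := by
    refine le_of_tendsto hlim' ?_
    filter_upwards [Ioc_mem_nhdsGT (zero_lt_one' ℝ)] with s hs
    exact hmain s hs.1 hs.2
  have hφ0 : Real.exp (2 * j * σ 0) ≤ Real.exp A * Real.exp (φ 0) := by
    rw [← Real.exp_add]
    apply Real.exp_le_exp.2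
    have a1 := hP2 0
    have a2 : 0 ≤ 2 * (m:ℝ) * τ 0 := mul_nonneg (by positivity) (hτ0 0)
    simp at a1
    simp only [hφdef]; linarith
  calc ‖β 0‖ ^ 2 * Real.exp (2 * j * σ 0)
      ≤ ‖β 0‖ ^ 2 * (Real.exp A * Real.exp (φ 0)) := by gcongr
    _ = cpi⁻¹ * Real.exp A * (cpi * (‖β 0‖ ^ 2 * Real.exp (φ 0))) := by field_simp
    _ ≤ cpi⁻¹ * Real.exp A * (6 * (C₂ * M)) := by gcongr
    _ = _ := by ring

section mollifier

/-- Unnormalized radial bump function. -/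
noncomputable def rbump (ε : ℝ) (z : ℂ) : ℝ := Real.smoothTransition (1 - ‖z‖ ^ 2 / ε ^ 2)

/-- Radial mollifier supported in the closed ball of radius `ε`. -/
noncomputable def mol (ε : ℝ) (z : ℂ) : ℝ := (∫ w, rbump ε w)⁻¹ * rbump ε z

variable {ε : ℝ}

lemma contDiff_rbump (ε : ℝ) : ContDiff ℝ ∞ (rbump ε) := by
  unfold rbump
  exact Real.smoothTransition.contDiff.comp
    (contDiff_const.sub ((contDiff_norm_sq ℝ).div_const _))

lemma contDiff_mol (ε : ℝ) : ContDiff ℝ ∞ (mol ε) := contDiff_const.mul (contDiff_rbump ε)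

lemma rbump_eq_zero (hε : 0 < ε) {z : ℂ} (hz : ε ≤ ‖z‖) : rbump ε z = 0 := by
  refine Real.smoothTransition.zero_of_nonpos ?_
  rw [sub_nonpos, le_div_iff₀ (by positivity), one_mul]
  gcongr

lemma rbump_nonneg (z : ℂ) : 0 ≤ rbump ε z := Real.smoothTransition.nonneg _

lemma hasCompactSupport_rbump (hε : 0 < ε) : HasCompactSupport (rbump ε) :=
  HasCompactSupport.intro (isCompact_closedBall 0 ε) fun z hz => by
    refine rbump_eq_zero hε ?_
    simp at hz; exact hz.le

lemma integral_rbump_pos (hε : 0 < ε) : 0 < ∫ w, rbump ε w := by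
  refine (contDiff_rbump ε).continuous.integral_pos_of_hasCompactSupport_nonneg_nonzero
    (hasCompactSupport_rbump hε) (fun z => rbump_nonneg z) (x := 0) ?_
  unfold rbump
  exact (Real.smoothTransition.pos_of_pos (by simp)).ne'

lemma mol_eq_zero (hε : 0 < ε) {z : ℂ} (hz : ε ≤ ‖z‖) : mol ε z = 0 := by
  rw [mol, rbump_eq_zero hε hz, mul_zero]

lemma mol_nonneg (hε : 0 < ε) (z : ℂ) : 0 ≤ mol ε z :=
  mul_nonneg (inv_nonneg.2 (integral_rbump_pos hε).le) (rbump_nonneg z)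

lemma hasCompactSupport_mol (hε : 0 < ε) : HasCompactSupport (mol ε) :=
  (hasCompactSupport_rbump hε).mul_left

lemma integral_mol (hε : 0 < ε) : ∫ w, mol ε w = 1 := by
  simp only [mol]
  rw [integral_const_mul, inv_mul_cancel₀ (integral_rbump_pos hε).ne']

lemma integrable_mol (hε : 0 < ε) : Integrable (mol ε) :=
  (contDiff_mol ε).continuous.integrable_of_hasCompactSupport (hasCompactSupport_mol hε)

lemma mol_radial (z : ℂ) : mol ε z = mol ε (‖z‖ : ℂ) := by
  simp [mol, rbump]

lemma circleMap_add_pi (c : ℂ) (t x : ℝ) :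
    circleMap c t (x + Real.pi) = c - t * Complex.exp (x * Complex.I) := by
  simp only [circleMap]
  push_cast
  rw [add_mul, Complex.exp_add, Complex.exp_pi_mul_I]; ring

variable {E : Type*} [NormedAddCommGroup E] [NormedSpace ℝ E]

lemma integral_mol_polar (hε : 0 < ε) {f : ℂ → E} (hf : StronglyMeasurable f) (c : ℂ) {B : ℝ}
    (hB : ∀ z ∈ closedBall c ε, ‖f z‖ ≤ B) :
    IntegrableOn (fun t : ℝ => (t * mol ε t) • ∫ x in (0:ℝ)..(2 * Real.pi), f (circleMap c t x)) (Ioi 0) ∧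
    ∫ w, mol ε w • f (c - w) =
      ∫ t in Ioi (0:ℝ), (t * mol ε t) • ∫ x in (0:ℝ)..(2 * Real.pi), f (circleMap c t x) := by
  have hpi := Real.pi_pos
  have hB0 : 0 ≤ B := (norm_nonneg _).trans (hB c (mem_closedBall_self hε.le))
  set F : ℝ × ℝ → E := fun p => (p.1 * mol ε p.1) • f (circleMap c p.1 (p.2 + Real.pi)) with hF
  have hmc := (contDiff_mol ε).continuous
  have hFm : StronglyMeasurable F := by
    have h1 : Continuous (fun p : ℝ × ℝ => p.1 * mol ε p.1) := by fun_prop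
    have h2 : Continuous (fun p : ℝ × ℝ => circleMap c p.1 (p.2 + Real.pi)) := by
      simp only [circleMap]; fun_prop
    exact h1.stronglyMeasurable.smul (hf.comp_measurable h2.measurable)
  have hint : IntegrableOn F (Ioi 0 ×ˢ Ioo (-Real.pi) Real.pi) (volume.prod volume) := by
    have h1 : IntegrableOn F (Ioc 0 ε ×ˢ Ioo (-Real.pi) Real.pi) (volume.prod volume) := by
      obtain ⟨C, hC⟩ := hmc.bounded_above_of_compact_support (hasCompactSupport_mol hε)
      refine Measure.integrableOn_of_bounded (M := ε * C * B) ?_ hFm.aestronglyMeasurable ?_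
      · rw [Measure.prod_prod]; simp [ENNReal.mul_eq_top]
      · filter_upwards [self_mem_ae_restrict (measurableSet_Ioc.prod measurableSet_Ioo)] with p hp
        have hp1 := hp.1
        rw [hF, norm_smul, norm_mul]
        have h3 : ‖f (circleMap c p.1 (p.2 + Real.pi))‖ ≤ B := by
          refine hB _ ?_
          have : dist (circleMap c p.1 (p.2 + Real.pi)) c = |p.1| := by
            simp [circleMap, dist_eq_norm, Complex.norm_exp]
          rw [mem_closedBall, this, abs_of_pos hp1.1]; exact hp1.2
        have h4 : ‖p.1‖ ≤ ε := by rw [Real.norm_of_nonneg hp1.1.le]; exact hp1.2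
        have := hC p.1
        have hC0 : 0 ≤ C := (norm_nonneg _).trans this
        gcongr
    refine h1.of_forall_sdiff_eq_zero (measurableSet_Ioi.prod measurableSet_Ioo) ?_
    rintro p ⟨hp, hp'⟩
    have : ε ≤ ‖(p.1 : ℂ)‖ := by
      rw [Complex.norm_real, Real.norm_of_nonneg (le_of_lt hp.1)]
      by_contra! h
      exact hp' ⟨⟨hp.1, h.le⟩, hp.2⟩
    rw [hF]; simp only; rw [mol_eq_zero hε this]; simp
  have hinner : ∀ t : ℝ, ∫ x in Ioo (-Real.pi) Real.pi, F (t, x) =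
      (t * mol ε t) • ∫ x in (0:ℝ)..(2 * Real.pi), f (circleMap c t x) := by
    intro t
    simp only [hF]
    rw [integral_smul, ← integral_Ioc_eq_integral_Ioo,
      ← intervalIntegral.integral_of_le (by linarith)]
    congr 1
    rw [intervalIntegral.integral_comp_add_right (fun x => f (circleMap c t x))]
    congr 1 <;> ring
  constructor
  · rw [IntegrableOn, ← Measure.prod_restrict] at hint
    refine hint.integral_prod_left.congr (ae_of_all _ fun t => ?_)
    exact hinner t
  · rw [← Complex.integral_comp_polarCoord_symm, polarCoord_target]
    have e : ∀ p ∈ Ioi (0:ℝ) ×ˢ Ioo (-Real.pi) Real.pi,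
        p.1 • (mol ε (Complex.polarCoord.symm p) • f (c - Complex.polarCoord.symm p)) = F p := by
      intro p hp
      have h1 : ‖Complex.polarCoord.symm p‖ = p.1 := by
        rw [Complex.norm_polarCoord_symm]; exact abs_of_pos hp.1
      rw [hF, mol_radial, h1, smul_smul]
      simp only
      rw [circleMap_add_pi, Complex.polarCoord_symm_apply]
      congr 3
      rw [Complex.exp_mul_I]; push_cast; ring
    rw [setIntegral_congr_fun (measurableSet_Ioi.prod measurableSet_Ioo) e]
    rw [Measure.volume_eq_prod, setIntegral_prod _ hint]
    exact integral_congr_ae (ae_of_all _ fun t => hinner t)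

lemma mol_polar_one (hε : 0 < ε) :
    IntegrableOn (fun t : ℝ => (t * mol ε t) * (2 * Real.pi)) (Ioi 0) ∧
    ∫ t in Ioi (0:ℝ), (t * mol ε t) * (2 * Real.pi) = 1 := by
  have h := integral_mol_polar hε (f := fun _ : ℂ => (1:ℝ)) stronglyMeasurable_const 0 (B := 1)
    (by simp)
  simp only [intervalIntegral.integral_const, smul_eq_mul, mul_one, sub_zero] at h
  rw [integral_mol hε] at h
  exact ⟨h.1, h.2.symm⟩

lemma mol_mean_eq [CompleteSpace E] (hε : 0 < ε) {f : ℂ → E} (hf : StronglyMeasurable f) (c : ℂ) {B : ℝ}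
    (hB : ∀ z ∈ closedBall c ε, ‖f z‖ ≤ B)
    (hm : ∀ t ∈ Ioc 0 ε, ∫ x in (0:ℝ)..(2 * Real.pi), f (circleMap c t x) = (2 * Real.pi) • f c) :
    ∫ w, mol ε w • f (c - w) = f c := by
  rw [(integral_mol_polar hε hf c hB).2]
  have : ∫ t in Ioi (0:ℝ), ((t * mol ε t) * (2 * Real.pi)) • f c = f c := by
    rw [integral_smul_const, (mol_polar_one hε).2, one_smul]
  rw [← this]
  refine setIntegral_congr_fun measurableSet_Ioi fun t ht => ?_
  rcases le_or_gt t ε with h | h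
  · rw [hm t ⟨ht, h⟩, smul_smul]
  · have : mol ε t = 0 := mol_eq_zero hε (by simpa [abs_of_pos ht.out] using h.le)
    simp [this]

lemma mol_mean_le (hε : 0 < ε) {f : ℂ → ℝ} (hf : StronglyMeasurable f) (c : ℂ) {B : ℝ}
    (hB : ∀ z ∈ closedBall c ε, ‖f z‖ ≤ B)
    (hm : ∀ t ∈ Ioc 0 ε, (2 * Real.pi) * f c ≤ ∫ x in (0:ℝ)..(2 * Real.pi), f (circleMap c t x)) :
    f c ≤ ∫ w, mol ε w * f (c - w) := by
  have h := integral_mol_polar hε hf c hB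
  simp only [smul_eq_mul] at h
  rw [h.2]
  have : ∫ t in Ioi (0:ℝ), ((t * mol ε t) * (2 * Real.pi)) * f c = f c := by
    rw [integral_mul_const, (mol_polar_one hε).2, one_mul]
  conv_lhs => rw [← this]
  refine setIntegral_mono_on ((mol_polar_one hε).1.mul_const _) h.1 measurableSet_Ioi fun t ht => ?_
  rcases le_or_gt t ε with h | h
  · have := mol_nonneg hε (t:ℂ)
    have := ht.out
    rw [mul_assoc]
    gcongr
    exact hm t ⟨ht, h⟩
  · have : mol ε t = 0 := mol_eq_zero hε (by simpa [abs_of_pos ht.out] using h.le)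
    simp [this]

end mollifier

lemma exists_continuous_antitone_approx {v : ℂ → ℝ} (hv : UpperSemicontinuous v) {S : ℝ}
    (h0 : ∀ z, 0 ≤ v z) (hS : ∀ z, v z ≤ S) :
    ∃ φ : ℕ → ℂ → ℝ, (∀ n, Continuous (φ n)) ∧ (∀ n z, v z ≤ φ n z) ∧ (∀ n z, φ n z ≤ S) ∧
      ∀ z, Tendsto (fun n => φ n z) atTop (𝓝 (v z)) := by
  set φ : ℕ → ℂ → ℝ := fun n z => ⨆ w, (v w - n * dist z w) with hφ
  have hbd : ∀ (n : ℕ) z, BddAbove (range fun w => v w - n * dist z w) := by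
    intro n z
    refine ⟨S, ?_⟩
    rintro _ ⟨w, rfl⟩
    have : 0 ≤ (n:ℝ) * dist z w := mul_nonneg (Nat.cast_nonneg _) dist_nonneg
    simp only; linarith [hS w]
  have hle : ∀ n z, v z ≤ φ n z := by
    intro n z
    have := le_ciSup (hbd n z) z
    simpa using this
  have hleS : ∀ n z, φ n z ≤ S := by
    intro n z
    refine ciSup_le fun w => ?_
    have : 0 ≤ (n:ℝ) * dist z w := mul_nonneg (Nat.cast_nonneg _) dist_nonneg
    linarith [hS w]
  refine ⟨φ, fun n => ?_, hle, hleS, fun z => ?_⟩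
  · refine (LipschitzWith.of_le_add_mul (n : NNReal) fun x y => ?_).continuous
    refine ciSup_le fun w => ?_
    have h1 := le_ciSup (hbd n y) w
    have h2 : (n:ℝ) * dist y w ≤ n * (dist x y + dist x w) := by
      gcongr; rw [dist_comm x y]; exact dist_triangle _ _ _
    have h3 : v w - n * dist y w ≤ φ n y := h1
    push_cast
    linarith
  · refine tendsto_order.2 ⟨fun a ha => Eventually.of_forall fun n => ha.trans_le (hle n z),
      fun a ha => ?_⟩
    obtain ⟨b, hb1, hb2⟩ := exists_between ha
    obtain ⟨δ, hδ, hδv⟩ := Metric.eventually_nhds_iff.1 (hv z b hb1)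
    obtain ⟨N, hN⟩ := exists_nat_ge (S / δ)
    filter_upwards [eventually_ge_atTop N] with n hn
    refine lt_of_le_of_lt (ciSup_le fun w => ?_) hb2
    rcases lt_or_ge (dist z w) δ with h | h
    · have := hδv (y := w) (by rwa [dist_comm])
      have h0 : 0 ≤ (n:ℝ) * dist z w := mul_nonneg (Nat.cast_nonneg _) dist_nonneg
      linarith
    · have h1 : S ≤ n * δ := by
        rw [div_le_iff₀ hδ] at hN
        refine hN.trans ?_
        gcongr
      have : (n:ℝ) * δ ≤ n * dist z w := by gcongr
      linarith [hS w, h0 z]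

lemma hasDerivAt_integral_of_continuous {F F' : ℝ → ℝ → ℂ} {a b : ℝ} (hF : Continuous F.uncurry)
    (hF' : Continuous F'.uncurry) (hd : ∀ t x, HasDerivAt (fun t => F t x) (F' t x) t) (t : ℝ) :
    HasDerivAt (fun t => ∫ x in a..b, F t x) (∫ x in a..b, F' t x) t := by
  obtain ⟨C, hC⟩ := ((isCompact_closedBall t 1).prod (isCompact_uIcc (a := a) (b := b))).exists_bound_of_continuousOn
    hF'.continuousOn
  have h1 : ∀ t, Continuous (F t) := fun t => hF.comp (by fun_prop : Continuous fun x => (t, x))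
  have h2 : ∀ t, Continuous (F' t) := fun t => hF'.comp (by fun_prop : Continuous fun x => (t, x))
  refine (intervalIntegral.hasDerivAt_integral_of_dominated_loc_of_deriv_le
    (bound := fun _ => C) (closedBall_mem_nhds t one_pos)
    (Eventually.of_forall fun t => (h1 t).aestronglyMeasurable) ((h1 t).intervalIntegrable _ _)
    (h2 t).aestronglyMeasurable (ae_of_all _ fun x hx s hs => ?_) intervalIntegrable_const
    (ae_of_all _ fun x _ s _ => hd s x)).2
  exact hC (s, x) ⟨hs, uIoc_subset_uIcc hx⟩

lemma hasDerivAt_circleMap_radius (c : ℂ) (t x : ℝ) :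
    HasDerivAt (fun t => circleMap c t x) (Complex.exp (x * Complex.I)) t := by
  simp only [circleMap]
  have := (Complex.ofRealCLM.hasDerivAt (x := t)).mul_const (Complex.exp (x * Complex.I))
  simpa using this.const_add c

lemma hasDerivAt_comp_circleMap {f : ℂ → ℂ} (hf : ContDiff ℝ ∞ f) (c : ℂ) (t x : ℝ) :
    HasDerivAt (fun t => f (circleMap c t x)) (dz f (circleMap c t x) * Complex.exp (x * Complex.I)
      + dzb f (circleMap c t x) * Complex.exp (-(x * Complex.I))) t := by
  have h0 : HasFDerivAt f _ (circleMap c t x) := hf.hasW (circleMap c t x)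
  have h := h0.comp_hasDerivAt t (hasDerivAt_circleMap_radius c t x)
  rw [wlin_apply, ← Complex.exp_conj] at h
  simp only [map_mul, Complex.conj_ofReal, Complex.conj_I, mul_neg] at h
  exact h

lemma integral_exp_int_mul_I {n : ℤ} (hn : n ≠ 0) :
    ∫ x in (0:ℝ)..(2 * Real.pi), Complex.exp (n * (x * Complex.I)) = 0 := by
  have h := integral_exp_mul_complex (a := 0) (b := 2 * Real.pi) (c := n * Complex.I)
    (by simp [hn])
  have e : ∀ x : ℝ, Complex.exp (n * Complex.I * x) = Complex.exp (n * (x * Complex.I)) := by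
    intro x; congr 1; ring
  simp only [e] at h
  rw [h]
  have : Complex.exp (n * ((2 * Real.pi : ℝ) * Complex.I)) = 1 := by
    push_cast
    exact Complex.exp_int_mul_two_pi_mul_I n
  rw [this]; simp

lemma qlap_nonneg_of_submean {σ : ℂ → ℝ} (hσ : ContDiff ℝ ∞ σ) (c : ℂ) {ε : ℝ} (hε : 0 < ε)
    (hm : ∀ t ∈ Ioo 0 ε, 2 * Real.pi * σ c ≤ ∫ x in (0:ℝ)..(2 * Real.pi), σ (circleMap c t x)) :
    0 ≤ qlap σ c := by
  set f : ℂ → ℂ := fun z => (σ z : ℂ) with hf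
  have hfs : ContDiff ℝ ∞ f := hσ.ofReal'
  set e : ℝ → ℂ := fun x => Complex.exp (x * Complex.I) with he
  set e' : ℝ → ℂ := fun x => Complex.exp (-(x * Complex.I)) with he'
  have hec : Continuous e := by fun_prop
  have he'c : Continuous e' := by fun_prop
  have hcm : Continuous (fun p : ℝ × ℝ => circleMap c p.1 p.2) := by simp only [circleMap]; fun_prop
  set G : ℝ → ℂ := fun t => ∫ x in (0:ℝ)..(2 * Real.pi), f (circleMap c t x) with hG
  set G1 : ℝ → ℂ := fun t => ∫ x in (0:ℝ)..(2 * Real.pi),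
    (dz f (circleMap c t x) * e x + dzb f (circleMap c t x) * e' x) with hG1
  have d1 : ∀ t, HasDerivAt G (G1 t) t := by
    intro t
    refine hasDerivAt_integral_of_continuous (F := fun t x => f (circleMap c t x))
      (F' := fun t x => dz f (circleMap c t x) * e x + dzb f (circleMap c t x) * e' x) ?_ ?_ ?_ t
    · exact hfs.continuous.comp hcm
    · have a1 := hfs.dz.continuous.comp hcm
      have a2 := hfs.dzb.continuous.comp hcm
      exact (a1.mul (hec.comp continuous_snd)).add (a2.mul (he'c.comp continuous_snd))
    · intro t x; exact hasDerivAt_comp_circleMap hfs c t x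
  have d2 : HasDerivAt G1 (4 * Real.pi * dzb (dz f) c) 0 := by
    have h := hasDerivAt_integral_of_continuous (a := 0) (b := 2 * Real.pi)
      (F := fun t x => (dz f (circleMap c t x) * e x + dzb f (circleMap c t x) * e' x))
      (F' := fun t x => (dz (dz f) (circleMap c t x) * e x + dzb (dz f) (circleMap c t x) * e' x) * e x
        + (dz (dzb f) (circleMap c t x) * e x + dzb (dzb f) (circleMap c t x) * e' x) * e' x)
      ?_ ?_ ?_ 0
    · convert h using 1
      have hc0 : ∀ x, circleMap c 0 x = c := fun x => by simp [circleMap]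
      have hee : ∀ x, e x * e' x = 1 := fun x => by
        simp only [he, he']; rw [← Complex.exp_add]; simp
      have e1 : ∀ x, (dz (dz f) (circleMap c 0 x) * e x + dzb (dz f) (circleMap c 0 x) * e' x) * e x
        + (dz (dzb f) (circleMap c 0 x) * e x + dzb (dzb f) (circleMap c 0 x) * e' x) * e' x =
        dz (dz f) c * Complex.exp ((2:ℤ) * (x * Complex.I)) +
        dzb (dzb f) c * Complex.exp ((-2:ℤ) * (x * Complex.I)) + 2 * dzb (dz f) c := by
        intro x
        have t1 : Complex.exp ((2:ℤ) * (x * Complex.I)) = e x * e x := by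
          simp only [he]; rw [← Complex.exp_add]; congr 1; push_cast; ring
        have t2 : Complex.exp ((-2:ℤ) * (x * Complex.I)) = e' x * e' x := by
          simp only [he']; rw [← Complex.exp_add]; congr 1; push_cast; ring
        rw [hc0, t1, t2, dz_dzb_comm hfs]
        linear_combination (2 * dz (dzb f) c) * hee x
      simp only [e1]
      have c1 : Continuous (fun x : ℝ => Complex.exp ((2:ℤ) * (x * Complex.I))) := by fun_prop
      have c2 : Continuous (fun x : ℝ => Complex.exp ((-2:ℤ) * (x * Complex.I))) := by fun_prop
      rw [intervalIntegral.integral_add, intervalIntegral.integral_add,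
        intervalIntegral.integral_const_mul, intervalIntegral.integral_const_mul,
        integral_exp_int_mul_I (by norm_num), integral_exp_int_mul_I (by norm_num)]
      · simp; ring
      all_goals apply Continuous.intervalIntegrable; fun_prop
    · have a1 := hfs.dz.continuous.comp hcm
      have a2 := hfs.dzb.continuous.comp hcm
      exact (a1.mul (hec.comp continuous_snd)).add (a2.mul (he'c.comp continuous_snd))
    · have a1 := hfs.dz.dz.continuous.comp hcm
      have a2 := hfs.dz.dzb.continuous.comp hcm
      have a3 := hfs.dzb.dz.continuous.comp hcm
      have a4 := hfs.dzb.dzb.continuous.comp hcm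
      have b1 := hec.comp (continuous_snd (X := ℝ) (Y := ℝ))
      have b2 := he'c.comp (continuous_snd (X := ℝ) (Y := ℝ))
      exact (((a1.mul b1).add (a2.mul b2)).mul b1).add (((a3.mul b1).add (a4.mul b2)).mul b2)
    · intro t x
      exact ((hasDerivAt_comp_circleMap hfs.dz c t x).mul_const _).add
        ((hasDerivAt_comp_circleMap hfs.dzb c t x).mul_const _)
  have hG10 : G1 0 = 0 := by
    have hc0 : ∀ x, circleMap c 0 x = c := fun x => by simp [circleMap]
    have t1 := integral_exp_int_mul_I (n := 1) (by norm_num)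
    have t2 := integral_exp_int_mul_I (n := -1) (by norm_num)
    simp only [Int.cast_one, one_mul, Int.cast_neg, neg_mul] at t1 t2
    simp only [hG1, hc0]
    rw [intervalIntegral.integral_add, intervalIntegral.integral_const_mul,
      intervalIntegral.integral_const_mul, t1, t2]
    · simp
    all_goals apply Continuous.intervalIntegrable; fun_prop
  set g : ℝ → ℝ := fun t => ∫ x in (0:ℝ)..(2 * Real.pi), σ (circleMap c t x) with hg
  have hgG : ∀ t, G t = (g t : ℂ) := fun t => by
    simp only [hG, hf, hg]; exact intervalIntegral.integral_ofReal
  have r1 : ∀ t, HasDerivAt g (G1 t).re t := by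
    intro t
    have := Complex.reCLM.hasFDerivAt.comp_hasDerivAt t (d1 t)
    refine this.congr_of_eventuallyEq (Eventually.of_forall fun s => ?_)
    simp [hgG]
  have hdg : deriv g = fun t => (G1 t).re := funext fun t => (r1 t).deriv
  have r2 : HasDerivAt (fun t => (G1 t).re) (4 * Real.pi * dzb (dz f) c).re 0 :=
    Complex.reCLM.hasFDerivAt.comp_hasDerivAt 0 d2
  have hval : (4 * Real.pi * dzb (dz f) c).re = 4 * Real.pi * qlap σ c := by
    rw [dz_dzb_comm hfs, ← ofReal_qlap hσ]
    norm_cast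
  rw [hval] at r2
  by_contra! hneg
  have hpi := Real.pi_pos
  have hmax : IsLocalMax g 0 := by
    refine isLocalMax_of_deriv_deriv_neg ?_ ?_ (r1 0).continuousAt
    · rw [hdg, r2.deriv]; nlinarith
    · rw [hdg]; simp [hG10]
  have hg0 : g 0 = 2 * Real.pi * σ c := by simp [hg, circleMap]
  obtain ⟨δ, hδ, hδm⟩ := Metric.eventually_nhds_iff.1 hmax
  have hzero : ∀ t ∈ Ioo 0 (min ε δ), (G1 t).re = 0 := by
    intro t ht
    have : g =ᶠ[𝓝 t] fun _ => g 0 := by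
      filter_upwards [isOpen_Ioo.mem_nhds ht] with s hs
      refine le_antisymm (hδm ?_) ?_
      · rw [Real.dist_eq, sub_zero, abs_of_pos hs.1]; exact hs.2.trans_le (min_le_right _ _)
      · rw [hg0]; exact hm s ⟨hs.1, hs.2.trans_le (min_le_left _ _)⟩
    rw [← (r1 t).deriv, this.deriv_eq]; simp
  have hslope := hasDerivAt_iff_tendsto_slope.1 r2
  have hslope' : Tendsto (slope (fun t => (G1 t).re) 0) (𝓝[>] 0) (𝓝 (4 * Real.pi * qlap σ c)) :=
    hslope.mono_left (nhdsWithin_mono _ fun x (hx : 0 < x) => hx.ne')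
  have hlim0 : Tendsto (slope (fun t => (G1 t).re) 0) (𝓝[>] 0) (𝓝 0) := by
    refine tendsto_const_nhds.congr' ?_
    filter_upwards [Ioo_mem_nhdsGT (lt_min hε hδ)] with t ht
    rw [slope_def_field, hzero t ht, hG10]; simp
  have := tendsto_nhds_unique hslope' hlim0
  nlinarith

/-- Sub-mean value inequality over circles for a real function, via continuous majorants. -/
def CircleSub (u : ℂ → ℝ) (D : Set ℂ) : Prop :=
  ∀ c s, 0 < s → closedBall c s ⊆ D → ∀ φ : ℂ → ℝ, Continuous φ → (∀ z ∈ sphere c s, u z ≤ φ z) →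
    2 * Real.pi * u c ≤ ∫ x in (0:ℝ)..(2 * Real.pi), φ (circleMap c s x)

lemma upperSemicontinuous_indicator {u : ℂ → ℝ} {K D : Set ℂ} (hu : UpperSemicontinuousOn u D)
    (h0 : ∀ z ∈ D, 0 ≤ u z) (hD : IsOpen D) (hK : IsClosed K) (hKD : K ⊆ D) :
    UpperSemicontinuous (K.indicator u) := by
  intro z y hy
  by_cases hz : z ∈ K
  · rw [indicator_of_mem hz] at hy
    have h1 := hu z (hKD hz) y hy
    rw [hD.nhdsWithin_eq (hKD hz)] at h1
    filter_upwards [h1] with w hw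
    by_cases hwK : w ∈ K
    · rwa [indicator_of_mem hwK]
    · rw [indicator_of_notMem hwK]; exact (h0 z (hKD hz)).trans_lt hy
  · rw [indicator_of_notMem hz] at hy
    filter_upwards [hK.isOpen_compl.mem_nhds hz] with w hw
    rw [indicator_of_notMem hw]; exact hy

lemma circle_submean_of_usc {v : ℂ → ℝ} (hv : UpperSemicontinuous v) {S : ℝ}
    (h0 : ∀ z, 0 ≤ v z) (hS : ∀ z, v z ≤ S) {K : Set ℂ} (hm : CircleSub v K) {c : ℂ} {t : ℝ} (ht : 0 < t)
    (hK : closedBall c t ⊆ K) :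
    2 * Real.pi * v c ≤ ∫ x in (0:ℝ)..(2 * Real.pi), v (circleMap c t x) := by
  obtain ⟨φ, hφc, hφv, hφS, hφt⟩ := exists_continuous_antitone_approx hv h0 hS
  have hcm : Continuous (circleMap c t) := continuous_circleMap c t
  have hlim : Tendsto (fun n => ∫ x in (0:ℝ)..(2 * Real.pi), φ n (circleMap c t x)) atTop
      (𝓝 (∫ x in (0:ℝ)..(2 * Real.pi), v (circleMap c t x))) := by
    refine intervalIntegral.tendsto_integral_filter_of_dominated_convergence (fun _ => S)
      (Eventually.of_forall fun n => ((hφc n).comp hcm).aestronglyMeasurable)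
      (Eventually.of_forall fun n => ae_of_all _ fun x _ => ?_) intervalIntegrable_const
      (ae_of_all _ fun x _ => hφt _)
    rw [Real.norm_of_nonneg ((h0 _).trans (hφv n _))]
    exact hφS n _
  exact ge_of_tendsto' hlim fun n => hm c t ht hK (φ n) (hφc n) fun z _ => hφv n z

section
variable {v : ℂ → ℝ} {S ε : ℝ}

lemma rcv_mol_eq (v : ℂ → ℝ) (ε : ℝ) (z : ℂ) : rcv v (mol ε) z = ∫ w, mol ε w * v (z - w) := by
  rw [rcv_swap]; congr 1; ext w; ring

lemma integrable_mol_mul (hε : 0 < ε) (hv : Measurable v) (h0 : ∀ z, 0 ≤ v z) (hS : ∀ z, v z ≤ S) (z : ℂ) :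
    Integrable (fun w => mol ε w * v (z - w)) := by
  refine (integrable_mol hε).mul_bdd (c := S)
    ((hv.comp (measurable_const.sub measurable_id)).aestronglyMeasurable) (ae_of_all _ fun w => ?_)
  rw [Real.norm_of_nonneg (h0 _)]; exact hS _

lemma rcv_mol_nonneg (hε : 0 < ε) (h0 : ∀ z, 0 ≤ v z) (z : ℂ) : 0 ≤ rcv v (mol ε) z :=
  integral_nonneg fun w => mul_nonneg (h0 w) (mol_nonneg hε _)

lemma rcv_mol_le_of_le (hε : 0 < ε) (hv : Measurable v) (h0 : ∀ z, 0 ≤ v z) (hS : ∀ z, v z ≤ S) {z : ℂ}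
    {b : ℝ} (hb : ∀ w, ‖w‖ < ε → v (z - w) ≤ b) : rcv v (mol ε) z ≤ b := by
  rw [rcv_mol_eq]
  calc ∫ w, mol ε w * v (z - w) ≤ ∫ w, mol ε w * b := by
        refine integral_mono (integrable_mol_mul hε hv h0 hS z) ((integrable_mol hε).mul_const b)
          fun w => ?_
        rcases lt_or_ge ‖w‖ ε with h | h
        · exact mul_le_mul_of_nonneg_left (hb w h) (mol_nonneg hε w)
        · simp [mol_eq_zero hε h]
    _ = b := by rw [integral_mul_const, integral_mol hε, one_mul]

lemma rcv_mol_submean (hε : 0 < ε) (hv : UpperSemicontinuous v)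
    (h0 : ∀ z, 0 ≤ v z) (hS : ∀ z, v z ≤ S) {K : Set ℂ} (hm : CircleSub v K) {c : ℂ} {t : ℝ} (ht : 0 < t)
    (hK : closedBall c (t + ε) ⊆ K) :
    2 * Real.pi * rcv v (mol ε) c ≤ ∫ x in (0:ℝ)..(2 * Real.pi), rcv v (mol ε) (circleMap c t x) := by
  have hpi := Real.two_pi_pos
  have hvm : Measurable v := hv.measurable
  have hint : Integrable (Function.uncurry fun (x : ℝ) (w : ℂ) => mol ε w * v (circleMap c t x - w))
      ((volume.restrict (Ioc 0 (2 * Real.pi))).prod volume) := by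
    have h1 : Integrable (fun p : ℝ × ℂ => (1:ℝ) * mol ε p.2)
        ((volume.restrict (Ioc 0 (2 * Real.pi))).prod volume) :=
      (integrable_const (1:ℝ)).mul_prod (integrable_mol hε)
    simp only [one_mul] at h1
    have hcm : Continuous (fun p : ℝ × ℂ => circleMap c t p.1 - p.2) :=
      ((continuous_circleMap c t).comp continuous_fst).sub continuous_snd
    refine h1.mul_bdd (c := S) (hvm.comp hcm.measurable).aestronglyMeasurable (ae_of_all _ fun w => ?_)
    rw [Real.norm_of_nonneg (h0 _)]; exact hS _
  have hswap := integral_integral_swap hint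
  simp only [rcv_mol_eq]
  rw [intervalIntegral.integral_of_le hpi.le, hswap, ← integral_const_mul]
  refine integral_mono ((integrable_mol_mul hε hvm h0 hS c).const_mul _) hint.integral_prod_right
    fun w => ?_
  rw [integral_const_mul]
  rcases lt_or_ge ‖w‖ ε with h | h
  · have := circle_submean_of_usc hv h0 hS hm (c := c - w) ht (fun z hz => hK (by
      rw [mem_closedBall, dist_eq_norm] at hz ⊢
      calc ‖z - c‖ = ‖(z - (c - w)) - w‖ := by congr 1; ring
        _ ≤ _ := norm_sub_le _ _
        _ ≤ t + ε := by linarith))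
    rw [intervalIntegral.integral_of_le hpi.le] at this
    have e : ∀ x, circleMap (c - w) t x = circleMap c t x - w := fun x => by
      simp only [circleMap]; ring
    simp only [e] at this
    calc 2 * Real.pi * (mol ε w * v (c - w)) = mol ε w * (2 * Real.pi * v (c - w)) := by ring
      _ ≤ _ := mul_le_mul_of_nonneg_left this (mol_nonneg hε w)
  · simp [mol_eq_zero hε h]
end

/-- Smooth approximation of bounded subharmonic functions near a compact set. -/
lemma exists_regularization {u : ℂ → ℝ} {D K : Set ℂ} (hD : IsOpen D) (hu : UpperSemicontinuousOn u D)
    (h0 : ∀ z ∈ D, 0 ≤ u z) (hs : CircleSub u D) (hK : IsCompact K) (hKD : K ⊆ D) :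
    ∃ (v : ℂ → ℝ) (S : ℝ) (ε : ℕ → ℝ), Measurable v ∧ HasCompactSupport v ∧ 0 ≤ S ∧
      (∀ z, 0 ≤ v z) ∧ (∀ z, v z ≤ S) ∧ (∀ z ∈ K, v z = u z) ∧ (∀ k, 0 < ε k) ∧
      Tendsto ε atTop (𝓝 0) ∧ (∀ k, ∀ z ∈ K, 0 ≤ qlap (rcv v (mol (ε k))) z) ∧
      ∀ z ∈ K, Tendsto (fun k => rcv v (mol (ε k)) z) atTop (𝓝 (u z)) := by
  obtain ⟨δ₁, hδ₁, hδD⟩ := hK.exists_cthickening_subset_open hD hKD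
  set δ := δ₁ / 2 with hδdef
  have hδ : 0 < δ := by positivity
  set K₁ := cthickening δ₁ K
  have hK₁ : IsCompact K₁ := hK.cthickening
  have hv : UpperSemicontinuous (K₁.indicator u) :=
    upperSemicontinuous_indicator hu h0 hD hK₁.isClosed hδD
  set v := K₁.indicator u with hvdef
  have hv0 : ∀ z, 0 ≤ v z := fun z => indicator_nonneg (fun z hz => h0 z (hδD hz)) z
  have hvc : HasCompactSupport v :=
    HasCompactSupport.intro hK₁ fun z hz => indicator_of_notMem hz u
  obtain ⟨S, hS0, hvS⟩ : ∃ S, 0 ≤ S ∧ ∀ z, v z ≤ S := by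
    rcases K₁.eq_empty_or_nonempty with he | hne
    · exact ⟨0, le_rfl, fun z => by simp [hvdef, he]⟩
    · obtain ⟨a, ha, hmax⟩ := (hu.mono hδD).exists_isMaxOn hne hK₁
      refine ⟨u a, h0 a (hδD ha), fun z => ?_⟩
      by_cases hz : z ∈ K₁
      · rw [hvdef, indicator_of_mem hz]; exact hmax hz
      · rw [hvdef, indicator_of_notMem hz]; exact h0 a (hδD ha)
  have hvu : ∀ z ∈ K₁, v z = u z := fun z hz => indicator_of_mem hz u
  have hsub : CircleSub v K₁ := by
    intro c s hs' hcs φ hφ hle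
    rw [hvu c (hcs (mem_closedBall_self hs'.le))]
    exact hs c s hs' (hcs.trans hδD) φ hφ fun z hz =>
      (hvu z (hcs (sphere_subset_closedBall hz))).symm.le.trans (hle z hz)
  have hball : ∀ c ∈ K, closedBall c δ₁ ⊆ K₁ := fun c hc => closedBall_subset_cthickening hc δ₁
  have hKK : K ⊆ K₁ := self_subset_cthickening K
  have hε : ∀ k : ℕ, 0 < δ / (k + 1) := fun k => by positivity
  have hεδ : ∀ k : ℕ, δ / (k + 1) ≤ δ := fun k =>
    div_le_self hδ.le (by have : (0:ℝ) ≤ k := k.cast_nonneg; linarith)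
  have hεt : Tendsto (fun k : ℕ => δ / ((k:ℝ) + 1)) atTop (𝓝 0) :=
    tendsto_const_div_atTop_nhds_zero_nat δ |>.comp (tendsto_add_atTop_nat 1) |>.congr fun k => by simp
  have hvl : LocallyIntegrable v := by
    have : Integrable v := by
      refine (integrableOn_iff_integrable_of_support_subset (s := K₁) support_indicator_subset).1 ?_
      refine Measure.integrableOn_of_bounded (M := S) hK₁.measure_lt_top.ne
        hv.measurable.aestronglyMeasurable (ae_of_all _ fun z => ?_)
      rw [Real.norm_of_nonneg (hv0 z)]; exact hvS z
    exact this.locallyIntegrable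
  refine ⟨v, S, fun k => δ / (k + 1), hv.measurable, hvc, hS0, hv0, hvS, fun z hz => hvu z (hKK hz), hε,
    hεt, fun k z hz => ?_, fun z hz => ?_⟩
  · refine qlap_nonneg_of_submean (contDiff_rcv hvl (contDiff_mol _) (hasCompactSupport_mol (hε k))) z hδ
      fun t ht => rcv_mol_submean (hε k) hv hv0 hvS hsub ht.1 ?_
    refine (closedBall_subset_closedBall ?_).trans (hball z hz)
    have := hεδ k
    have := ht.2
    linarith
  · rw [← hvu z (hKK hz)]
    refine tendsto_order.2 ⟨fun a ha => Eventually.of_forall fun k => ha.trans_le ?_, fun a ha => ?_⟩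
    · rw [rcv_mol_eq]
      refine mol_mean_le (hε k) hv.measurable.stronglyMeasurable z (B := S) (fun w _ => ?_) fun t ht => ?_
      · rw [Real.norm_of_nonneg (hv0 w)]; exact hvS w
      · refine circle_submean_of_usc hv hv0 hvS hsub ht.1 ?_
        refine (closedBall_subset_closedBall ?_).trans (hball z hz)
        have := hεδ k
        have := ht.2
        linarith
    · obtain ⟨b, hb1, hb2⟩ := exists_between ha
      obtain ⟨η, hη, hηv⟩ := Metric.eventually_nhds_iff.1 (hv z b hb1)
      filter_upwards [hεt.eventually (gt_mem_nhds hη)] with k hk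
      refine (rcv_mol_le_of_le (hε k) hv.measurable hv0 hvS fun w hw => ?_).trans_lt hb2
      refine (hηv ?_).le
      simpa [dist_eq_norm] using hw.trans hk

lemma tendsto_energy {θ u : ℂ → ℝ} {σ : ℕ → ℂ → ℝ} {S : ℝ} (hθ : ContDiff ℝ ∞ θ)
    (hθc : HasCompactSupport θ) (hσ : ∀ k, ContDiff ℝ ∞ (σ k)) (h0 : ∀ k z, 0 ≤ σ k z)
    (hS : ∀ k z, σ k z ≤ S) (hlim : ∀ z ∈ tsupport θ, Tendsto (fun k => σ k z) atTop (𝓝 (u z))) :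
    Tendsto (fun k => ∫ z, θ z * qlap (cmod (σ k)) z) atTop (𝓝 (∫ z, cmod u z * qlap θ z)) := by
  have e : ∀ k, ∫ z, θ z * qlap (cmod (σ k)) z = ∫ z, cmod (σ k) z * qlap θ z := by
    intro k
    rw [integral_mul_qlap (contDiff_cmod (hσ k)) hθ hθc]
    congr 1; ext z; ring
  simp only [e]
  refine tendsto_integral_of_dominated_convergence (fun z => (S + 1) * |qlap θ z|)
    (fun k => ((contDiff_cmod (hσ k)).continuous.mul hθ.qlap.continuous).aestronglyMeasurable)
    (((hθ.qlap.continuous.integrable_of_hasCompactSupport hθc.qlap).abs).const_mul _)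
    (fun k => ae_of_all _ fun z => ?_) (ae_of_all _ fun z => ?_)
  · rw [norm_mul, Real.norm_eq_abs, Real.norm_eq_abs, abs_of_nonneg (cmod_nonneg (h0 k z))]
    gcongr
    exact (cmod_le (h0 k z)).trans (by linarith [hS k z])
  · by_cases hz : z ∈ tsupport θ
    · have h := hlim z hz
      refine (h.add ?_).mul_const _
      exact (Real.continuous_exp.tendsto _).comp h.neg
    · simp [qlap_eq_zero_of_notMem hz]

lemma energy_lower {θ σ : ℂ → ℝ} {S : ℝ} (hθ : ContDiff ℝ ∞ θ) (hθc : HasCompactSupport θ)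
    (hθ0 : ∀ z, 0 ≤ θ z) (hσ : ContDiff ℝ ∞ σ) (h0 : ∀ z, 0 ≤ σ z) (hS : ∀ z, σ z ≤ S)
    (hq : ∀ z ∈ tsupport θ, 0 ≤ qlap σ z) :
    ∫ z, θ z * ‖dz (fun z => (σ z : ℂ)) z‖ ^ 2 ≤ Real.exp S * ∫ z, θ z * qlap (cmod σ) z := by
  rw [← integral_const_mul]
  refine integral_mono ?_ ?_ fun z => ?_
  · refine Continuous.integrable_of_hasCompactSupport ?_ hθc.mul_right
    have := hθ.continuous
    have := hσ.ofReal'.dz.continuous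
    fun_prop
  · refine Continuous.integrable_of_hasCompactSupport ?_ hθc.mul_right.mul_left
    have := hθ.continuous
    have := (contDiff_cmod hσ).qlap.continuous
    fun_prop
  · by_cases hz : z ∈ tsupport θ
    · simp only
      rw [qlap_cmod hσ]
      have h1 : 0 ≤ (1 - Real.exp (-σ z)) * qlap σ z :=
        mul_nonneg (by simp [h0 z]) (hq z hz)
      have h2 : 1 ≤ Real.exp S * Real.exp (-σ z) := by
        rw [← Real.exp_add]; exact Real.one_le_exp (by linarith [hS z])
      have h3 := Real.exp_pos S
      set N := ‖dz (fun z => (σ z : ℂ)) z‖ ^ 2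
      have hN : 0 ≤ N := by positivity
      calc θ z * N ≤ θ z * (Real.exp S * Real.exp (-σ z) * N) := by
            have := hθ0 z
            gcongr
            exact le_mul_of_one_le_left hN h2
        _ ≤ θ z * (Real.exp S * Real.exp (-σ z) * N + Real.exp S * ((1 - Real.exp (-σ z)) * qlap σ z)) := by
            have := hθ0 z
            gcongr
            have := mul_nonneg h3.le h1
            linarith
        _ = _ := by ring
    · simp [image_eq_zero_of_notMem_tsupport hz]

lemma norm_integral_mul_dz_le {θ σ : ℂ → ℝ} {g : ℂ → ℂ} (hθ : ContDiff ℝ ∞ θ) (hθc : HasCompactSupport θ)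
    (hθ0 : ∀ z, 0 ≤ θ z) (hσ : ContDiff ℝ ∞ σ) (hg : ContDiff ℝ ∞ g) (hgc : HasCompactSupport g)
    (hgθ : ∀ z, g z ≠ 0 → θ z = 1) {t : ℝ} (ht : 0 < t) :
    ‖∫ z, (σ z : ℂ) * dz g z‖ ≤
      t * (∫ z, θ z * ‖dz (fun z => (σ z : ℂ)) z‖ ^ 2) + t⁻¹ * ∫ z, ‖g z‖ ^ 2 := by
  rw [integral_mul_dz hσ.ofReal' hg hgc, norm_neg, ← integral_const_mul, ← integral_const_mul]
  have hdc := hσ.ofReal'.dz.continuous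
  have i1 : Integrable fun z => t * (θ z * ‖dz (fun z => (σ z : ℂ)) z‖ ^ 2) := by
    refine Continuous.integrable_of_hasCompactSupport ?_ hθc.mul_right.mul_left
    have := hθ.continuous
    fun_prop
  have i2 : Integrable fun z => t⁻¹ * ‖g z‖ ^ 2 := by
    refine Continuous.integrable_of_hasCompactSupport ?_ ?_
    · have := hg.continuous
      fun_prop
    · exact HasCompactSupport.mul_left (hgc.comp_left (g := fun x : ℂ => ‖x‖ ^ 2) (by simp))
  rw [← integral_add i1 i2]
  refine norm_integral_le_of_norm_le (i1.add i2) (ae_of_all _ fun z => ?_)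
  by_cases hz : g z = 0
  · have := hθ0 z
    simp only [hz]
    simp
    positivity
  · rw [hgθ z hz, norm_mul, one_mul]
    set a := ‖dz (fun z => (σ z : ℂ)) z‖
    set b := ‖g z‖
    have h : 0 ≤ t⁻¹ * (t * a - b) ^ 2 := by positivity
    have h' : t⁻¹ * (t * a - b) ^ 2 = t * a ^ 2 + t⁻¹ * b ^ 2 - 2 * (a * b) := by field_simp; ring
    have : 0 ≤ a * b := by positivity
    linarith

/-- Positivity of the energy of a nonconstant subharmonic function. -/
lemma energy_pos {D : Set ℂ} {u θ : ℂ → ℝ} (hD : IsOpen D) (hu : UpperSemicontinuousOn u D)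
    (h0 : ∀ z ∈ D, 0 ≤ u z) (hs : CircleSub u D) {R : ℝ} (hR : 0 < R)
    (hθ : ContDiff ℝ ∞ θ) (hθc : HasCompactSupport θ)
    (hθ0 : ∀ z, 0 ≤ θ z) (hθ1 : ∀ z ∈ ball 0 R, θ z = 1) (hθD : tsupport θ ⊆ D)
    (hnc : ∀ δ > 0, ¬ ∃ c, ∀ z ∈ ball (0:ℂ) δ, u z = c) :
    0 < ∫ z, cmod u z * qlap θ z := by
  by_contra! hneg
  obtain ⟨v, S, ε, hvm, hvc, hS0, hv0, hvS, hvu, hε, hεt, hq, hlim⟩ :=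
    exists_regularization hD hu h0 hs hθc hθD
  have hvi : Integrable v := by
    refine (integrableOn_iff_integrable_of_support_subset (subset_tsupport v)).1 ?_
    refine Measure.integrableOn_of_bounded (M := S) hvc.measure_lt_top.ne
      hvm.aestronglyMeasurable (ae_of_all _ fun z => ?_)
    rw [Real.norm_of_nonneg (hv0 z)]; exact hvS z
  have hvl := hvi.locallyIntegrable
  set σ : ℕ → ℂ → ℝ := fun k => rcv v (mol (ε k)) with hσdef
  have hσ : ∀ k, ContDiff ℝ ∞ (σ k) := fun k =>
    contDiff_rcv hvl (contDiff_mol _) (hasCompactSupport_mol (hε k))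
  have hσ0 : ∀ k z, 0 ≤ σ k z := fun k z => rcv_mol_nonneg (hε k) hv0 z
  have hσS : ∀ k z, σ k z ≤ S := fun k z => rcv_mol_le_of_le (hε k) hvm hv0 hvS fun w _ => hvS _
  have hen := tendsto_energy hθ hθc hσ hσ0 hσS hlim
  have hθmem : ∀ z ∈ ball (0:ℂ) R, z ∈ tsupport θ := fun z hz =>
    subset_tsupport _ (by rw [Function.mem_support, hθ1 z hz]; exact one_ne_zero)
  have hzero : ∀ g : ℂ → ℂ, ContDiff ℝ ∞ g → tsupport g ⊆ ball 0 R → HasCompactSupport g →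
      ∫ z, (v z : ℂ) * dz g z = 0 := by
    intro g hg hgR hgc
    have hl : Tendsto (fun k => ∫ z, (σ k z : ℂ) * dz g z) atTop (𝓝 (∫ z, (v z : ℂ) * dz g z)) := by
      refine tendsto_integral_of_dominated_convergence (fun z => S * ‖dz g z‖)
        (fun k => ((hσ k).ofReal'.continuous.mul hg.dz.continuous).aestronglyMeasurable)
        (((hg.dz.continuous.integrable_of_hasCompactSupport hgc.dz).norm).const_mul _)
        (fun k => ae_of_all _ fun z => ?_) (ae_of_all _ fun z => ?_)
      · rw [norm_mul, Complex.norm_real, Real.norm_of_nonneg (hσ0 k z)]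
        gcongr
        exact hσS k z
      · by_cases hz : z ∈ tsupport g
        · refine Tendsto.mul_const _ ((Complex.continuous_ofReal.tendsto _).comp ?_)
          have := hθmem z (hgR hz)
          rw [hvu z this]
          exact hlim z this
        · rw [image_eq_zero_of_notMem_tsupport (f := dz g) fun h => hz (tsupport_dz_subset h)]
          simp
    have hbound : ∀ t : ℝ, 0 < t → ‖∫ z, (v z : ℂ) * dz g z‖ ≤ t⁻¹ * ∫ z, ‖g z‖ ^ 2 := by
      intro t ht
      have h1 : ∀ k, ‖∫ z, (σ k z : ℂ) * dz g z‖ ≤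
          t * (Real.exp S * ∫ z, θ z * qlap (cmod (σ k)) z) + t⁻¹ * ∫ z, ‖g z‖ ^ 2 := by
        intro k
        refine (norm_integral_mul_dz_le hθ hθc hθ0 (hσ k) hg hgc (fun z hz => hθ1 z
          (hgR (subset_tsupport _ hz))) ht).trans ?_
        gcongr
        exact energy_lower hθ hθc hθ0 (hσ k) (hσ0 k) (hσS k) (hq k)
      have h2 := le_of_tendsto_of_tendsto' hl.norm
        (((hen.const_mul (Real.exp S)).const_mul t).add_const _) h1
      refine h2.trans ?_
      have : t * (Real.exp S * ∫ z, cmod u z * qlap θ z) ≤ 0 :=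
        mul_nonpos_of_nonneg_of_nonpos ht.le (mul_nonpos_of_nonneg_of_nonpos (Real.exp_pos S).le hneg)
      linarith
    have h3 : Tendsto (fun t : ℝ => t⁻¹ * ∫ z, ‖g z‖ ^ 2) atTop (𝓝 (0 * ∫ z, ‖g z‖ ^ 2)) :=
      tendsto_inv_atTop_zero.mul_const _
    rw [zero_mul] at h3
    have h4 : ‖∫ z, (v z : ℂ) * dz g z‖ ≤ 0 :=
      ge_of_tendsto h3 ((eventually_gt_atTop 0).mono hbound)
    exact norm_le_zero_iff.1 h4
  have hconst : ∀ᶠ k in atTop, ∀ z ∈ ball (0:ℂ) (R / 2), σ k z = σ k 0 := by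
    filter_upwards [hεt.eventually (gt_mem_nhds (half_pos hR))] with k hk z hz
    have hmol := (contDiff_mol (ε k)).ofReal'
    have hmolc : HasCompactSupport (fun z => (mol (ε k) z : ℂ)) :=
      (hasCompactSupport_mol (hε k)).comp_left (g := fun x : ℝ => (x:ℂ)) (by simp)
    have hσc : (fun z => (σ k z : ℂ)) = cv (fun z => (v z : ℂ)) (fun z => (mol (ε k) z : ℂ)) :=
      funext fun z => ofReal_rcv v (mol (ε k)) z
    have hdz : ∀ z ∈ ball (0:ℂ) (R / 2), dz (fun z => (σ k z : ℂ)) z = 0 := by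
      intro z hz
      rw [hσc, dz_cv hvl.ofReal' hmol hmolc]
      set g : ℂ → ℂ := fun ζ => (mol (ε k) (z - ζ) : ℂ) with hg
      have hgs : ContDiff ℝ ∞ g := hmol.comp (contDiff_const.sub contDiff_id)
      have hgsupp : ∀ ζ, ζ ∉ closedBall z (ε k) → g ζ = 0 := by
        intro ζ hζ
        rw [mem_closedBall, dist_eq_norm, norm_sub_rev, not_le] at hζ
        simp only [hg]; rw [mol_eq_zero (hε k) hζ.le]; simp
      have hgt : tsupport g ⊆ closedBall z (ε k) :=
        closure_minimal (fun ζ hζ => by by_contra h; exact hζ (hgsupp ζ h)) isClosed_closedBall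
      have hb : closedBall z (ε k) ⊆ ball 0 R := by
        intro ζ hζ
        rw [mem_ball, dist_eq_norm, sub_zero] at hz ⊢
        rw [mem_closedBall, dist_eq_norm] at hζ
        have := norm_add_le (ζ - z) z
        rw [sub_add_cancel] at this
        linarith
      have h5 := hzero g hgs (hgt.trans hb) (HasCompactSupport.intro (isCompact_closedBall z (ε k)) hgsupp)
      have h6 : ∀ ζ, dz g ζ = - dz (fun z => (mol (ε k) z : ℂ)) (z - ζ) := by
        intro ζ
        have chain : ∀ w, fderiv ℝ g ζ w = - fderiv ℝ (fun z => (mol (ε k) z : ℂ)) (z - ζ) w := by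
          intro w
          have h1 := (hmol.differentiable (by simp) (z - ζ)).hasFDerivAt.comp ζ
            ((hasFDerivAt_const z ζ).sub (hasFDerivAt_id ζ))
          have h2 : fderiv ℝ g ζ = _ := h1.fderiv
          rw [h2]; simp
        rw [dz, chain, chain, dz]; ring
      simp only [h6, mul_neg, integral_neg, neg_eq_zero] at h5
      exact h5
    have hdiff : Differentiable ℝ (fun z => (σ k z : ℂ)) := (hσ k).ofReal'.differentiable (by simp)
    have := isOpen_ball.is_const_of_fderiv_eq_zero (𝕜 := ℝ) (s := ball (0:ℂ) (R / 2))
      (convex_ball _ _).isPreconnected hdiff.differentiableOn (fun w hw => by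
        rw [fderiv_eq_wlin, dzb_ofReal (hσ k), hdz w hw]
        ext; simp) hz (mem_ball_self (half_pos hR))
    exact_mod_cast this
  refine hnc (R / 2) (half_pos hR) ⟨u 0, fun z hz => ?_⟩
  have h7 := hlim z (hθmem z (ball_subset_ball (by linarith) hz))
  have h8 := hlim 0 (hθmem 0 (mem_ball_self hR))
  refine tendsto_nhds_unique h7 (h8.congr' ?_)
  filter_upwards [hconst] with k hk
  exact (hk z hz).symm

/-- The a priori estimate for the Cauchy-Riemann operator with a nonconstant subharmonic weight. -/
lemma exists_apriori_estimate {D : Set ℂ} {u : ℂ → ℝ} (hD : IsOpen D) (h0D : (0:ℂ) ∈ D)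
    (hu : UpperSemicontinuousOn u D) (h0 : ∀ z ∈ D, 0 ≤ u z) (hs : CircleSub u D)
    (hnc : ∀ δ > 0, ¬ ∃ c, ∀ z ∈ ball (0:ℂ) δ, u z = c) :
    ∃ C : ℝ, 0 ≤ C ∧ ∃ m : ℕ, ∀ β : ℂ → ℂ, ContDiff ℝ ∞ β → HasCompactSupport β → tsupport β ⊆ D →
      ∀ j : ℕ, ‖β 0‖ ^ 2 * Real.exp (2 * j * u 0) ≤
        C * ∫ z, ‖dzb β z‖ ^ 2 * wgt z * Real.exp (2 * (j + m : ℕ) * u z) := by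
  obtain ⟨r, hr, hrD⟩ := Metric.isOpen_iff.1 hD 0 h0D
  set R := r / 4 with hRdef
  have hR : 0 < R := by positivity
  have h3D : closedBall (0:ℂ) (3 * R) ⊆ D := (closedBall_subset_ball (by linarith)).trans hrD
  let θ : ContDiffBump (0:ℂ) := ⟨R, 2 * R, hR, by linarith⟩
  have hθ : ContDiff ℝ ∞ (θ : ℂ → ℝ) := θ.contDiff
  have hθs : tsupport (θ : ℂ → ℝ) = closedBall 0 (2 * R) := θ.tsupport_eq
  have hθ1 : ∀ z ∈ ball (0:ℂ) R, (θ : ℂ → ℝ) z = 1 := fun z hz =>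
    θ.one_of_mem_closedBall (ball_subset_closedBall hz)
  have h23 : closedBall (0:ℂ) (2 * R) ⊆ closedBall 0 (3 * R) := closedBall_subset_closedBall (by linarith)
  have hc0 := energy_pos hD hu h0 hs hR hθ θ.hasCompactSupport (fun z => θ.nonneg) hθ1
    (hθs.trans_subset (h23.trans h3D)) hnc
  set c₀ := ∫ z, cmod u z * qlap (θ : ℂ → ℝ) z with hc₀
  obtain ⟨x₀, hx₀, hmax⟩ := (hu.mono h3D).exists_isMaxOn (nonempty_closedBall.2 (by positivity))
    (isCompact_closedBall (0:ℂ) (3 * R))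
  obtain ⟨C, hC, m, hcore⟩ := core_estimate hθ (fun z => θ.nonneg) (fun z => θ.le_one) hR hθs.subset
    (u x₀) (h0 _ (h3D hx₀)) (c₀ / 2) (by positivity)
  refine ⟨C, hC, m, fun β hβ hβc hβD j => ?_⟩
  set K := closedBall (0:ℂ) (3 * R) ∪ tsupport β with hK
  have hKD : K ⊆ D := union_subset h3D hβD
  obtain ⟨v, S, ε, hvm, hvc, hS0, hv0, hvS, hvu, hε, hεt, hq, hlim⟩ :=
    exists_regularization hD hu h0 hs ((isCompact_closedBall (0:ℂ) (3 * R)).union hβc) hKD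
  have hvi : Integrable v := by
    refine (integrableOn_iff_integrable_of_support_subset (subset_tsupport v)).1 ?_
    refine Measure.integrableOn_of_bounded (M := S) hvc.measure_lt_top.ne
      hvm.aestronglyMeasurable (ae_of_all _ fun z => ?_)
    rw [Real.norm_of_nonneg (hv0 z)]; exact hvS z
  set σ : ℕ → ℂ → ℝ := fun k => rcv v (mol (ε k)) with hσdef
  have hσ : ∀ k, ContDiff ℝ ∞ (σ k) := fun k =>
    contDiff_rcv hvi.locallyIntegrable (contDiff_mol _) (hasCompactSupport_mol (hε k))
  have hσ0 : ∀ k z, 0 ≤ σ k z := fun k z => rcv_mol_nonneg (hε k) hv0 z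
  have hσS : ∀ k z, σ k z ≤ S := fun k z => rcv_mol_le_of_le (hε k) hvm hv0 hvS fun w _ => hvS _
  have hθK : tsupport (θ : ℂ → ℝ) ⊆ K := hθs.trans_subset (h23.trans subset_union_left)
  have hen := tendsto_energy hθ θ.hasCompactSupport hσ hσ0 hσS fun z hz => hlim z (hθK hz)
  have h1 : ∀ᶠ k in atTop, ‖β 0‖ ^ 2 * Real.exp (2 * j * σ k 0) ≤
      C * ∫ z, ‖dzb β z‖ ^ 2 * wgt z * Real.exp (2 * (j + m : ℕ) * σ k z) := by
    filter_upwards [hεt.eventually (gt_mem_nhds hR), hen.eventually (lt_mem_nhds (half_lt_self hc0))]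
      with k hk hk2
    refine hcore (σ k) K (hσ k) (hσ0 k) (fun z hz => ?_) hθK (hq k) hk2.le β hβ hβc
      subset_union_right j
    refine rcv_mol_le_of_le (hε k) hvm hv0 hvS fun w hw => ?_
    have hzw : z - w ∈ closedBall (0:ℂ) (3 * R) := by
      rw [mem_closedBall, dist_zero_right] at hz ⊢
      have := norm_sub_le z w
      linarith
    rw [hvu _ (subset_union_left hzw)]
    exact hmax hzw
  have h0K : (0:ℂ) ∈ K := subset_union_left (mem_closedBall_self (by positivity))
  have hl1 : Tendsto (fun k => ‖β 0‖ ^ 2 * Real.exp (2 * j * σ k 0)) atTop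
      (𝓝 (‖β 0‖ ^ 2 * Real.exp (2 * j * u 0))) :=
    ((Real.continuous_exp.tendsto _).comp ((hlim 0 h0K).const_mul _)).const_mul _
  have hdc := hβ.dzb.continuous
  have hl2 : Tendsto (fun k => ∫ z, ‖dzb β z‖ ^ 2 * wgt z * Real.exp (2 * (j + m : ℕ) * σ k z)) atTop
      (𝓝 (∫ z, ‖dzb β z‖ ^ 2 * wgt z * Real.exp (2 * (j + m : ℕ) * u z))) := by
    refine tendsto_integral_of_dominated_convergence
      (fun z => ‖dzb β z‖ ^ 2 * wgt z * Real.exp (2 * (j + m : ℕ) * S)) (fun k => ?_) ?_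
      (fun k => ae_of_all _ fun z => ?_) (ae_of_all _ fun z => ?_)
    · have := (hσ k).continuous
      have h : Continuous fun z => Real.exp (2 * (j + m : ℕ) * σ k z) := by fun_prop
      exact ((by fun_prop : Continuous fun z => ‖dzb β z‖ ^ 2).measurable.mul
        measurable_wgt).aestronglyMeasurable.mul h.aestronglyMeasurable
    · refine Integrable.mul_const ?_ _
      have hc : HasCompactSupport fun z => ‖dzb β z‖ ^ 2 :=
        hβc.dzb.comp_left (g := fun x : ℂ => ‖x‖ ^ 2) (by simp)
      exact locallyIntegrable_wgt.integrable_smul_left_of_hasCompactSupport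
        (g := fun z => ‖dzb β z‖ ^ 2) (by fun_prop) hc
    · have := wgt_nonneg z
      rw [Real.norm_of_nonneg (by positivity)]
      gcongr
      exact hσS k z
    · by_cases hz : z ∈ tsupport β
      · exact ((Real.continuous_exp.tendsto _).comp
          ((hlim z (subset_union_right hz)).const_mul _)).const_mul _
      · rw [image_eq_zero_of_notMem_tsupport (f := dzb β) fun h => hz (tsupport_dzb_subset h)]
        simp
  exact le_of_tendsto_of_tendsto hl1 (hl2.const_mul C) h1

lemma fderiv_comp_const_sub {u : ℂ → ℂ} (hu : ContDiff ℝ ∞ u) (z ζ v : ℂ) :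
    fderiv ℝ (fun ζ => u (z - ζ)) ζ v = - fderiv ℝ u (z - ζ) v := by
  have h1 := (hu.differentiable (by simp) (z - ζ)).hasFDerivAt.comp ζ
    ((hasFDerivAt_const z ζ).sub (hasFDerivAt_id ζ))
  have h2 : fderiv ℝ (fun ζ => u (z - ζ)) ζ = _ := h1.fderiv
  rw [h2]; simp

lemma differentiableAt_of_dzb_eq_zero {f : ℂ → ℂ} {z : ℂ} (hf : DifferentiableAt ℝ f z)
    (h : dzb f z = 0) : DifferentiableAt ℂ f z := by
  rw [differentiableAt_complex_iff_differentiableAt_real]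
  refine ⟨hf, ?_⟩
  rw [dzb, div_eq_zero_iff, or_iff_left two_ne_zero] at h
  rw [smul_eq_mul]
  linear_combination (-Complex.I) * h + fderiv ℝ f z Complex.I * Complex.I_sq

/-- A smoothing of a weak solution of the Cauchy-Riemann equation is holomorphic. -/
lemma differentiableAt_cv {f g : ℂ → ℂ} {V : Set ℂ} (hf : Integrable f)
    (hw : ∀ β : ℂ → ℂ, ContDiff ℝ ∞ β → HasCompactSupport β → tsupport β ⊆ V →
      ∫ z, f z * dzb β z = 0) (hg : ContDiff ℝ ∞ g) {ε : ℝ}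
    (hgs : ∀ w, ε ≤ ‖w‖ → g w = 0) {z : ℂ} (hz : closedBall z ε ⊆ V) :
    DifferentiableAt ℂ (cv f g) z := by
  have hgc : HasCompactSupport g :=
    HasCompactSupport.intro (isCompact_closedBall 0 ε) fun w hw => hgs w (by
      rw [mem_closedBall, dist_zero_right, not_le] at hw; exact hw.le)
  have hl := hf.locallyIntegrable
  refine differentiableAt_of_dzb_eq_zero ((contDiff_cv hl hg hgc).differentiable (by simp) z) ?_
  rw [dzb_cv hl hg hgc]
  have hβ : ContDiff ℝ ∞ fun ζ => g (z - ζ) := hg.comp (contDiff_const.sub contDiff_id)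
  have hβ0 : ∀ ζ, ζ ∉ closedBall z ε → g (z - ζ) = 0 := fun ζ hζ => hgs _ (by
    rw [mem_closedBall, dist_eq_norm, norm_sub_rev, not_le] at hζ; exact hζ.le)
  have h := hw _ hβ (HasCompactSupport.intro (isCompact_closedBall z ε) hβ0)
    ((closure_minimal (fun ζ hζ => by by_contra h; exact hζ (hβ0 ζ h)) isClosed_closedBall).trans hz)
  have e : ∀ ζ, dzb (fun ζ => g (z - ζ)) ζ = - dzb g (z - ζ) := fun ζ => by
    rw [dzb, fderiv_comp_const_sub hg, fderiv_comp_const_sub hg, dzb]; ring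
  simp only [e, mul_neg, integral_neg, neg_eq_zero] at h
  exact h

lemma cv_cv_comm {f g h : ℂ → ℂ} (hf : Integrable f) (hg : Integrable g) (hh : Continuous h)
    (hhc : HasCompactSupport h) (z : ℂ) : cv (cv f g) h z = cv (cv f h) g z := by
  obtain ⟨B, hB⟩ := hhc.exists_bound_of_continuous hh
  have h1 : Integrable (fun p : ℂ × ℂ => g p.2 * f (p.1 - p.2)) :=
    hg.convolution_integrand (ContinuousLinearMap.mul ℝ ℂ) hf
  have h2 : Integrable (Function.uncurry fun x w : ℂ => g w * f (x - w) * h (z - x)) :=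
    h1.mul_bdd (c := B) (by fun_prop) (ae_of_all _ fun p => hB _)
  have e1 : cv (cv f g) h z = ∫ x, ∫ w, g w * f (x - w) * h (z - x) := by
    unfold cv
    refine integral_congr_ae (ae_of_all _ fun x => ?_)
    have := cv_swap f g x
    unfold cv at this
    simp only [this, ← integral_mul_const]
    congr 1; ext w; ring
  rw [e1, integral_integral_swap h2, cv_swap]
  refine integral_congr_ae (ae_of_all _ fun w => ?_)
  simp only [cv]
  rw [← integral_mul_const, ← integral_add_right_eq_self _ w]
  congr 1; ext x
  rw [add_sub_cancel_right, show z - (x + w) = z - w - x by ring]; ring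

lemma cv_mol_eq_of_differentiable {F : ℂ → ℂ} (hF : Continuous F) {ε : ℝ} (hε : 0 < ε) {z : ℂ}
    (hd : ∀ w ∈ closedBall z ε, DifferentiableAt ℂ F w) :
    cv F (fun w => (mol ε w : ℂ)) z = F z := by
  rw [cv_swap]
  obtain ⟨B, hB⟩ := (isCompact_closedBall z ε).exists_bound_of_continuousOn hF.continuousOn
  have := mol_mean_eq hε hF.stronglyMeasurable z hB fun t ht => by
    have h : DiffContOnCl ℂ F (ball z |t|) := by
      refine DifferentiableOn.diffContOnCl fun w hw => (hd w ?_).differentiableWithinAt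
      rw [abs_of_pos ht.1] at hw
      exact closedBall_subset_closedBall ht.2 (closure_ball_subset_closedBall hw)
    have h2 := h.circleAverage
    rw [Real.circleAverage_def] at h2
    rw [← h2, smul_smul, mul_inv_cancel₀ (by positivity), one_smul]
  rw [← this]
  congr 1; ext w
  rw [Complex.real_smul, mul_comm]

/-- Weyl's lemma for the Cauchy-Riemann operator on a disc. -/
lemma weyl_local {f : ℂ → ℂ} (hf : Integrable f) {z₀ : ℂ} {r : ℝ} (hr : 0 < r)
    (hw : ∀ β : ℂ → ℂ, ContDiff ℝ ∞ β → HasCompactSupport β → tsupport β ⊆ ball z₀ (4 * r) →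
      ∫ z, f z * dzb β z = 0) :
    ∃ F : ℂ → ℂ, DifferentiableOn ℂ F (ball z₀ r) ∧ ∀ᵐ z, z ∈ ball z₀ r → F z = f z := by
  set μr : ℂ → ℂ := fun w => (mol r w : ℂ)
  have hμ : ContDiff ℝ ∞ μr := (contDiff_mol r).ofReal'
  have hμc : HasCompactSupport μr :=
    (hasCompactSupport_mol hr).comp_left (g := fun x : ℝ => (x:ℂ)) (by simp)
  have hball : ∀ {a : ℝ} {z : ℂ}, z ∈ ball z₀ a → closedBall z r ⊆ ball z₀ (a + r) := by
    intro a z hz ζ hζ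
    rw [mem_ball] at hz ⊢
    rw [mem_closedBall] at hζ
    linarith [dist_triangle ζ z z₀]
  set F := cv f μr with hF
  have hFs : ContDiff ℝ ∞ F := contDiff_cv hf.locallyIntegrable hμ hμc
  refine ⟨F, fun z hz => (differentiableAt_cv hf hw hμ (ε := r) (fun w hw => ?_)
    ((hball hz).trans (ball_subset_ball (by linarith)))).differentiableWithinAt, ?_⟩
  · simp [μr, mol_eq_zero hr hw]
  let φ : ℕ → ContDiffBump (0:ℂ) := fun k =>
    ⟨r / (2 * (k + 1)), r / (k + 1), by positivity, by
      gcongr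
      have : (0:ℝ) ≤ k := by positivity
      linarith⟩
  have hφ : Tendsto (fun k => (φ k).rOut) atTop (𝓝 0) := by
    have := (tendsto_one_div_add_atTop_nhds_zero_nat (𝕜 := ℝ)).const_mul r
    simpa [φ, div_eq_mul_inv] using this
  have hφr : ∀ k, (φ k).rOut ≤ r := fun k => by
    have : (0:ℝ) ≤ k := by positivity
    exact div_le_self hr.le (by linarith)
  set ψ : ℕ → ℂ → ℂ := fun k w => ((φ k).normed volume w : ℂ)
  have hψ : ∀ k, ContDiff ℝ ∞ (ψ k) := fun k => ((φ k).contDiff_normed (n := ⊤)).ofReal'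
  have hψc : ∀ k, HasCompactSupport (ψ k) := fun k =>
    ((φ k).hasCompactSupport_normed).comp_left (g := fun x : ℝ => (x:ℂ)) (by simp)
  have hψ0 : ∀ k w, r ≤ ‖w‖ → ψ k w = 0 := fun k w hw => by
    have : (φ k).normed volume w = 0 := by
      rw [← Function.notMem_support, (φ k).support_normed_eq, mem_ball, dist_zero_right, not_lt]
      exact (hφr k).trans hw
    simp [ψ, this]
  have hconv : ∀ (g : ℂ → ℂ) k z, convolution ((φ k).normed volume) g (ContinuousLinearMap.lsmul ℝ ℝ) volume z
      = cv g (ψ k) z := by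
    intro g k z
    rw [cv_swap, convolution_def]
    congr 1; ext w
    simp [ψ, mul_comm]
  have hae := ContDiffBump.ae_convolution_tendsto_right_of_locallyIntegrable (μ := volume) (K := 2)
    hφ (Eventually.of_forall fun k => by
      simp only [φ]
      apply le_of_eq; field_simp) hf.locallyIntegrable
  filter_upwards [hae] with z hz hzb
  refine tendsto_nhds_unique (f := fun k => cv F (ψ k) z) (l := atTop) ?_ ?_
  · have := ContDiffBump.convolution_tendsto_right_of_continuous (μ := volume) hφ hFs.continuous z
    simp only [hconv] at this
    exact this
  · simp only [hconv] at hz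
    refine hz.congr fun k => ?_
    rw [hF, cv_cv_comm hf (hμ.continuous.integrable_of_hasCompactSupport hμc) (hψ k).continuous (hψc k)]
    refine (cv_mol_eq_of_differentiable (contDiff_cv hf.locallyIntegrable (hψ k) (hψc k)).continuous hr
      fun w hwb => ?_).symm
    refine differentiableAt_cv hf hw (hψ k) (hψ0 k) ((hball (hball hzb hwb)).trans
      (ball_subset_ball (by linarith)))

/-- Weyl's lemma for the Cauchy-Riemann operator. -/
lemma weyl {f : ℂ → ℂ} {D : Set ℂ} (hD : IsOpen D)
    (hf : ∀ K, IsCompact K → K ⊆ D → IntegrableOn f K)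
    (hw : ∀ β : ℂ → ℂ, ContDiff ℝ ∞ β → HasCompactSupport β → tsupport β ⊆ D →
      ∫ z, f z * dzb β z = 0) :
    ∃ F : ℂ → ℂ, DifferentiableOn ℂ F D ∧ ∀ᵐ z, z ∈ D → F z = f z := by
  have hloc : ∀ z ∈ D, ∃ r > 0, ∃ F : ℂ → ℂ, ball z r ⊆ D ∧ DifferentiableOn ℂ F (ball z r) ∧
      ∀ᵐ w, w ∈ ball z r → F w = f w := by
    intro z hz
    obtain ⟨s, hs, hsD⟩ := Metric.isOpen_iff.1 hD z hz
    have hcD : closedBall z (4 * (s / 5)) ⊆ D := (closedBall_subset_ball (by linarith)).trans hsD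
    have hi : Integrable ((closedBall z (4 * (s / 5))).indicator f) :=
      (hf _ (isCompact_closedBall _ _) hcD).integrable_indicator measurableSet_closedBall
    obtain ⟨F, hF, hFf⟩ := weyl_local hi (z₀ := z) (r := s / 5) (by positivity) fun β hβ hβc hβs => by
      rw [← hw β hβ hβc (hβs.trans (ball_subset_closedBall.trans hcD))]
      congr 1; ext ζ
      by_cases hζ : ζ ∈ tsupport β
      · rw [indicator_of_mem (ball_subset_closedBall (hβs hζ))]
      · rw [image_eq_zero_of_notMem_tsupport (f := dzb β) fun h => hζ (tsupport_dzb_subset h)]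
        simp
    refine ⟨s / 5, by positivity, F, (ball_subset_ball (by linarith)).trans hsD, hF, ?_⟩
    filter_upwards [hFf] with w hw hwb
    rw [hw hwb, indicator_of_mem (closedBall_subset_closedBall (by linarith) (ball_subset_closedBall hwb))]
  choose! r hr G hGD hG hGf using hloc
  have hglue : ∀ z ∈ D, ∀ w ∈ ball z (r z), G w w = G z w := by
    intro z hz w hw
    have hwD := hGD z hz hw
    refine MeasureTheory.Measure.eqOn_open_of_ae_eq (μ := volume)
      (U := ball z (r z) ∩ ball w (r w)) ?_ (isOpen_ball.inter isOpen_ball)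
      ((hG w hwD).continuousOn.mono inter_subset_right)
      ((hG z hz).continuousOn.mono inter_subset_left) ⟨hw, mem_ball_self (hr w hwD)⟩
    rw [Filter.EventuallyEq, ae_restrict_iff' (isOpen_ball.inter isOpen_ball).measurableSet]
    filter_upwards [hGf z hz, hGf w hwD] with x h1 h2 hx
    rw [h1 hx.1, h2 hx.2]
  refine ⟨fun z => G z z, fun z hz => ?_, ?_⟩
  · have h1 : DifferentiableAt ℂ (G z) z :=
      (hG z hz).differentiableAt (isOpen_ball.mem_nhds (mem_ball_self (hr z hz)))
    refine (h1.congr_of_eventuallyEq ?_).differentiableWithinAt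
    filter_upwards [isOpen_ball.mem_nhds (mem_ball_self (hr z hz))] with w hw using hglue z hz w hw
  · rw [ae_iff]
    refine measure_null_of_locally_null _ fun z hz => ?_
    simp only [mem_ofPred_eq, Classical.not_imp] at hz
    refine ⟨_, inter_mem self_mem_nhdsWithin (mem_nhdsWithin_of_mem_nhds
      (isOpen_ball.mem_nhds (mem_ball_self (hr z hz.1)))), ?_⟩
    refine measure_mono_null (t := {w | ¬ (w ∈ ball z (r z) → G z w = f w)}) ?_ (hGf z hz.1)
    rintro w ⟨hw1, hw2⟩ h
    exact hw1 fun hwD => (hglue z hz.1 w hw2).trans (h hw2)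

/-- Riesz representation for a functional dominated by a linear map into a Hilbert space. -/
lemma exists_inner_eq_of_bound {V H : Type*} [AddCommGroup V] [Module ℂ V] [NormedAddCommGroup H]
    [InnerProductSpace ℂ H] [CompleteSpace H] (T : V →ₗ[ℂ] H) (l : V →ₗ[ℂ] ℂ) {C : ℝ} (hC : 0 ≤ C)
    (h : ∀ v, ‖l v‖ ≤ C * ‖T v‖) : ∃ g : H, ‖g‖ ≤ C ∧ ∀ v, inner ℂ g (T v) = l v := by
  have hker : LinearMap.ker T ≤ LinearMap.ker l := fun v hv => by
    rw [LinearMap.mem_ker] at hv ⊢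
    have := h v
    rw [hv, norm_zero, mul_zero] at this
    exact norm_le_zero_iff.1 this
  let φ : LinearMap.range T →ₗ[ℂ] ℂ :=
    ((LinearMap.ker T).liftQ l hker).comp (T.quotKerEquivRange.symm : LinearMap.range T →ₗ[ℂ] _)
  have hφ : ∀ v (hv : T v ∈ LinearMap.range T), φ ⟨T v, hv⟩ = l v := fun v hv => by
    have : T.quotKerEquivRange.symm ⟨T v, hv⟩ = (LinearMap.ker T).mkQ v := by
      rw [LinearEquiv.symm_apply_eq]; rfl
    simp only [φ, LinearMap.comp_apply, LinearEquiv.coe_coe, this]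
    rfl
  have hb : ∀ x, ‖φ x‖ ≤ C * ‖x‖ := by
    rintro ⟨y, hy⟩
    obtain ⟨v, rfl⟩ := LinearMap.mem_range.1 hy
    rw [hφ]; exact h v
  obtain ⟨ψ, hψ, hn⟩ := exists_extension_norm_eq (LinearMap.range T) (φ.mkContinuous C hb)
  refine ⟨(InnerProductSpace.toDual ℂ H).symm ψ, ?_, fun v => ?_⟩
  · rw [LinearIsometryEquiv.norm_map, hn]
    exact LinearMap.mkContinuous_norm_le _ hC _
  · rw [InnerProductSpace.toDual_symm_apply]
    have := hψ ⟨T v, LinearMap.mem_range_self T v⟩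
    rw [LinearMap.mkContinuous_apply, hφ] at this
    exact this

/-- Smooth functions with compact support contained in `D`. -/
def testSpace (D : Set ℂ) : Submodule ℂ (ℂ → ℂ) where
  carrier := {β | ContDiff ℝ ∞ β ∧ HasCompactSupport β ∧ tsupport β ⊆ D}
  add_mem' := fun ha hb => ⟨ha.1.add hb.1, ha.2.1.add hb.2.1,
    (tsupport_add _ _).trans (union_subset ha.2.2 hb.2.2)⟩
  zero_mem' := ⟨contDiff_const, HasCompactSupport.zero, by simp [tsupport]⟩
  smul_mem' := fun c β hβ => ⟨hβ.1.const_smul c, hβ.2.1.smul_left (f := fun _ => c),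
    (closure_mono (Function.support_const_smul_subset c β)).trans hβ.2.2⟩

lemma norm_sq_toLp {f : ℂ → ℂ} (hf : MemLp f 2 volume) : ‖hf.toLp f‖ ^ 2 = ∫ z, ‖f z‖ ^ 2 := by
  have h := inner_self_eq_norm_sq_to_K (𝕜 := ℂ) (hf.toLp f)
  rw [L2.inner_def] at h
  have e : ∫ z, inner ℂ (hf.toLp f z) (hf.toLp f z) = ((∫ z, ‖f z‖ ^ 2 : ℝ) : ℂ) := by
    rw [← integral_complex_ofReal]
    refine integral_congr_ae ?_
    filter_upwards [hf.coeFn_toLp] with z hz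
    rw [hz, inner_self_eq_norm_sq_to_K]; simp
  rw [e] at h
  apply Complex.ofReal_injective
  rw [h]; simp

/-- Solution of a minimal norm problem with the weight `s`. -/
lemma exists_dual_solution {D : Set ℂ} {s : ℂ → ℝ} {C : ℝ} (hC : 0 ≤ C)
    (hs : ∀ β ∈ testSpace D, MemLp (fun z => dzb β z * s z) 2 volume)
    (h : ∀ β ∈ testSpace D, ‖β 0‖ ^ 2 ≤ C * ∫ z, ‖dzb β z * s z‖ ^ 2) :
    ∃ g : ℂ → ℂ, MemLp g 2 volume ∧ ∫ z, ‖g z‖ ^ 2 ≤ C ∧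
      ∀ β ∈ testSpace D, ∫ z, g z * s z * dzb β z = β 0 := by
  let T : testSpace D →ₗ[ℂ] Lp ℂ 2 (volume : Measure ℂ) :=
    { toFun := fun β => (hs β β.2).toLp _
      map_add' := fun β γ => by
        rw [← MemLp.toLp_add]
        refine MemLp.toLp_congr _ _ (ae_of_all _ fun z => ?_)
        have := ((β.2.1.hasW z).add (γ.2.1.hasW z)).dzb
        change dzb (fun z => (β : ℂ → ℂ) z + (γ : ℂ → ℂ) z) z * s z = dzb β z * s z + dzb γ z * s z
        rw [this]; ring
      map_smul' := fun c β => by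
        rw [RingHom.id_apply, ← MemLp.toLp_const_smul]
        refine MemLp.toLp_congr _ _ (ae_of_all _ fun z => ?_)
        have := ((hasW_const c z).mul (β.2.1.hasW z)).dzb
        change dzb (fun z => c * (β : ℂ → ℂ) z) z * s z = c * (dzb β z * s z)
        rw [this]; ring }
  let l : testSpace D →ₗ[ℂ] ℂ :=
    { toFun := fun β => (β : ℂ → ℂ) 0
      map_add' := fun β γ => rfl
      map_smul' := fun c β => rfl }
  obtain ⟨g, hg, hgl⟩ := exists_inner_eq_of_bound T l (Real.sqrt_nonneg C) fun β => by
    refine (sq_le_sq₀ (norm_nonneg _) (by positivity)).1 ?_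
    rw [mul_pow, Real.sq_sqrt hC]
    have : ‖T β‖ ^ 2 = _ := norm_sq_toLp (hs β β.2)
    rw [this]; exact h β β.2
  have hgm := Lp.memLp g
  refine ⟨fun z => conj (g z), hgm.star, ?_, fun β hβ => ?_⟩
  · have h1 := norm_sq_toLp hgm
    rw [Lp.toLp_coeFn] at h1
    simp only [RCLike.norm_conj]
    rw [← h1, ← Real.sq_sqrt hC]
    gcongr
  · have h1 : inner ℂ g (T ⟨β, hβ⟩) = β 0 := hgl ⟨β, hβ⟩
    rw [← h1, L2.inner_def]
    refine integral_congr_ae ?_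
    filter_upwards [(hs β hβ).coeFn_toLp] with z hz
    have : T ⟨β, hβ⟩ z = dzb β z * s z := hz
    rw [this, RCLike.inner_apply]; ring

lemma norm_mul_sqrt_wgt_le (z : ℂ) : ‖z‖ * √(wgt z) ≤ 1 := by
  rw [← sq_le_sq₀ (by positivity) zero_le_one, mul_pow, Real.sq_sqrt (wgt_nonneg z), one_pow]
  exact norm_sq_mul_wgt_le z

/-- Holomorphic functions with prescribed value at the origin and weighted `L²` bounds. -/
lemma exists_holomorphic_of_nonconstant {D : Set ℂ} {u : ℂ → ℝ} (hD : IsOpen D) (h0D : (0:ℂ) ∈ D)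
    (hum : Measurable u) (hu : UpperSemicontinuousOn u D) (h0 : ∀ z ∈ D, 0 ≤ u z)
    (hs : CircleSub u D) (hnc : ∀ δ > 0, ¬ ∃ c, ∀ z ∈ ball (0:ℂ) δ, u z = c) :
    ∃ C : ℝ, 0 ≤ C ∧ ∃ m : ℕ, ∀ j : ℕ, ∃ F : ℂ → ℂ, DifferentiableOn ℂ F D ∧ ‖F 0‖ = cpi⁻¹ ∧
      IntegrableOn (fun z => ‖F z‖ ^ 2 * Real.exp (-(2 * (j + m : ℕ) * u z))) D ∧
      ∫ z in D, ‖F z‖ ^ 2 * Real.exp (-(2 * (j + m : ℕ) * u z)) ≤ C * Real.exp (-(2 * j * u 0)) := by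
  obtain ⟨C, hC, m, hest⟩ := exists_apriori_estimate hD h0D hu h0 hs hnc
  refine ⟨C, hC, m, fun j => ?_⟩
  set n : ℕ := j + m with hn
  set s : ℂ → ℝ := fun z => √(wgt z) * Real.exp (n * u z) with hsdef
  have hsm : Measurable s := by
    have := measurable_wgt
    fun_prop
  have hs2 : ∀ z, s z ^ 2 = wgt z * Real.exp (2 * n * u z) := fun z => by
    rw [hsdef, mul_pow, Real.sq_sqrt (wgt_nonneg z), ← Real.exp_nat_mul]
    push_cast; ring_nf
  have hnorm : ∀ (β : ℂ → ℂ) z, ‖dzb β z * s z‖ ^ 2 =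
      ‖dzb β z‖ ^ 2 * wgt z * Real.exp (2 * n * u z) := fun β z => by
    rw [norm_mul, mul_pow, Complex.norm_real, Real.norm_eq_abs, sq_abs, hs2]; ring
  have hbd : ∀ K, IsCompact K → K ⊆ D → ∃ S : ℝ, ∀ z ∈ K, u z ≤ S := by
    intro K hK hKD
    rcases K.eq_empty_or_nonempty with rfl | hne
    · exact ⟨0, by simp⟩
    · obtain ⟨x, -, hx⟩ := (hu.mono hKD).exists_isMaxOn hne hK
      exact ⟨u x, fun z hz => hx hz⟩
  obtain ⟨g, hg, hgC, hgβ⟩ := exists_dual_solution (D := D) (s := s)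
    (C := C * Real.exp (-(2 * j * u 0))) (by positivity) (fun β hβ => by
      have hdc := hβ.1.dzb.continuous
      have hm : AEStronglyMeasurable (fun z => dzb β z * (s z : ℂ)) volume :=
        hdc.aestronglyMeasurable.mul (Complex.measurable_ofReal.comp hsm).aestronglyMeasurable
      obtain ⟨S, hS⟩ := hbd _ hβ.2.1 hβ.2.2
      rw [memLp_two_iff_integrable_sq_norm hm]
      have hc : HasCompactSupport fun z => ‖dzb β z‖ ^ 2 :=
        hβ.2.1.dzb.comp_left (g := fun x : ℂ => ‖x‖ ^ 2) (by simp)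
      have hi : Integrable fun z => ‖dzb β z‖ ^ 2 * wgt z * Real.exp (2 * n * S) :=
        Integrable.mul_const (locallyIntegrable_wgt.integrable_smul_left_of_hasCompactSupport
          (g := fun z => ‖dzb β z‖ ^ 2) (by fun_prop) hc) _
      refine hi.mono' (hm.norm.pow 2) (ae_of_all _ fun z => ?_)
      rw [Real.norm_of_nonneg (by positivity), hnorm]
      have := wgt_nonneg z
      by_cases hz : z ∈ tsupport β
      · gcongr
        exact hS z hz
      · rw [image_eq_zero_of_notMem_tsupport (f := dzb β) fun h => hz (tsupport_dzb_subset h)]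
        simp) (fun β hβ => by
      have := hest β hβ.1 hβ.2.1 hβ.2.2 j
      simp only [hnorm]
      rw [Real.exp_neg, mul_right_comm, ← div_eq_mul_inv, le_div_iff₀ (Real.exp_pos _)]
      exact this)
  set f : ℂ → ℂ := fun z => z * (g z * s z) with hf
  have hfle : ∀ z, ‖f z‖ ≤ ‖g z‖ * Real.exp (n * u z) := fun z => by
    have h1 : 0 ≤ s z := by positivity
    rw [hf, norm_mul, norm_mul, Complex.norm_real, Real.norm_of_nonneg h1]
    calc ‖z‖ * (‖g z‖ * s z) = (‖z‖ * √(wgt z)) * (‖g z‖ * Real.exp (n * u z)) := by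
          rw [hsdef]; ring
      _ ≤ 1 * (‖g z‖ * Real.exp (n * u z)) := by
          gcongr; exact norm_mul_sqrt_wgt_le z
      _ = _ := one_mul _
  have hgs : ∀ z, ‖f z‖ ^ 2 * Real.exp (-(2 * n * u z)) ≤ ‖g z‖ ^ 2 := fun z => by
    calc ‖f z‖ ^ 2 * Real.exp (-(2 * n * u z))
        ≤ (‖g z‖ * Real.exp (n * u z)) ^ 2 * Real.exp (-(2 * n * u z)) := by
          gcongr; exact hfle z
      _ = ‖g z‖ ^ 2 * (Real.exp (2 * n * u z) * Real.exp (-(2 * n * u z))) := by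
          rw [mul_pow, ← Real.exp_nat_mul]; push_cast; ring_nf
      _ = ‖g z‖ ^ 2 := by rw [← Real.exp_add]; simp
  have hfm : AEStronglyMeasurable f volume :=
    measurable_id.aestronglyMeasurable.mul
      (hg.1.mul (Complex.measurable_ofReal.comp hsm).aestronglyMeasurable)
  have hg2 : Integrable fun z => ‖g z‖ ^ 2 := (memLp_two_iff_integrable_sq_norm hg.1).1 hg
  obtain ⟨F, hF, hFf⟩ := weyl hD (f := f) (fun K hK hKD => by
      obtain ⟨S, hS⟩ := hbd K hK hKD
      have h1 : IntegrableOn g K := (hg.locallyIntegrable (by norm_num)).integrableOn_isCompact hK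
      refine (h1.norm.mul_const (Real.exp (n * S))).mono' hfm.restrict ?_
      refine (ae_restrict_mem hK.measurableSet).mono fun z hz => (hfle z).trans ?_
      gcongr
      exact hS z hz) (fun β hβ hβc hβD => by
      have hid : ContDiff ℝ ∞ fun z : ℂ => z * β z := contDiff_id.mul hβ
      have := hgβ (fun z => z * β z) ⟨hid, hβc.mul_left,
        (tsupport_mul_subset_right (f := fun z : ℂ => z)).trans hβD⟩
      rw [zero_mul] at this
      rw [← this]
      congr 1; ext z
      rw [((hasW_id z).mul (hβ.hasW z)).dzb, hf]; ring)
  refine ⟨F, hF, ?_, ?_⟩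
  · obtain ⟨r, hr, hrD⟩ := Metric.isOpen_iff.1 hD 0 h0D
    let χ : ContDiffBump (0:ℂ) := ⟨r / 4, r / 2, by positivity, by linarith⟩
    have hχ : ContDiff ℝ ∞ fun z => (χ z : ℂ) := (χ.contDiff (n := ⊤)).ofReal'
    have hχc : HasCompactSupport fun z => (χ z : ℂ) :=
      χ.hasCompactSupport.comp_left (g := fun x : ℝ => (x:ℂ)) (by simp)
    have hχD : tsupport (fun z => (χ z : ℂ)) ⊆ D := by
      refine Subset.trans ?_ hrD
      refine (tsupport_comp_subset (g := fun x : ℝ => (x:ℂ)) (by simp) χ).trans ?_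
      rw [χ.tsupport_eq]
      exact closedBall_subset_ball (by simp [χ]; linarith)
    have hχ0 : χ (0:ℂ) = 1 := χ.one_of_mem_closedBall (mem_closedBall_self (by positivity))
    have h1 := hgβ _ ⟨hχ, hχc, hχD⟩
    have hFc : ContDiffOn ℝ ∞ F D := ((hF.contDiffOn hD).restrict_scalars ℝ : ContDiffOn ℝ ∞ F D)
    have hP : ContDiff ℝ ∞ fun z => F z * χ z := by
      rw [contDiff_iff_contDiffAt]
      intro z
      by_cases hz : z ∈ tsupport fun z => (χ z : ℂ)
      · exact (hFc.contDiffAt (hD.mem_nhds (hχD hz))).mul hχ.contDiffAt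
      · refine (contDiffAt_const (c := (0:ℂ))).congr_of_eventuallyEq ?_
        filter_upwards [(isClosed_tsupport _).isOpen_compl.mem_nhds hz] with w hw
        rw [image_eq_zero_of_notMem_tsupport (f := fun z => (χ z : ℂ)) hw, mul_zero]
    have h2 := integral_inv_mul_dzb hP hχc.mul_left
    have h3 : ∫ z, g z * s z * dzb (fun z => (χ z : ℂ)) z = ∫ z, z⁻¹ * dzb (fun z => F z * χ z) z := by
      refine integral_congr_ae ?_
      filter_upwards [hFf, ae_ne_zero] with z hz hz0
      by_cases hzs : z ∈ tsupport fun z => (χ z : ℂ)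
      · have hzD := hχD hzs
        rw [((hF.differentiableAt (hD.mem_nhds hzD)).hasDerivAt.hasW.mul (hχ.hasW z)).dzb, hz hzD, hf]
        field_simp
        ring
      · have e1 : dzb (fun z => (χ z : ℂ)) z = 0 :=
          image_eq_zero_of_notMem_tsupport fun h => hzs (tsupport_dzb_subset h)
        have e2 : dzb (fun z => F z * χ z) z = 0 :=
          image_eq_zero_of_notMem_tsupport fun h => hzs
            (tsupport_mul_subset_right (f := F) (tsupport_dzb_subset h))
        rw [e1, e2, mul_zero, mul_zero]
    rw [h3, h2] at h1
    simp only [hχ0, Complex.ofReal_one, mul_one] at h1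
    have h4 := congrArg norm h1
    rw [norm_neg, norm_mul, Complex.norm_real, Real.norm_of_nonneg cpi_pos.le, norm_one] at h4
    exact eq_inv_of_mul_eq_one_right h4
  · have hle : ∀ᵐ z ∂(volume.restrict D),
        ‖‖F z‖ ^ 2 * Real.exp (-(2 * n * u z))‖ ≤ ‖g z‖ ^ 2 := by
      rw [ae_restrict_iff' hD.measurableSet]
      filter_upwards [hFf] with z hz hzD
      rw [Real.norm_of_nonneg (by positivity), hz hzD]
      exact hgs z
    have hint : IntegrableOn (fun z => ‖F z‖ ^ 2 * Real.exp (-(2 * n * u z))) D := by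
      refine hg2.integrableOn.mono' ?_ hle
      refine ((hF.continuousOn.aestronglyMeasurable hD.measurableSet).norm.pow 2).mul ?_
      exact Measurable.aestronglyMeasurable (by fun_prop)
    refine ⟨hint, ?_⟩
    calc _ ≤ ∫ z in D, ‖g z‖ ^ 2 :=
          integral_mono_ae hint hg2.integrableOn (hle.mono fun z hz => (le_abs_self _).trans hz)
      _ ≤ ∫ z, ‖g z‖ ^ 2 := setIntegral_le_integral hg2 (ae_of_all _ fun z => by positivity)
      _ ≤ _ := hgC

/-- Square-mean bound for holomorphic functions. -/
lemma exists_norm_sq_le_integral {δ : ℝ} (hδ : 0 < δ) :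
    ∃ A : ℝ, 0 ≤ A ∧ ∀ (D : Set ℂ) (g : ℂ → ℂ) (z : ℂ), DifferentiableOn ℂ g D → IsOpen D →
      closedBall z δ ⊆ D → ‖g z‖ ^ 2 ≤ A * ∫ w in closedBall z δ, ‖g w‖ ^ 2 := by
  obtain ⟨A, hA⟩ := (hasCompactSupport_mol hδ).exists_bound_of_continuous (contDiff_mol δ).continuous
  refine ⟨A, (norm_nonneg _).trans (hA 0), fun D g z hg hD hz => ?_⟩
  set h : ℂ → ℂ := (closedBall z δ).indicator fun w => g w ^ 2 with hh
  have hgc : ContinuousOn (fun w => g w ^ 2) (closedBall z δ) := (hg.continuousOn.mono hz).pow 2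
  have hmeas : Measurable h := by
    classical
    have : h = (closedBall z δ).piecewise (fun w => g w ^ 2) (fun _ => 0) := by
      rw [hh, ← Set.piecewise_eq_indicator]; rfl
    rw [this]
    exact hgc.measurable_piecewise continuousOn_const measurableSet_closedBall
  obtain ⟨B, hB⟩ := (isCompact_closedBall z δ).exists_bound_of_continuousOn hgc
  have hzz : z ∈ closedBall z δ := mem_closedBall_self hδ.le
  have hmean := mol_mean_eq hδ hmeas.stronglyMeasurable z (B := B)
    (fun w hw => by rw [hh, indicator_of_mem hw]; exact hB w hw) fun t ht => by
      have h1 : DiffContOnCl ℂ (fun w => g w ^ 2) (ball z |t|) := by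
        refine DifferentiableOn.diffContOnCl fun w hw =>
          (((hg.differentiableAt (hD.mem_nhds (hz ?_))).pow 2)).differentiableWithinAt
        rw [abs_of_pos ht.1] at hw
        exact closedBall_subset_closedBall ht.2 (closure_ball_subset_closedBall hw)
      have h2 := h1.circleAverage
      rw [Real.circleAverage_def] at h2
      rw [hh, indicator_of_mem hzz, ← h2, smul_smul, mul_inv_cancel₀ (by positivity), one_smul]
      refine intervalIntegral.integral_congr fun x _ => ?_
      rw [indicator_of_mem]
      exact closedBall_subset_closedBall ht.2 (circleMap_mem_closedBall z ht.1.le x)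
  rw [← integral_sub_left_eq_self _ volume z] at hmean
  simp only [sub_sub_cancel] at hmean
  have hint : Integrable fun w => A * ‖h w‖ := by
    refine Integrable.const_mul (Integrable.norm ?_) _
    exact (hgc.integrableOn_compact (isCompact_closedBall z δ)).integrable_indicator
      measurableSet_closedBall
  calc ‖g z‖ ^ 2 = ‖h z‖ := by rw [hh, indicator_of_mem hzz, norm_pow]
    _ ≤ ∫ w, A * ‖h w‖ := by
        rw [← hmean]
        refine norm_integral_le_of_norm_le hint (ae_of_all _ fun w => ?_)
        rw [norm_smul]
        gcongr
        exact hA _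
    _ = _ := by
        rw [integral_const_mul, ← integral_indicator measurableSet_closedBall]
        congr 2; ext w
        by_cases hw : w ∈ closedBall z δ
        · rw [hh, indicator_of_mem hw, indicator_of_mem hw, norm_pow]
        · rw [hh, indicator_of_notMem hw, indicator_of_notMem hw, norm_zero]

/-- Local geometric bounds for coefficients with weighted `L²` bounds. -/
lemma exists_local_bound {D : Set ℂ} {r : ℂ → ℝ} {a : ℕ → ℂ → ℂ} {B : ℝ} (hD : IsOpen D)
    (hr : UpperSemicontinuousOn r D) (ha : ∀ i, DifferentiableOn ℂ (a i) D)
    (hai : ∀ i, IntegrableOn (fun z => ‖a i z‖ ^ 2 * Real.exp (-(2 * (i + 1 : ℕ) * r z))) D)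
    (hB : ∀ i, ∫ z in D, ‖a i z‖ ^ 2 * Real.exp (-(2 * (i + 1 : ℕ) * r z)) ≤ B)
    {z₀ : ℂ} (hz₀ : z₀ ∈ D) {s : ℝ} (hs : r z₀ < s) :
    ∃ δ > 0, ball z₀ δ ⊆ D ∧ (∀ z ∈ ball z₀ δ, r z < s) ∧
      ∃ K : ℝ, 0 ≤ K ∧ ∀ i, ∀ z ∈ ball z₀ δ, ‖a i z‖ ≤ K * Real.exp ((i + 1 : ℕ) * s) := by
  have h1 : ∀ᶠ z in 𝓝 z₀, r z < s := by
    have := hr z₀ hz₀ s hs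
    rwa [hD.nhdsWithin_eq hz₀] at this
  obtain ⟨η, hη, hηs⟩ := Metric.eventually_nhds_iff_ball.1 (h1.and (hD.mem_nhds hz₀))
  obtain ⟨A, hA, hAb⟩ := exists_norm_sq_le_integral (δ := η / 2) (by positivity)
  have hB0 : 0 ≤ B := (integral_nonneg fun z => by positivity).trans (hB 0)
  refine ⟨η / 2, by positivity, fun z hz => (hηs z (ball_subset_ball (by linarith) hz)).2,
    fun z hz => (hηs z (ball_subset_ball (by linarith) hz)).1, √(A * B), Real.sqrt_nonneg _, ?_⟩
  intro i z hz
  have hsub : closedBall z (η / 2) ⊆ ball z₀ η := by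
    intro w hw
    rw [mem_ball] at hz ⊢
    rw [mem_closedBall] at hw
    linarith [dist_triangle w z z₀]
  have hsubD : closedBall z (η / 2) ⊆ D := fun w hw => (hηs w (hsub hw)).2
  refine (sq_le_sq₀ (norm_nonneg _) (by positivity)).1 ?_
  rw [mul_pow, Real.sq_sqrt (by positivity), ← Real.exp_nat_mul]
  refine (hAb D (a i) z (ha i) hD hsubD).trans ?_
  rw [mul_assoc]
  refine mul_le_mul_of_nonneg_left ?_ hA
  have hc : ContinuousOn (fun w => ‖a i w‖ ^ 2) (closedBall z (η / 2)) :=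
    (((ha i).continuousOn.mono hsubD).norm).pow 2
  calc ∫ w in closedBall z (η / 2), ‖a i w‖ ^ 2
      ≤ ∫ w in closedBall z (η / 2), Real.exp ((2:ℕ) * ((i + 1 : ℕ) * s)) *
          (‖a i w‖ ^ 2 * Real.exp (-(2 * (i + 1 : ℕ) * r w))) := by
        refine setIntegral_mono_on (hc.integrableOn_compact (isCompact_closedBall _ _))
          (((hai i).mono_set hsubD).const_mul _) measurableSet_closedBall fun w hw => ?_
        have h2 := (hηs w (hsub hw)).1
        have : 1 ≤ Real.exp ((2:ℕ) * ((i + 1 : ℕ) * s)) * Real.exp (-(2 * (i + 1 : ℕ) * r w)) := by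
          rw [← Real.exp_add, Real.one_le_exp_iff]
          have : 0 ≤ ((i + 1 : ℕ) : ℝ) * (s - r w) := mul_nonneg (by positivity) (by linarith)
          push_cast at this ⊢
          linarith
        nlinarith [mul_le_mul_of_nonneg_left this (sq_nonneg ‖a i w‖)]
    _ ≤ Real.exp ((2:ℕ) * ((i + 1 : ℕ) * s)) * B := by
        rw [integral_const_mul]
        gcongr
        exact (setIntegral_mono_set (hai i) (ae_of_all _ fun w => by positivity)
          hsubD.eventuallyLE).trans (hB i)
    _ = _ := mul_comm _ _

lemma summable_norm_coeff_mul_pow {b : ℕ → ℂ} {K E q : ℝ} (hE : 0 ≤ E)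
    (hb : ∀ i, ‖b i‖ ≤ K * E ^ (i + 1)) (hq : 0 < q) (hEq : E * q < 1) {w : ℂ} (hw : ‖w‖ < q) :
    Summable fun i => b i * w ^ i := by
  have hK : 0 ≤ K * E := (norm_nonneg _).trans ((hb 0).trans_eq (by ring))
  refine Summable.of_norm_bounded
    ((summable_geometric_of_lt_one (mul_nonneg hE hq.le) hEq).mul_left (K * E)) fun i => ?_
  rw [norm_mul, norm_pow]
  calc ‖b i‖ * ‖w‖ ^ i ≤ (K * E ^ (i + 1)) * q ^ i := by
        gcongr
        · exact (norm_nonneg _).trans (hb i)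
        · exact hb i
    _ = _ := by rw [mul_pow]; ring

lemma hasFDerivAt_coeff_mul_pow {a : ℂ → ℂ} {p : ℂ × ℂ} (ha : DifferentiableAt ℂ a p.1) (i : ℕ) :
    HasFDerivAt (fun p : ℂ × ℂ => a p.1 * p.2 ^ i)
      (a p.1 • ((i * p.2 ^ (i - 1)) • ContinuousLinearMap.snd ℂ ℂ ℂ) +
        p.2 ^ i • (deriv a p.1 • ContinuousLinearMap.fst ℂ ℂ ℂ)) p := by
  have h1 : HasFDerivAt (fun p : ℂ × ℂ => a p.1)
      (deriv a p.1 • ContinuousLinearMap.fst ℂ ℂ ℂ) p :=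
    ha.hasDerivAt.comp_hasFDerivAt p hasFDerivAt_fst
  have h3 : HasFDerivAt (fun p : ℂ × ℂ => p.2 ^ i)
      ((i * p.2 ^ (i - 1)) • ContinuousLinearMap.snd ℂ ℂ ℂ) p :=
    (hasDerivAt_pow i p.2).comp_hasFDerivAt p hasFDerivAt_snd
  exact h1.mul h3

lemma norm_fderiv_coeff_mul_pow_le (A B w : ℂ) {M N q : ℝ} (i : ℕ) (hA : ‖A‖ ≤ M) (hB : ‖B‖ ≤ N)
    (hw : ‖w‖ ≤ q) (hq : 0 < q) :
    ‖A • ((i * w ^ (i - 1)) • ContinuousLinearMap.snd ℂ ℂ ℂ) +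
        w ^ i • (B • ContinuousLinearMap.fst ℂ ℂ ℂ)‖ ≤ M * (i * q ^ i * q⁻¹) + q ^ i * N := by
  have e1 : (i : ℝ) * q ^ (i - 1) = i * q ^ i * q⁻¹ := by
    rcases i with _ | i
    · simp
    · rw [Nat.add_sub_cancel, pow_succ]; field_simp
  have hM : 0 ≤ M := (norm_nonneg _).trans hA
  have hN : 0 ≤ N := (norm_nonneg _).trans hB
  have n1 := ContinuousLinearMap.norm_fst_le ℂ ℂ ℂ
  have n2 := ContinuousLinearMap.norm_snd_le ℂ ℂ ℂ
  refine (norm_add_le _ _).trans ?_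
  simp only [norm_smul, norm_mul, norm_pow, Complex.norm_natCast]
  calc _ ≤ M * (i * q ^ (i - 1) * 1) + q ^ i * (N * 1) := by gcongr
    _ = _ := by rw [mul_one, mul_one, e1]

lemma differentiableAt_tsum_mul_pow {a : ℕ → ℂ → ℂ} {z₀ w₀ : ℂ} {δ K E q : ℝ} (hδ : 0 < δ)
    (hE : 0 ≤ E) (ha : ∀ i, DifferentiableOn ℂ (a i) (ball z₀ δ))
    (hb : ∀ i, ∀ z ∈ ball z₀ δ, ‖a i z‖ ≤ K * E ^ (i + 1)) (hq : 0 < q) (hEq : E * q < 1)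
    (hw : ‖w₀‖ < q) :
    DifferentiableAt ℂ (fun p : ℂ × ℂ => ∑' i, a i p.1 * p.2 ^ i) (z₀, w₀) := by
  have hθ : 0 ≤ E * q := mul_nonneg hE hq.le
  have hsub : ∀ z ∈ ball z₀ (δ / 2), closedBall z (δ / 4) ⊆ ball z₀ δ := fun z hz w hw' => by
    have h1 := mem_ball.1 hz
    have h2 := mem_closedBall.1 hw'
    exact mem_ball.2 (by linarith [dist_triangle w z z₀])
  have hderiv : ∀ i, ∀ z ∈ ball z₀ (δ / 2), ‖deriv (a i) z‖ ≤ K * E ^ (i + 1) / (δ / 4) := by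
    intro i z hz
    refine Complex.norm_deriv_le_of_forall_mem_sphere_norm_le (by positivity) ?_
      fun w hw' => hb i w (hsub z hz (sphere_subset_closedBall hw'))
    refine DifferentiableOn.diffContOnCl ((ha i).mono ?_)
    exact closure_ball_subset_closedBall.trans (hsub z hz)
  have hx : (z₀, w₀) ∈ ball z₀ (δ / 2) ×ˢ ball (0 : ℂ) q :=
    ⟨mem_ball_self (by positivity), by simpa using hw⟩
  have hθ1 : ‖E * q‖ < 1 := by rwa [Real.norm_of_nonneg hθ]
  have hs1 : Summable fun i : ℕ => (i : ℝ) ^ 1 * (E * q) ^ i :=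
    summable_pow_mul_geometric_of_norm_lt_one 1 hθ1
  have hsum : Summable fun i : ℕ =>
      K * E * q⁻¹ * ((i : ℝ) ^ 1 * (E * q) ^ i) + K * E / (δ / 4) * (E * q) ^ i :=
    (hs1.mul_left _).add ((summable_geometric_of_lt_one hθ hEq).mul_left _)
  have hs0 := summable_norm_coeff_mul_pow hE (fun i => hb i z₀ (mem_ball_self hδ)) hq hEq hw
  have hbound : ∀ (i : ℕ), ∀ p ∈ ball z₀ (δ / 2) ×ˢ ball (0 : ℂ) q,
      ‖a i p.1 • ((i * p.2 ^ (i - 1)) • ContinuousLinearMap.snd ℂ ℂ ℂ) +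
        p.2 ^ i • (deriv (a i) p.1 • ContinuousLinearMap.fst ℂ ℂ ℂ)‖ ≤
      K * E * q⁻¹ * ((i : ℝ) ^ 1 * (E * q) ^ i) + K * E / (δ / 4) * (E * q) ^ i := by
    intro i p hp
    have hp2 : ‖p.2‖ ≤ q := by simpa using (mem_ball.1 hp.2).le
    have hp1 : p.1 ∈ ball z₀ δ := ball_subset_ball (by linarith) hp.1
    refine (norm_fderiv_coeff_mul_pow_le _ _ _ i (hb i _ hp1) (hderiv i _ hp.1) hp2 hq).trans_eq ?_
    rw [mul_pow, pow_one, pow_succ]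
    ring
  have hfd : ∀ (i : ℕ), ∀ p ∈ ball z₀ (δ / 2) ×ˢ ball (0 : ℂ) q,
      HasFDerivAt (fun p : ℂ × ℂ => a i p.1 * p.2 ^ i)
      (a i p.1 • ((i * p.2 ^ (i - 1)) • ContinuousLinearMap.snd ℂ ℂ ℂ) +
        p.2 ^ i • (deriv (a i) p.1 • ContinuousLinearMap.fst ℂ ℂ ℂ)) p := fun i p hp =>
    hasFDerivAt_coeff_mul_pow ((ha i).differentiableAt
      (isOpen_ball.mem_nhds (ball_subset_ball (by linarith) hp.1))) i
  have hpre : IsPreconnected (ball z₀ (δ / 2) ×ˢ ball (0 : ℂ) q) :=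
    (convex_ball _ _).isPreconnected.prod (convex_ball _ _).isPreconnected
  exact (hasFDerivAt_tsum_of_isPreconnected hsum (isOpen_ball.prod isOpen_ball) hpre
    hfd hbound hx hs0 hx).differentiableAt

/-- The Hartogs domain of a real-valued function. -/
def realHartogs (D : Set ℂ) (r : ℂ → ℝ) : Set (ℂ × ℂ) :=
  {p | p.1 ∈ D ∧ ‖p.2‖ < Real.exp (-r p.1)}

lemma isOpen_realHartogs {D : Set ℂ} {r : ℂ → ℝ} (hD : IsOpen D)
    (hr : UpperSemicontinuousOn r D) : IsOpen (realHartogs D r) := by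
  rw [isOpen_iff_mem_nhds]
  rintro ⟨z, w⟩ ⟨hz, hw⟩
  obtain ⟨q, hwq, hq⟩ := exists_between hw
  have hq0 : 0 < q := (norm_nonneg _).trans_lt hwq
  have h1 : r z < -Real.log q := by
    have := Real.log_lt_log hq0 hq
    rw [Real.log_exp] at this
    change Real.log q < - r z at this
    linarith
  have h2 := hr z hz _ h1
  rw [hD.nhdsWithin_eq hz] at h2
  have h3 : ∀ᶠ w' in 𝓝 w, ‖w'‖ < q := continuous_norm.continuousAt.eventually_lt_const hwq
  filter_upwards [((h2.and (hD.eventually_mem hz)).prod_nhds h3)] with p hp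
  refine ⟨hp.1.2, hp.2.trans ?_⟩
  rw [← Real.exp_log hq0]
  exact Real.exp_lt_exp.2 (by linarith [hp.1.1])

lemma lintegral_realHartogs_le {D : Set ℂ} {r : ℂ → ℝ} {a : ℂ → ℂ} {i : ℕ} {B : ℝ}
    (hD : IsOpen D) (hr : UpperSemicontinuousOn r D) (ha : ContinuousOn a D)
    (hai : IntegrableOn (fun z => ‖a z‖ ^ 2 * Real.exp (-(2 * (i + 1 : ℕ) * r z))) D)
    (hB : ∫ z in D, ‖a z‖ ^ 2 * Real.exp (-(2 * (i + 1 : ℕ) * r z)) ≤ B) :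
    ∫⁻ p in realHartogs D r, ENNReal.ofReal (‖a p.1 * p.2 ^ i‖ ^ 2) ≤
      ENNReal.ofReal (Real.pi * B) := by
  have hG := isOpen_realHartogs hD hr
  have hc : ContinuousOn (fun p : ℂ × ℂ => ENNReal.ofReal (‖a p.1 * p.2 ^ i‖ ^ 2))
      (realHartogs D r) := by
    refine ENNReal.continuous_ofReal.comp_continuousOn (ContinuousOn.pow (ContinuousOn.norm
      (ContinuousOn.mul (ha.comp continuousOn_fst fun p hp => hp.1) ?_)) 2)
    exact (continuous_snd.pow i).continuousOn
  have hm : AEMeasurable ((realHartogs D r).indicator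
      fun p : ℂ × ℂ => ENNReal.ofReal (‖a p.1 * p.2 ^ i‖ ^ 2)) (volume.prod volume) :=
    (aemeasurable_indicator_iff hG.measurableSet).2 (hc.aemeasurable hG.measurableSet)
  rw [← lintegral_indicator hG.measurableSet, Measure.volume_eq_prod, lintegral_prod _ hm]
  calc _ ≤ ∫⁻ z, D.indicator (fun z => ENNReal.ofReal
        (Real.pi * (‖a z‖ ^ 2 * Real.exp (-(2 * (i + 1 : ℕ) * r z))))) z := by
        refine lintegral_mono fun z => ?_
        by_cases hz : z ∈ D
        · rw [indicator_of_mem hz]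
          calc _ ≤ ∫⁻ w, (ball (0 : ℂ) (Real.exp (-r z))).indicator
                (fun _ => ENNReal.ofReal (‖a z‖ ^ 2 * Real.exp (-r z) ^ (2 * i))) w := by
                refine lintegral_mono fun w => ?_
                by_cases hw : ‖w‖ < Real.exp (-r z)
                · rw [indicator_of_mem (show w ∈ ball (0 : ℂ) _ by simpa using hw),
                    indicator_of_mem (show (z, w) ∈ realHartogs D r from ⟨hz, hw⟩)]
                  refine ENNReal.ofReal_le_ofReal ?_
                  rw [norm_mul, norm_pow, mul_pow, ← pow_mul, mul_comm i 2]
                  gcongr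
                · rw [indicator_of_notMem (show (z, w) ∉ realHartogs D r from fun h => hw h.2)]
                  exact zero_le
            _ = _ := by
                rw [lintegral_indicator measurableSet_ball, setLIntegral_const,
                  Complex.volume_ball, ← ENNReal.ofReal_pow (Real.exp_pos _).le]
                rw [show (↑NNReal.pi : ENNReal) = ENNReal.ofReal Real.pi by
                    rw [← NNReal.coe_real_pi, ENNReal.ofReal_coe_nnreal],
                  ← ENNReal.ofReal_mul (by positivity), ← ENNReal.ofReal_mul (by positivity)]
                congr 1
                rw [← Real.exp_nat_mul, ← Real.exp_nat_mul,
                  show -(2 * ((i + 1 : ℕ) : ℝ) * r z) = ((2 * i : ℕ) : ℝ) * -r z + (2 : ℕ) * -r z by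
                    push_cast; ring, Real.exp_add]
                ring
        · rw [indicator_of_notMem hz, lintegral_eq_zero_of_ae_eq_zero]
          refine ae_of_all _ fun w => ?_
          exact indicator_of_notMem (show (z, w) ∉ realHartogs D r from fun h => hz h.1) _
    _ = ENNReal.ofReal (∫ z in D, Real.pi *
          (‖a z‖ ^ 2 * Real.exp (-(2 * (i + 1 : ℕ) * r z)))) := by
        rw [lintegral_indicator hD.measurableSet, ofReal_integral_eq_lintegral_ofReal
          (hai.const_mul _) (ae_of_all _ fun z => by positivity)]
    _ ≤ _ := by
        rw [integral_const_mul]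
        gcongr

/-- Hartogs series with square-summable weighted coefficients are square-integrable holomorphic. -/
lemma exists_hartogs_series {D : Set ℂ} {r : ℂ → ℝ} {a : ℕ → ℂ → ℂ} {b : ℕ → ℝ} (hD : IsOpen D)
    (hr : UpperSemicontinuousOn r D) (ha : ∀ i, DifferentiableOn ℂ (a i) D)
    (hai : ∀ i, IntegrableOn (fun z => ‖a i z‖ ^ 2 * Real.exp (-(2 * (i + 1 : ℕ) * r z))) D)
    (hb0 : ∀ i, 0 ≤ b i) (hb : Summable b)
    (hab : ∀ i, ∫ z in D, ‖a i z‖ ^ 2 * Real.exp (-(2 * (i + 1 : ℕ) * r z)) ≤ b i ^ 2) :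
    ∃ f : ℂ × ℂ → ℂ, DifferentiableOn ℂ f (realHartogs D r) ∧
      IntegrableOn (fun p => ‖f p‖ ^ 2) (realHartogs D r) ∧
      ∀ p ∈ realHartogs D r, HasSum (fun i => a i p.1 * p.2 ^ i) (f p) := by
  have hG := isOpen_realHartogs hD hr
  have hloc : ∀ p ∈ realHartogs D r, Summable (fun i => a i p.1 * p.2 ^ i) ∧
      DifferentiableAt ℂ (fun p : ℂ × ℂ => ∑' i, a i p.1 * p.2 ^ i) p := by
    rintro ⟨z, w⟩ ⟨hz, hw⟩
    obtain ⟨q, hwq, hq⟩ := exists_between hw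
    have hq0 : 0 < q := (norm_nonneg _).trans_lt hwq
    have h1 : r z < -Real.log q := by
      have := Real.log_lt_log hq0 hq
      rw [Real.log_exp] at this
      change Real.log q < - r z at this
      linarith
    obtain ⟨s, hs1, hs2⟩ := exists_between h1
    have hB : ∀ i, ∫ z in D, ‖a i z‖ ^ 2 * Real.exp (-(2 * (i + 1 : ℕ) * r z)) ≤ (∑' i, b i) ^ 2 :=
      fun i => (hab i).trans (by
        have h := hb.le_tsum i fun j _ => hb0 j
        gcongr
        exact hb0 i)
    obtain ⟨δ, hδ, hδD, -, K, hK, hbd⟩ := exists_local_bound hD hr ha hai hB hz hs1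
    have hEq : Real.exp s * q < 1 := by
      rw [← Real.exp_log hq0, ← Real.exp_add, Real.exp_lt_one_iff]
      linarith
    have hbd' : ∀ i, ∀ z' ∈ ball z δ, ‖a i z'‖ ≤ K * Real.exp s ^ (i + 1) := fun i z' hz' => by
      rw [← Real.exp_nat_mul]; exact hbd i z' hz'
    exact ⟨summable_norm_coeff_mul_pow (Real.exp_pos _).le
        (fun i => hbd' i z (mem_ball_self hδ)) hq0 hEq hwq,
      differentiableAt_tsum_mul_pow hδ (Real.exp_pos _).le
        (fun i => (ha i).mono hδD) hbd' hq0 hEq hwq⟩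
  set f : ℂ × ℂ → ℂ := fun p => ∑' i, a i p.1 * p.2 ^ i with hf
  have hfd : DifferentiableOn ℂ f (realHartogs D r) := fun p hp =>
    (hloc p hp).2.differentiableWithinAt
  have hfs : ∀ p ∈ realHartogs D r, HasSum (fun i => a i p.1 * p.2 ^ i) (f p) := fun p hp =>
    (hloc p hp).1.hasSum
  refine ⟨f, hfd, ?_, hfs⟩
  have hfm : AEStronglyMeasurable f (volume.restrict (realHartogs D r)) :=
    hfd.continuousOn.aestronglyMeasurable hG.measurableSet
  refine (memLp_two_iff_integrable_sq_norm hfm).1 ⟨hfm, ?_⟩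
  have htm : ∀ i, AEStronglyMeasurable (fun p : ℂ × ℂ => a i p.1 * p.2 ^ i)
      (volume.restrict (realHartogs D r)) := fun i => by
    refine ContinuousOn.aestronglyMeasurable (ContinuousOn.mul
      ((ha i).continuousOn.comp continuousOn_fst fun p hp => hp.1) ?_) hG.measurableSet
    exact (continuous_snd.pow i).continuousOn
  have htL : ∀ i, eLpNorm (fun p : ℂ × ℂ => a i p.1 * p.2 ^ i) 2
      (volume.restrict (realHartogs D r)) ≤ ENNReal.ofReal (√Real.pi * b i) := fun i => by
    rw [eLpNorm_eq_lintegral_rpow_enorm_toReal (by norm_num) (by norm_num)]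
    have h1 := lintegral_realHartogs_le hD hr (ha i).continuousOn (hai i) (hab i)
    have h2 : ∀ x : ℂ, ‖x‖ₑ ^ (2 : ENNReal).toReal = ENNReal.ofReal (‖x‖ ^ 2) := fun x => by
      rw [ENNReal.ofReal_pow (norm_nonneg _), ofReal_norm, ENNReal.toReal_ofNat,
        ← ENNReal.rpow_natCast]
      norm_num
    simp only [h2]
    calc _ ≤ (ENNReal.ofReal (Real.pi * b i ^ 2)) ^ (1 / (2 : ENNReal).toReal) := by gcongr
      _ = _ := by
        rw [ENNReal.ofReal_rpow_of_nonneg (by positivity) (by positivity), ENNReal.toReal_ofNat,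
          ← Real.sqrt_eq_rpow, Real.sqrt_mul Real.pi_pos.le, Real.sqrt_sq (hb0 i)]
  have hlim := Lp.eLpNorm_lim_le_liminf_eLpNorm (p := 2) (μ := volume.restrict (realHartogs D r))
    (f := fun n => ∑ i ∈ Finset.range n, fun p : ℂ × ℂ => a i p.1 * p.2 ^ i)
    (fun n => Finset.aestronglyMeasurable_sum _ fun i _ => htm i) f (by
      refine (ae_restrict_iff' hG.measurableSet).2 (ae_of_all _ fun p hp => ?_)
      simpa only [Finset.sum_apply] using (hfs p hp).tendsto_sum_nat)
  refine (hlim.trans (liminf_le_of_frequently_le' (Frequently.of_forall fun n => ?_))).trans_lt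
    (ENNReal.ofReal_lt_top (r := √Real.pi * ∑' i, b i))
  refine (eLpNorm_sum_le (fun i _ => htm i) (by norm_num)).trans ?_
  refine (Finset.sum_le_sum fun i _ => htL i).trans ?_
  rw [← ENNReal.ofReal_sum_of_nonneg fun i _ => mul_nonneg (Real.sqrt_nonneg _) (hb0 i),
    ← Finset.mul_sum]
  gcongr
  exact hb.sum_le_tsum _ fun i _ => hb0 i

lemma measurable_indicator_of_upperSemicontinuousOn {D : Set ℂ} {r : ℂ → ℝ} (hD : IsOpen D)
    (hr : UpperSemicontinuousOn r D) : Measurable (D.indicator r) := by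
  refine measurable_of_Iio fun c => ?_
  have h1 : IsOpen (D ∩ {z | r z < c}) := by
    rw [isOpen_iff_mem_nhds]
    rintro z ⟨hz, hzc⟩
    have h2 := hr z hz c hzc
    rw [hD.nhdsWithin_eq hz] at h2
    filter_upwards [h2, hD.mem_nhds hz] with w h3 h4 using ⟨h4, h3⟩
  have h2 : D.indicator r ⁻¹' Iio c = (D ∩ {z | r z < c}) ∪ (Dᶜ ∩ {_z | 0 < c}) := by
    ext z
    by_cases hz : z ∈ D <;> simp [hz]
  rw [h2]
  exact h1.measurableSet.union (hD.measurableSet.compl.inter (MeasurableSet.const _))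

lemma CircleSub.translate {r : ℂ → ℝ} {D : Set ℂ} (h : CircleSub r D) (z₀ : ℂ) (M : ℝ) :
    CircleSub (fun z => r (z + z₀) - M) ((· + z₀) ⁻¹' D) := by
  intro c s hs hball φ hφ hle
  have e1 : ∀ x, circleMap (c + z₀) s x - z₀ = circleMap c s x := fun x => by
    simp only [circleMap]; ring
  have h1 := h (c + z₀) s hs (fun w hw => by
      have := hball (show w - z₀ ∈ closedBall c s by
        rw [mem_closedBall, dist_eq_norm] at *
        rwa [show w - z₀ - c = w - (c + z₀) by ring])
      simpa using this)
    (fun w => φ (w - z₀) + M) (by fun_prop) (fun w hw => by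
      have := hle (w - z₀) (by
        rw [mem_sphere, dist_eq_norm] at *
        rwa [show w - z₀ - c = w - (c + z₀) by ring])
      simp only [sub_add_cancel] at this
      linarith)
  simp only [e1] at h1
  rw [intervalIntegral.integral_add (Continuous.intervalIntegrable (by fun_prop) _ _)
    (by simp), intervalIntegral.integral_const] at h1
  simp only [sub_zero, smul_eq_mul] at h1
  linarith

lemma exists_holomorphic_at {D : Set ℂ} {r : ℂ → ℝ} {z₀ : ℂ} {M : ℝ} (hD : IsOpen D)
    (hz₀ : z₀ ∈ D) (hm : Measurable r) (hr : UpperSemicontinuousOn r D) (hM : ∀ z ∈ D, M ≤ r z)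
    (hs : CircleSub r D) (hnc : ∀ δ > 0, ¬ ∃ c, ∀ z ∈ ball z₀ δ, r z = c) :
    ∃ C, 0 ≤ C ∧ ∃ m : ℕ, ∀ j : ℕ, ∃ F : ℂ → ℂ, DifferentiableOn ℂ F D ∧ ‖F z₀‖ = cpi⁻¹ ∧
      IntegrableOn (fun z => ‖F z‖ ^ 2 * Real.exp (-(2 * (j + m + 1 : ℕ) * r z))) D ∧
      ∫ z in D, ‖F z‖ ^ 2 * Real.exp (-(2 * (j + m + 1 : ℕ) * r z)) ≤
        C * Real.exp (-(2 * j * r z₀)) := by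
  have hDo : IsOpen ((· + z₀) ⁻¹' D) := hD.preimage (continuous_id.add continuous_const)
  have husc : UpperSemicontinuousOn (fun z => r (z + z₀) - M) ((· + z₀) ⁻¹' D) := by
    intro z hz c hc
    have h1 := hr (z + z₀) hz (c + M) (by linarith)
    rw [hD.nhdsWithin_eq hz] at h1
    have h2 : Tendsto (· + z₀) (𝓝 z) (𝓝 (z + z₀)) :=
      (continuous_id.add continuous_const).continuousAt
    rw [hDo.nhdsWithin_eq hz]
    filter_upwards [h2.eventually h1] with w hw
    linarith
  obtain ⟨C, hC, m, hF⟩ := exists_holomorphic_of_nonconstant (u := fun z => r (z + z₀) - M) hDo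
    (by simpa using hz₀) ((hm.comp (measurable_id.add_const z₀)).sub_const M) husc
    (fun z hz => sub_nonneg.2 (hM _ hz)) (hs.translate z₀ M) (fun δ hδ => by
      rintro ⟨c, hc⟩
      refine hnc δ hδ ⟨c + M, fun z hz => ?_⟩
      have := hc (z - z₀) (by simpa [dist_eq_norm] using hz)
      simp only [sub_add_cancel] at this
      linarith)
  refine ⟨C * Real.exp (-(2 * (m + 1) * M)), by positivity, m, fun j => ?_⟩
  obtain ⟨F, hFd, hF0, hFi, hFC⟩ := hF j
  have hmp : MeasurePreserving (· + z₀) (volume : Measure ℂ) volume :=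
    measurePreserving_add_right volume z₀
  have hme : MeasurableEmbedding (· + z₀ : ℂ → ℂ) := measurableEmbedding_addRight z₀
  set g : ℂ → ℝ := fun z => ‖F (z - z₀)‖ ^ 2 * Real.exp (-(2 * (j + m : ℕ) * (r z - M))) with hg
  have hgF : ∀ z, g (z + z₀) =
      ‖F z‖ ^ 2 * Real.exp (-(2 * (j + m : ℕ) * (r (z + z₀) - M))) := fun z => by
    simp only [hg, add_sub_cancel_right]
  have hgi : IntegrableOn g D := by
    rw [← hmp.integrableOn_comp_preimage hme]
    refine hFi.congr (ae_of_all _ fun z => (hgF z).symm)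
  have hgC : ∫ z in D, g z ≤ C * Real.exp (-(2 * j * (r z₀ - M))) := by
    rw [← hmp.setIntegral_preimage_emb hme]
    simp only [hgF]
    simpa using hFC
  have hFd' : DifferentiableOn ℂ (fun z => F (z - z₀)) D := by
    refine hFd.comp (by fun_prop) fun z hz => ?_
    simpa using hz
  have hle : ∀ z ∈ D, ‖F (z - z₀)‖ ^ 2 * Real.exp (-(2 * (j + m + 1 : ℕ) * r z)) ≤
      Real.exp (-(2 * (j + m + 1) * M)) * g z := fun z hz => by
    rw [hg]
    simp only
    rw [mul_left_comm, ← Real.exp_add]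
    gcongr
    push_cast
    nlinarith [hM z hz]
  have hmeas : AEStronglyMeasurable
      (fun z => ‖F (z - z₀)‖ ^ 2 * Real.exp (-(2 * (j + m + 1 : ℕ) * r z))) (volume.restrict D) := by
    refine ((hFd'.continuousOn.norm.pow 2).aestronglyMeasurable hD.measurableSet).mul ?_
    exact (Real.measurable_exp.comp (hm.const_mul _).neg).aestronglyMeasurable
  have hint : IntegrableOn
      (fun z => ‖F (z - z₀)‖ ^ 2 * Real.exp (-(2 * (j + m + 1 : ℕ) * r z))) D := by
    refine (hgi.const_mul (Real.exp (-(2 * (j + m + 1) * M)))).mono' hmeas ?_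
    refine (ae_restrict_iff' hD.measurableSet).2 (ae_of_all _ fun z hz => ?_)
    rw [Real.norm_of_nonneg (by positivity)]
    exact hle z hz
  refine ⟨fun z => F (z - z₀), hFd', by simpa using hF0, hint, ?_⟩
  calc _ ≤ ∫ z in D, Real.exp (-(2 * (j + m + 1) * M)) * g z :=
        setIntegral_mono_on hint (hgi.const_mul _) hD.measurableSet hle
    _ ≤ Real.exp (-(2 * (j + m + 1) * M)) * (C * Real.exp (-(2 * j * (r z₀ - M)))) := by
        rw [integral_const_mul]
        gcongr
    _ = _ := by
        rw [mul_left_comm, ← Real.exp_add, mul_assoc C, ← Real.exp_add]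
        congr 2
        ring

lemma tendsto_growth_rate (s t : ℝ) (m : ℕ) :
    Tendsto (fun i : ℕ => (i : ℝ)⁻¹ * (((i : ℝ) - m) * s - 2 * Real.log (i + 1) + t)) atTop
      (𝓝 s) := by
  have h1 : Tendsto (fun i : ℕ => (i : ℝ)⁻¹) atTop (𝓝 0) := tendsto_inv_atTop_nhds_zero_nat
  have h2 : Tendsto (fun i : ℕ => Real.log ((i : ℝ) + 1) ^ 1 / (1 * ((i : ℝ) + 1) + -1)) atTop
      (𝓝 0) := (Real.tendsto_pow_log_div_mul_add_atTop 1 (-1) 1 one_ne_zero).comp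
    (tendsto_atTop_add_const_right _ _ tendsto_natCast_atTop_atTop)
  have h3 := ((h1.const_mul (-m * s + t)).sub (h2.const_mul 2)).const_add s
  simp only [mul_zero, sub_zero, add_zero] at h3
  refine h3.congr' ?_
  filter_upwards [eventually_gt_atTop 0] with i hi
  have hi' : (i : ℝ) ≠ 0 := by positivity
  rw [pow_one, show 1 * ((i : ℝ) + 1) + -1 = i by ring]
  field_simp
  ring

/-- A square-integrable Hartogs series whose coefficients have growth rate `r z₀` at `z₀`. -/
lemma exists_hartogs_series_growth {D : Set ℂ} {r : ℂ → ℝ} {z₀ : ℂ} {M : ℝ} (hD : IsOpen D)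
    (hz₀ : z₀ ∈ D) (hm : Measurable r) (hr : UpperSemicontinuousOn r D) (hM : ∀ z ∈ D, M ≤ r z)
    (hs : CircleSub r D) (hnc : ∀ δ > 0, ¬ ∃ c, ∀ z ∈ ball z₀ δ, r z = c) :
    ∃ (a : ℕ → ℂ → ℂ) (f : ℂ × ℂ → ℂ), (∀ i, DifferentiableOn ℂ (a i) D) ∧
      DifferentiableOn ℂ f (realHartogs D r) ∧
      IntegrableOn (fun p => ‖f p‖ ^ 2) (realHartogs D r) ∧
      (∀ p ∈ realHartogs D r, HasSum (fun i => a i p.1 * p.2 ^ i) (f p)) ∧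
      (∀ᶠ i in atTop, 0 < ‖a i z₀‖) ∧
      Tendsto (fun i : ℕ => (i : ℝ)⁻¹ * Real.log ‖a i z₀‖) atTop (𝓝 (r z₀)) := by
  obtain ⟨C, hC, m, hF⟩ := exists_holomorphic_at hD hz₀ hm hr hM hs hnc
  choose F hFd hF0 hFi hFC using hF
  set k : ℕ → ℝ := fun i => if i < m then 0 else
    Real.exp (((i : ℝ) - m) * r z₀) / (i + 1) ^ 2 with hk
  have hk0 : ∀ i, 0 ≤ k i := fun i => by
    rw [hk]; simp only; split_ifs <;> positivity
  set a : ℕ → ℂ → ℂ := fun i z => (k i : ℂ) * F (i - m) z with ha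
  have han : ∀ i z, ‖a i z‖ = k i * ‖F (i - m) z‖ := fun i z => by
    rw [ha]
    simp only [norm_mul, Complex.norm_real, Real.norm_of_nonneg (hk0 i)]
  have hwt : ∀ i z, ‖a i z‖ ^ 2 * Real.exp (-(2 * (i + 1 : ℕ) * r z)) =
      k i ^ 2 * (‖F (i - m) z‖ ^ 2 * Real.exp (-(2 * (i - m + m + 1 : ℕ) * r z))) := fun i z => by
    by_cases hi : i < m
    · have : k i = 0 := by simp [hk, hi]
      rw [han, this]; simp
    · rw [han, Nat.sub_add_cancel (not_lt.1 hi)]; ring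
  have had : ∀ i, DifferentiableOn ℂ (a i) D := fun i => (hFd _).const_mul _
  have hai : ∀ i, IntegrableOn (fun z => ‖a i z‖ ^ 2 * Real.exp (-(2 * (i + 1 : ℕ) * r z))) D :=
    fun i => by
      simp only [hwt]
      exact (hFi _).const_mul _
  have hab : ∀ i, ∫ z in D, ‖a i z‖ ^ 2 * Real.exp (-(2 * (i + 1 : ℕ) * r z)) ≤
      (√C * (1 / ((i + 1 : ℕ) : ℝ) ^ 2)) ^ 2 := fun i => by
    simp only [hwt]
    rw [integral_const_mul, mul_pow, Real.sq_sqrt hC]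
    refine (mul_le_mul_of_nonneg_left (hFC (i - m)) (by positivity)).trans ?_
    by_cases hi : i < m
    · have : k i = 0 := by simp [hk, hi]
      rw [this, zero_pow two_ne_zero, zero_mul]
      positivity
    · have : k i = Real.exp (((i : ℝ) - m) * r z₀) / (i + 1) ^ 2 := by simp [hk, hi]
      rw [this, Nat.cast_sub (not_lt.1 hi), div_pow, ← Real.exp_nat_mul]
      refine le_of_eq ?_
      rw [div_mul_eq_mul_div, mul_left_comm, ← Real.exp_add]
      push_cast
      rw [show (2 : ℝ) * (((i : ℝ) - m) * r z₀) + -(2 * ((i : ℝ) - m) * r z₀) = 0 by ring,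
        Real.exp_zero]
      field_simp
  have hbs : Summable fun i : ℕ => √C * (1 / ((i + 1 : ℕ) : ℝ) ^ 2) :=
    ((summable_nat_add_iff 1).2
      (Real.summable_one_div_nat_pow.2 one_lt_two)).mul_left _
  obtain ⟨f, hfd, hfi, hfs⟩ := exists_hartogs_series hD hr had hai
    (fun i => by positivity) hbs hab
  have hc := inv_pos.2 cpi_pos
  have hv : ∀ i, m ≤ i → ‖a i z₀‖ = Real.exp (((i : ℝ) - m) * r z₀) / (i + 1) ^ 2 * cpi⁻¹ :=
    fun i hi => by rw [han, hF0]; simp [hk, not_lt.2 hi]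
  refine ⟨a, f, had, hfd, hfi, hfs, ?_, ?_⟩
  · filter_upwards [eventually_ge_atTop m] with i hi
    rw [hv i hi]
    positivity
  · refine (tendsto_growth_rate (r z₀) (Real.log cpi⁻¹) m).congr' ?_
    filter_upwards [eventually_ge_atTop m] with i hi
    rw [hv i hi, Real.log_mul (by positivity) hc.ne', Real.log_div (by positivity) (by positivity),
      Real.log_exp, Real.log_pow]
    push_cast
    ring

lemma elog_lt_coe_iff {x s : ℝ} (hx : 0 ≤ x) : elog x < (s : EReal) ↔ x < Real.exp s := by
  unfold elog
  split_ifs with h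
  · have : x = 0 := le_antisymm h hx
    subst this
    simp [EReal.bot_lt_coe, Real.exp_pos]
  · push Not at h
    rw [EReal.coe_lt_coe_iff, Real.log_lt_iff_lt_exp h]

lemma hartogs_eq_realHartogs {D : Set ℂ} {ρ : ℂ → EReal} {r : ℂ → ℝ}
    (h : ∀ z ∈ D, ρ z = (r z : EReal)) : hartogs D ρ = realHartogs D r := by
  ext p
  refine and_congr_right fun hp => ?_
  rw [h _ hp, ← EReal.coe_neg, elog_lt_coe_iff (norm_nonneg _)]

lemma SubmeanOn.circleSub {D : Set ℂ} {ρ : ℂ → EReal} {r : ℂ → ℝ} (hρ : SubmeanOn ρ D)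
    (h : ∀ z ∈ D, ρ z = (r z : EReal)) : CircleSub r D := by
  intro c s hs hball φ hφ hle
  have h1 := hρ c s hs hball (fun x => φ (circleMap c s x))
    (hφ.comp (continuous_circleMap c s)) fun x => by
      have hmem : circleMap c s x ∈ sphere c s := circleMap_mem_sphere c hs.le x
      change ρ (circleMap c s x) ≤ _
      rw [h _ (hball (sphere_subset_closedBall hmem)), EReal.coe_le_coe_iff]
      exact hle _ hmem
  rw [h c (hball (mem_closedBall_self hs.le)), EReal.coe_le_coe_iff] at h1
  rwa [inv_mul_eq_div, le_div_iff₀ Real.two_pi_pos, mul_comm] at h1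

lemma le_uscReg (g : ℂ → EReal) (z : ℂ) : g z ≤ uscReg g z := by
  rw [uscReg]
  refine le_limsup_of_frequently_le ?_
  exact (Frequently.filter_mono (f := pure z) (by simp [Filter.frequently_pure]) (pure_le_nhds z))

lemma uscReg_le_of_le {D : Set ℂ} {g ρ : ℂ → EReal} (hD : IsOpen D)
    (hρ : UpperSemicontinuousOn ρ D) (h : ∀ z ∈ D, g z ≤ ρ z) {z : ℂ} (hz : z ∈ D) :
    uscReg g z ≤ ρ z := by
  refine le_of_forall_gt_imp_ge_of_dense fun c hc => ?_
  have h1 := hρ z hz c hc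
  rw [hD.nhdsWithin_eq hz] at h1
  refine limsup_le_of_le (by isBoundedDefault) ?_
  filter_upwards [h1, hD.mem_nhds hz] with w hw hwD
  exact (h w hwD).trans hw.le

lemma coeffGrowth_le {D : Set ℂ} {ρ : ℂ → EReal} {r : ℂ → ℝ} (h : ∀ z ∈ D, ρ z = (r z : EReal))
    {f : ℂ × ℂ → ℂ} {fj : ℕ → ℂ → ℂ} (hf : HartogsExpansion D ρ f fj) {z : ℂ} (hz : z ∈ D) :
    coeffGrowth fj z ≤ ρ z := by
  rw [h z hz]
  refine EReal.le_of_forall_lt_iff_le.1 fun c hc => ?_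
  rw [EReal.coe_lt_coe_iff] at hc
  have hp : ((z, ((Real.exp (-c) : ℝ) : ℂ)) : ℂ × ℂ) ∈ hartogs D ρ := by
    rw [hartogs_eq_realHartogs h]
    refine ⟨hz, ?_⟩
    simp only [Complex.norm_real, Real.norm_of_nonneg (Real.exp_pos _).le]
    exact Real.exp_lt_exp.2 (by linarith)
  have h1 := (hf.2 _ hp).summable.tendsto_atTop_zero.norm
  rw [norm_zero] at h1
  refine limsup_le_of_le (by isBoundedDefault) ?_
  filter_upwards [h1.eventually_lt_const one_pos, eventually_gt_atTop 0] with j hj hj0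
  simp only [norm_mul, norm_pow, Complex.norm_real, Real.norm_of_nonneg (Real.exp_pos _).le] at hj
  have hj0' : (0 : ℝ) < j := by exact_mod_cast hj0
  rw [elog]
  split_ifs with h2
  · rw [EReal.coe_mul_bot_of_pos (inv_pos.2 hj0')]
    exact bot_le
  · push Not at h2
    rw [← EReal.coe_mul, EReal.coe_le_coe_iff]
    have h3 := Real.log_lt_log (by positivity) hj
    rw [Real.log_mul h2.ne' (by positivity), Real.log_pow, Real.log_exp, Real.log_one] at h3
    rw [inv_mul_le_iff₀ hj0']
    linarith

lemma coeffGrowth_eq_of_tendsto {fj : ℕ → ℂ → ℂ} {z : ℂ} {s : ℝ} (h0 : ∀ᶠ i in atTop, 0 < ‖fj i z‖)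
    (h : Tendsto (fun i : ℕ => (i : ℝ)⁻¹ * Real.log ‖fj i z‖) atTop (𝓝 s)) :
    coeffGrowth fj z = s := by
  refine Tendsto.limsup_eq (((continuous_coe_real_ereal.tendsto s).comp h).congr' ?_)
  filter_upwards [h0] with i hi
  rw [elog, if_neg (not_le.2 hi), ← EReal.coe_mul]
  rfl

/-- **Lemma 4.** If `ρ` is subharmonic on the domain `D`, bounded from below,
and not constant near `z₀ ∈ D` (no open connected neighborhood of `z₀` in `D` on which `ρ`
is constant), then `ρ(z₀) = ρ̃*(z₀)`. -/
theorem lemma4 (D : Set ℂ) (hDopen : IsOpen D) (hDconn : IsConnected D)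
    (ρ : ℂ → EReal) (hρ : SubharmonicOn ρ D) (hbd : ∃ M : ℝ, ∀ z ∈ D, (M : EReal) ≤ ρ z)
    (z₀ : ℂ) (hz₀ : z₀ ∈ D)
    (hnc : ¬ ∃ U : Set ℂ, IsOpen U ∧ IsConnected U ∧ z₀ ∈ U ∧ U ⊆ D ∧
        ∃ c : EReal, ∀ z ∈ U, ρ z = c) :
    ρ z₀ = uscReg (rhoTilde D ρ) z₀ := by
  obtain ⟨M, hM⟩ := hbd
  obtain ⟨-, husc, htop, -, hsub⟩ := hρ
  set r : ℂ → ℝ := D.indicator fun z => (ρ z).toReal with hr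
  have hρr : ∀ z ∈ D, ρ z = (r z : EReal) := fun z hz => by
    rw [hr, indicator_of_mem hz, EReal.coe_toReal (htop z hz)]
    exact ((EReal.bot_lt_coe M).trans_le (hM z hz)).ne'
  have hMr : ∀ z ∈ D, M ≤ r z := fun z hz => by
    have := hM z hz
    rwa [hρr z hz, EReal.coe_le_coe_iff] at this
  have hrusc : UpperSemicontinuousOn r D := fun z hz c hc => by
    have h1 := husc z hz (c : EReal) (by
      change ρ z < c
      rwa [hρr z hz, EReal.coe_lt_coe_iff])
    rw [hDopen.nhdsWithin_eq hz] at h1 ⊢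
    filter_upwards [h1, hDopen.mem_nhds hz] with w hw hwD
    rwa [hρr w hwD, EReal.coe_lt_coe_iff] at hw
  have hrm : Measurable r := by
    have := measurable_indicator_of_upperSemicontinuousOn hDopen hrusc
    rwa [hr, indicator_indicator, inter_self] at this
  have hle : ∀ z ∈ D, rhoTilde D ρ z ≤ ρ z := fun z hz =>
    iSup₂_le fun fj hfj => by
      obtain ⟨f, -, hf⟩ := hfj
      exact uscReg_le_of_le hDopen husc (fun w hw => coeffGrowth_le hρr hf hw) hz
  refine le_antisymm ?_ (uscReg_le_of_le hDopen husc hle hz₀)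
  obtain ⟨a, f, had, hfd, hfi, hfs, ha0, hat⟩ := exists_hartogs_series_growth hDopen hz₀ hrm hrusc
    hMr (hsub.circleSub hρr) fun δ hδ => by
      rintro ⟨c, hc⟩
      obtain ⟨ε, hε, hεD⟩ := Metric.isOpen_iff.1 hDopen z₀ hz₀
      refine hnc ⟨ball z₀ (min δ ε), isOpen_ball, (convex_ball _ _).isConnected
        ⟨z₀, mem_ball_self (lt_min hδ hε)⟩, mem_ball_self (lt_min hδ hε),
        (ball_subset_ball (min_le_right _ _)).trans hεD, c, fun z hz => ?_⟩
      rw [hρr z (hεD (ball_subset_ball (min_le_right _ _) hz)),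
        hc z (ball_subset_ball (min_le_left _ _) hz)]
  have hG := hartogs_eq_realHartogs hρr
  calc ρ z₀ = coeffGrowth a z₀ := by rw [coeffGrowth_eq_of_tendsto ha0 hat, hρr z₀ hz₀]
    _ ≤ uscReg (coeffGrowth a) z₀ := le_uscReg _ _
    _ ≤ rhoTilde D ρ z₀ := by
        refine le_iSup₂_of_le (f := fun fj _ => uscReg (coeffGrowth fj) z₀) a
          ⟨f, ⟨?_, ?_⟩, had, ?_⟩ le_rfl
        all_goals rw [hG]; assumption
    _ ≤ _ := le_uscReg _ _
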